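/- Corollary (complete sfl RDT frame, unit norms): in the r-th level interpolating setup, assume ‖x^{(i)}‖₂ = 1 for all x^{(i)} ∈ X and ‖y^{(i)}‖₂ = 1 for all y^{(i)} ∈ Y, and let t ↦ (p̄(t), q̄(t), 𝔪̄(t)) be differentiable paths of admissible parameters with p̄₀(t) = q̄₀(t) = 𝔪̄₀(t) = 1 and p̄_{r+1}(t) = q̄_{r+1}(t) = 𝔪̄_{r+1}(t) = 0 such that at every t ∈ (0,1) the partial derivatives of ψ₁ with respect to each p_{k₁}, q_{k₁}, 𝔪_{k₁} (1 ≤ k₁ ≤ r) vanish and φ_{k₁}^{(r)} = 0 for all k₁ ∈ {1,…,r+1} (so that ψ₁ is constant along the path). Then ψ_S(X,Y,p̄(1),q̄(1),𝔪̄(1),β,s,1) = −(sign(s) s β/(2√n)) Σ_{k=1}^{r+1} ( p̄_{k−1}(0)q̄_{k−1}(0) − p̄_k(0)q̄_k(0) ) 𝔪̄_k(0) + ψ_S(X,Y,p̄(0),q̄(0),𝔪̄(0),β,s,0), where ψ_S is the version of ψ with the u^{(4,k)} terms removed from D₀. -/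

import Mathlib

set_option linter.unusedVariables false

open MeasureTheory Real

namespace SFLR

noncomputable section

/-- The sample space of one group `𝒰_k = (u^{(4,k)}, u^{(2,k)}, h^{(k)})`. -/
abbrev Us (m n : ℕ) : Type := ℝ × (Fin m → ℝ) × (Fin n → ℝ)

/-- Standard Gaussian measure on `ℝ`. -/
def stdG : Measure ℝ := ProbabilityTheory.gaussianReal 0 1

/-- i.i.d. standard Gaussian vector measure. -/
def gVec (d : ℕ) : Measure (Fin d → ℝ) := Measure.pi fun _ => stdG

/-- i.i.d. standard Gaussian matrix measure. -/
def gMat (m n : ℕ) : Measure (Fin m → Fin n → ℝ) := Measure.pi fun _ => gVec n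

/-- Law of one group `𝒰_k`. -/
def muU (m n : ℕ) : Measure (Us m n) := stdG.prod ((gVec m).prod (gVec n))

/-- Joint law of `(G, (𝒰_k)_{k=1}^{r+1})`; the `k`-th group `𝒰_k` is coordinate `k-1`. -/
def muAll (r m n : ℕ) : Measure ((Fin m → Fin n → ℝ) × (Fin (r+1) → Us m n)) :=
  (gMat m n).prod (Measure.pi fun _ : Fin (r+1) => muU m n)

/-- Euclidean norm. -/
def nrm2 {d : ℕ} (v : Fin d → ℝ) : ℝ := Real.sqrt (∑ i, v i ^ 2)

/-- Euclidean inner product. -/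
def dotv {d : ℕ} (a b : Fin d → ℝ) : ℝ := ∑ i, a i * b i

variable {m n l : ℕ}

/-- The `r`-th level interpolating exponent `D₀^{(i₁,i₂)}`; the factor `ε` multiplies the
`u^{(4,k)}`-terms (`ε = 1` gives `D₀`, `ε = 0` gives `D_{0,S}`). -/
def D0R (r : ℕ) (ε β s t : ℝ) (mv p q : ℕ → ℝ) (x : Fin l → Fin n → ℝ) (y : Fin l → Fin m → ℝ)
    (G : Fin m → Fin n → ℝ) (U : Fin (r+1) → Us m n) (i1 i2 : Fin l) : ℝ :=
  Real.sqrt t * (∑ j, ∑ k, y i2 j * (G j k * x i1 k))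
    + Real.sqrt (1 - t) * nrm2 (x i1) *
        (∑ j, y i2 j * (∑ k : Fin (r+1), Real.sqrt (p (k : ℕ) - p ((k : ℕ) + 1)) * (U k).2.1 j))
    + ε * (Real.sqrt t * nrm2 (x i1) * nrm2 (y i2) *
        (∑ k : Fin (r+1),
          Real.sqrt (p (k : ℕ) * q (k : ℕ) - p ((k : ℕ) + 1) * q ((k : ℕ) + 1)) * (U k).1))
    + Real.sqrt (1 - t) * nrm2 (y i2) *
        (∑ kk, (∑ k : Fin (r+1), Real.sqrt (q (k : ℕ) - q ((k : ℕ) + 1)) * (U k).2.2 kk) * x i1 kk)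

/-- `A^{(i₁,i₂)}`. -/
def AR (r : ℕ) (ε β s t : ℝ) (mv p q : ℕ → ℝ) (x : Fin l → Fin n → ℝ) (y : Fin l → Fin m → ℝ)
    (G : Fin m → Fin n → ℝ) (U : Fin (r+1) → Us m n) (i1 i2 : Fin l) : ℝ :=
  Real.exp (β * D0R r ε β s t mv p q x y G U i1 i2)

/-- `C^{(i₁)}`. -/
def CR (r : ℕ) (ε β s t : ℝ) (mv p q : ℕ → ℝ) (x : Fin l → Fin n → ℝ) (y : Fin l → Fin m → ℝ)
    (G : Fin m → Fin n → ℝ) (U : Fin (r+1) → Us m n) (i1 : Fin l) : ℝ :=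
  ∑ i2, AR r ε β s t mv p q x y G U i1 i2

/-- `Z`. -/
def ZR (r : ℕ) (ε β s t : ℝ) (mv p q : ℕ → ℝ) (x : Fin l → Fin n → ℝ) (y : Fin l → Fin m → ℝ)
    (G : Fin m → Fin n → ℝ) (U : Fin (r+1) → Us m n) : ℝ :=
  ∑ i1, CR r ε β s t mv p q x y G U i1 ^ s

/-- `ζ_k`: successively integrated partition functions, `ζ₀ = Z`,
`ζ_k = E_{𝒰_k} ζ_{k-1}^{𝔪_k/𝔪_{k-1}}`. -/
def zetaR (r : ℕ) (ε β s t : ℝ) (mv p q : ℕ → ℝ) (x : Fin l → Fin n → ℝ)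
    (y : Fin l → Fin m → ℝ) (G : Fin m → Fin n → ℝ) : ℕ → (Fin (r+1) → Us m n) → ℝ
  | 0, U => ZR r ε β s t mv p q x y G U
  | k+1, U =>
      if h : k < r + 1 then
        ∫ u, zetaR r ε β s t mv p q x y G k (Function.update U ⟨k, h⟩ u) ^ (mv (k+1) / mv k)
          ∂ muU m n
      else 0

/-- The `r`-th level interpolating function `ψ`. -/
def psiR (r : ℕ) (ε β s t : ℝ) (mv p q : ℕ → ℝ) (x : Fin l → Fin n → ℝ)
    (y : Fin l → Fin m → ℝ) : ℝ :=
  ∫ ω, (β * |s| * Real.sqrt (n : ℝ) * mv r)⁻¹ *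
      Real.log (zetaR r ε β s t mv p q x y ω.1 r ω.2) ∂ muAll r m n

/-- The operator `Φ_{𝒰_k}` (for `k ≥ 1`). -/
def PhiR (r : ℕ) (ε β s t : ℝ) (mv p q : ℕ → ℝ) (x : Fin l → Fin n → ℝ)
    (y : Fin l → Fin m → ℝ) (k : ℕ)
    (f : (Fin m → Fin n → ℝ) → (Fin (r+1) → Us m n) → ℝ) :
    (Fin m → Fin n → ℝ) → (Fin (r+1) → Us m n) → ℝ :=
  fun G U =>
    if h : k - 1 < r + 1 then
      (∫ u, zetaR r ε β s t mv p q x y G (k-1) (Function.update U ⟨k-1, h⟩ u) ^ (mv k / mv (k-1))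
          * f G (Function.update U ⟨k-1, h⟩ u) ∂ muU m n) /
        zetaR r ε β s t mv p q x y G k U
    else 0

/-- `Φ_{𝒰_hi} ∘ ⋯ ∘ Φ_{𝒰_lo}` (identity when `hi < lo`). -/
def PhiUpToR (r : ℕ) (ε β s t : ℝ) (mv p q : ℕ → ℝ) (x : Fin l → Fin n → ℝ)
    (y : Fin l → Fin m → ℝ) (lo : ℕ) :
    ℕ → ((Fin m → Fin n → ℝ) → (Fin (r+1) → Us m n) → ℝ) →
      (Fin m → Fin n → ℝ) → (Fin (r+1) → Us m n) → ℝ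
  | 0, f => f
  | hi+1, f =>
      if hi + 1 < lo then f
      else PhiR r ε β s t mv p q x y (hi+1) (PhiUpToR r ε β s t mv p q x y lo hi f)

/-- `γ₀(i₁,i₂)`. -/
def gam0R (r : ℕ) (ε β s t : ℝ) (mv p q : ℕ → ℝ) (x : Fin l → Fin n → ℝ)
    (y : Fin l → Fin m → ℝ) (i1 i2 : Fin l) :
    (Fin m → Fin n → ℝ) → (Fin (r+1) → Us m n) → ℝ :=
  fun G U =>
    CR r ε β s t mv p q x y G U i1 ^ s / ZR r ε β s t mv p q x y G U *
      (AR r ε β s t mv p q x y G U i1 i2 / CR r ε β s t mv p q x y G U i1)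

/-- The measure `γ_{k₁+1}^{(r)}`. -/
def gamR (r : ℕ) (ε β s t : ℝ) (mv p q : ℕ → ℝ) (x : Fin l → Fin n → ℝ)
    (y : Fin l → Fin m → ℝ) (k1 : ℕ) (i1 i2 pp1 pp2 : Fin l) :
    (Fin m → Fin n → ℝ) → (Fin (r+1) → Us m n) → ℝ :=
  PhiUpToR r ε β s t mv p q x y (k1+1) r
    (fun G U =>
      PhiUpToR r ε β s t mv p q x y 1 k1 (gam0R r ε β s t mv p q x y i1 i2) G U *
        PhiUpToR r ε β s t mv p q x y 1 k1 (gam0R r ε β s t mv p q x y pp1 pp2) G U)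

/-- The measure `γ₀₁^{(r)}`. -/
def gam01R (r : ℕ) (ε β s t : ℝ) (mv p q : ℕ → ℝ) (x : Fin l → Fin n → ℝ)
    (y : Fin l → Fin m → ℝ) (i1 i2 : Fin l) :
    (Fin m → Fin n → ℝ) → (Fin (r+1) → Us m n) → ℝ :=
  PhiUpToR r ε β s t mv p q x y 1 r (gam0R r ε β s t mv p q x y i1 i2)

/-- The measure `γ₀₂^{(r)}`. -/
def gam02R (r : ℕ) (ε β s t : ℝ) (mv p q : ℕ → ℝ) (x : Fin l → Fin n → ℝ)
    (y : Fin l → Fin m → ℝ) (i1 i2 p2 : Fin l) :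
    (Fin m → Fin n → ℝ) → (Fin (r+1) → Us m n) → ℝ :=
  PhiUpToR r ε β s t mv p q x y 1 r
    (fun G U =>
      gam0R r ε β s t mv p q x y i1 i2 G U * gam0R r ε β s t mv p q x y i1 p2 G U)

/-- `E_{G,𝒰_{r+1}} ⟨f⟩_{γ_{k₁+1}^{(r)}}`. -/
def EBrR (r : ℕ) (ε β s t : ℝ) (mv p q : ℕ → ℝ) (x : Fin l → Fin n → ℝ)
    (y : Fin l → Fin m → ℝ) (k1 : ℕ) (f : Fin l → Fin l → Fin l → Fin l → ℝ) : ℝ :=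
  ∫ ω, (∑ i1, ∑ i2, ∑ pp1, ∑ pp2,
      f i1 i2 pp1 pp2 * gamR r ε β s t mv p q x y k1 i1 i2 pp1 pp2 ω.1 ω.2) ∂ muAll r m n

/-- `E_{G,𝒰_{r+1}} ⟨f⟩_{γ₀₁^{(r)}}`. -/
def EB01R (r : ℕ) (ε β s t : ℝ) (mv p q : ℕ → ℝ) (x : Fin l → Fin n → ℝ)
    (y : Fin l → Fin m → ℝ) (f : Fin l → Fin l → ℝ) : ℝ :=
  ∫ ω, (∑ i1, ∑ i2, f i1 i2 * gam01R r ε β s t mv p q x y i1 i2 ω.1 ω.2) ∂ muAll r m n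

/-- `E_{G,𝒰_{r+1}} ⟨f⟩_{γ₀₂^{(r)}}`. -/
def EB02R (r : ℕ) (ε β s t : ℝ) (mv p q : ℕ → ℝ) (x : Fin l → Fin n → ℝ)
    (y : Fin l → Fin m → ℝ) (f : Fin l → Fin l → Fin l → ℝ) : ℝ :=
  ∫ ω, (∑ i1, ∑ i2, ∑ p2, f i1 i2 p2 * gam02R r ε β s t mv p q x y i1 i2 p2 ω.1 ω.2)
    ∂ muAll r m n

/-- `E_{G,𝒰_{r+1}} ⟨‖x^{(i₁)}‖‖x^{(p₁)}‖‖y^{(i₂)}‖‖y^{(p₂)}‖⟩_{γ_{k₁+1}^{(r)}}`. -/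
def EXR (r : ℕ) (ε β s t : ℝ) (mv p q : ℕ → ℝ) (x : Fin l → Fin n → ℝ)
    (y : Fin l → Fin m → ℝ) (k1 : ℕ) : ℝ :=
  EBrR r ε β s t mv p q x y k1
    (fun i1 i2 pp1 pp2 => nrm2 (x i1) * nrm2 (x pp1) * nrm2 (y i2) * nrm2 (y pp2))

/-- The corrected interpolating function `ψ₁`. -/
def psi1R (r : ℕ) (ε β s t : ℝ) (mv p q : ℕ → ℝ) (x : Fin l → Fin n → ℝ)
    (y : Fin l → Fin m → ℝ) : ℝ :=
  -(Real.sign s * s * β / (2 * Real.sqrt (n : ℝ))) *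
      (∑ k ∈ Finset.range (r+1),
        mv (k+1) * (p k * q k * EXR r ε β s t mv p q x y k
          - p (k+1) * q (k+1) * EXR r ε β s t mv p q x y (k+1)))
    + psiR r ε β s t mv p q x y

/-- The component `u_j^{(2,k)}`. -/
def u2c {r m n : ℕ} (U : Fin (r+1) → Us m n) (k : ℕ) (j : Fin m) : ℝ :=
  if h : k - 1 < r + 1 then (U ⟨k-1, h⟩).2.1 j else 0

/-- The scalar `u^{(4,k)}`. -/
def u4c {r m n : ℕ} (U : Fin (r+1) → Us m n) (k : ℕ) : ℝ :=
  if h : k - 1 < r + 1 then (U ⟨k-1, h⟩).1 else 0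

/-- `u^{(i₁,3,k)} = (h^{(k)})ᵀ x^{(i₁)} / ‖x^{(i₁)}‖₂`. -/
def u3c {r m n l : ℕ} (x : Fin l → Fin n → ℝ) (U : Fin (r+1) → Us m n) (k : ℕ)
    (i1 : Fin l) : ℝ :=
  if h : k - 1 < r + 1 then dotv (U ⟨k-1, h⟩).2.2 (x i1) / nrm2 (x i1) else 0

/-- The nested conditional expectations
`E_{𝒰_v}(ζ_{v-1}^{𝔪_v/𝔪_{v-1}-1} ⋯ E_{𝒰₁}(ζ₀^{𝔪₁/𝔪₀-1} g) ⋯)`. -/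
def nestR (r : ℕ) (ε β s t : ℝ) (mv p q : ℕ → ℝ) (x : Fin l → Fin n → ℝ)
    (y : Fin l → Fin m → ℝ) (g : (Fin m → Fin n → ℝ) → (Fin (r+1) → Us m n) → ℝ) :
    ℕ → (Fin m → Fin n → ℝ) → (Fin (r+1) → Us m n) → ℝ
  | 0 => g
  | v+1 => fun G U =>
      if h : v < r + 1 then
        ∫ u, zetaR r ε β s t mv p q x y G v (Function.update U ⟨v, h⟩ u) ^
              (mv (v+1) / mv v - 1) *
            nestR r ε β s t mv p q x y g v G (Function.update U ⟨v, h⟩ u) ∂ muU m n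
      else 0

/-- `T^p_{k,1,j}(i₁,i₂)` at the `r`-th level. -/
def TpR (r : ℕ) (ε β s t : ℝ) (mv p q : ℕ → ℝ) (x : Fin l → Fin n → ℝ)
    (y : Fin l → Fin m → ℝ) (k : ℕ) (j : Fin m) (i1 i2 : Fin l) : ℝ :=
  ∫ ω, (zetaR r ε β s t mv p q x y ω.1 r ω.2)⁻¹ *
      nestR r ε β s t mv p q x y
        (fun G U => CR r ε β s t mv p q x y G U i1 ^ (s - 1) *
          AR r ε β s t mv p q x y G U i1 i2 * y i2 j * u2c U k j) r ω.1 ω.2 ∂ muAll r m n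

/-- `T^q_{k,2}(i₁,i₂)` at the `r`-th level. -/
def TqR (r : ℕ) (ε β s t : ℝ) (mv p q : ℕ → ℝ) (x : Fin l → Fin n → ℝ)
    (y : Fin l → Fin m → ℝ) (k : ℕ) (i1 i2 : Fin l) : ℝ :=
  ∫ ω, (zetaR r ε β s t mv p q x y ω.1 r ω.2)⁻¹ *
      nestR r ε β s t mv p q x y
        (fun G U => CR r ε β s t mv p q x y G U i1 ^ (s - 1) *
          AR r ε β s t mv p q x y G U i1 i2 * u3c x U k i1) r ω.1 ω.2 ∂ muAll r m n

/-- `T^{(p,q)}_{k,3}(i₁,i₂)` at the `r`-th level. -/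
def TpqR (r : ℕ) (ε β s t : ℝ) (mv p q : ℕ → ℝ) (x : Fin l → Fin n → ℝ)
    (y : Fin l → Fin m → ℝ) (k : ℕ) (i1 i2 : Fin l) : ℝ :=
  ∫ ω, (zetaR r ε β s t mv p q x y ω.1 r ω.2)⁻¹ *
      nestR r ε β s t mv p q x y
        (fun G U => CR r ε β s t mv p q x y G U i1 ^ (s - 1) *
          AR r ε β s t mv p q x y G U i1 i2 * u4c U k) r ω.1 ω.2 ∂ muAll r m n


instance instPstdG : IsProbabilityMeasure stdG := by unfold stdG; infer_instance
instance instPgVec (d : ℕ) : IsProbabilityMeasure (gVec d) := by unfold gVec; infer_instance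
instance instPgMat (a b : ℕ) : IsProbabilityMeasure (gMat a b) := by unfold gMat; infer_instance
instance instPmuU (a b : ℕ) : IsProbabilityMeasure (muU a b) := by unfold muU; infer_instance
instance instPmuAll (r a b : ℕ) : IsProbabilityMeasure (muAll r a b) := by
  unfold muAll; infer_instance

instance instOstdG : stdG.IsOpenPosMeasure := by
  unfold stdG
  exact (ProbabilityTheory.gaussianReal_absolutelyContinuous' 0 one_ne_zero).isOpenPosMeasure

/-- Standard Gaussian vector indexed by a finite type. -/
def gA (A : Type) [Fintype A] : Measure (A → ℝ) := Measure.pi fun _ => stdG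

instance instPgA (A : Type) [Fintype A] : IsProbabilityMeasure (gA A) := by
  unfold gA; infer_instance
instance instOgA (A : Type) [Fintype A] : (gA A).IsOpenPosMeasure := by
  unfold gA; infer_instance

/-- The `ℓ¹` norm. -/
def NN {A : Type} [Fintype A] (w : A → ℝ) : ℝ := ∑ a, |w a|

lemma NN_nonneg {A : Type} [Fintype A] (w : A → ℝ) : 0 ≤ NN w :=
  Finset.sum_nonneg fun _ _ => abs_nonneg _

lemma NN_add {A : Type} [Fintype A] (w v : A → ℝ) : NN (w + v) ≤ NN w + NN v := by
  unfold NN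
  rw [← Finset.sum_add_distrib]
  exact Finset.sum_le_sum fun a _ => abs_add_le _ _

lemma NN_cont {A : Type} [Fintype A] : Continuous (NN : (A → ℝ) → ℝ) := by
  unfold NN; fun_prop

lemma abs_le_NN {A : Type} [Fintype A] (w : A → ℝ) (a : A) : |w a| ≤ NN w :=
  Finset.single_le_sum (f := fun a => |w a|) (fun _ _ => abs_nonneg _) (Finset.mem_univ a)

lemma int_exp_abs (K : ℝ) : Integrable (fun z : ℝ => Real.exp (K * |z|)) stdG := by
  apply ProbabilityTheory.integrable_exp_mul_abs (X := fun z : ℝ => z)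
  · exact ProbabilityTheory.integrable_exp_mul_gaussianReal K
  · exact ProbabilityTheory.integrable_exp_mul_gaussianReal (-K)

lemma int_exp_NN {A : Type} [Fintype A] (K : ℝ) :
    Integrable (fun g : A → ℝ => Real.exp (K * NN g)) (gA A) := by
  have := Integrable.fintype_prod (ι := A) (𝕜 := ℝ) (f := fun _ z => Real.exp (K * |z|))
    (μ := fun _ => stdG) (fun _ => int_exp_abs K)
  refine this.congr (Filter.Eventually.of_forall fun g => ?_)
  simp only [NN, Finset.mul_sum, Real.exp_sum]

lemma int_of_bdE {A : Type} [Fintype A] {F : (A → ℝ) → ℝ} (hF : Continuous F) {K K' : ℝ}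
    (hb : ∀ g, |F g| ≤ K' * Real.exp (K * NN g)) : Integrable F (gA A) :=
  ((int_exp_NN K).const_mul K').mono' hF.aestronglyMeasurable
    (Filter.Eventually.of_forall hb)

lemma int_of_bd1 {F : ℝ → ℝ} (hF : Continuous F) {K K' : ℝ}
    (hb : ∀ g, |F g| ≤ K' * Real.exp (K * |g|)) : Integrable F stdG :=
  ((int_exp_abs K).const_mul K').mono' hF.aestronglyMeasurable
    (Filter.Eventually.of_forall hb)

lemma hasDerivAt_pdf (z : ℝ) : HasDerivAt (ProbabilityTheory.gaussianPDFReal 0 1)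
    (-z * ProbabilityTheory.gaussianPDFReal 0 1 z) z := by
  have h : ProbabilityTheory.gaussianPDFReal 0 1 =
      fun x => (Real.sqrt (2 * π * (1:NNReal)))⁻¹ * Real.exp (-(x - 0) ^ 2 / (2 * (1:NNReal))) := by
    funext x; simp [ProbabilityTheory.gaussianPDFReal]
  rw [h]
  have h1 : HasDerivAt (fun x : ℝ => -(x - 0) ^ 2 / (2 * (1:NNReal))) (-z) z := by
    have := (((hasDerivAt_id z).sub_const 0).pow 2).neg.div_const (2 * ((1:NNReal):ℝ))
    refine this.congr_deriv ?_
    simp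
    ring
  exact (h1.exp.const_mul _).congr_deriv (by ring)

lemma integrable_stdG_iff (F : ℝ → ℝ) : Integrable F stdG ↔
    Integrable (fun z => ProbabilityTheory.gaussianPDFReal 0 1 z * F z) := by
  unfold stdG
  rw [ProbabilityTheory.gaussianReal_of_var_ne_zero _ one_ne_zero,
    integrable_withDensity_iff_integrable_smul' (ProbabilityTheory.measurable_gaussianPDF _ _)
      (ae_of_all _ fun _ ↦ ProbabilityTheory.gaussianPDF_lt_top)]
  simp [ProbabilityTheory.toReal_gaussianPDF]

lemma integral_stdG (F : ℝ → ℝ) : ∫ z, F z ∂stdG =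
    ∫ z, ProbabilityTheory.gaussianPDFReal 0 1 z * F z := by
  unfold stdG
  rw [ProbabilityTheory.integral_gaussianReal_eq_integral_smul one_ne_zero]
  rfl

lemma stein1 {F F' : ℝ → ℝ} (hd : ∀ z, HasDerivAt F (F' z) z) (h1 : Integrable F stdG)
    (h2 : Integrable F' stdG) (h3 : Integrable (fun z => z * F z) stdG) :
    ∫ z, z * F z ∂stdG = ∫ z, F' z ∂stdG := by
  rw [integrable_stdG_iff] at h1 h2 h3
  rw [integral_stdG, integral_stdG]
  have := integral_mul_deriv_eq_deriv_mul_of_integrable (u := F)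
    (v := ProbabilityTheory.gaussianPDFReal 0 1) (u' := F')
    (v' := fun z => -z * ProbabilityTheory.gaussianPDFReal 0 1 z)
    (fun x _ => hd x) (fun x _ => hasDerivAt_pdf x)
    (h3.neg.congr (Filter.Eventually.of_forall fun z => by simp; ring))
    (h2.congr (Filter.Eventually.of_forall fun z => by simp; ring))
    (h1.congr (Filter.Eventually.of_forall fun z => by simp; ring))
  have e1 : ∫ z, ProbabilityTheory.gaussianPDFReal 0 1 z * (z * F z) =
      - ∫ z, F z * (-z * ProbabilityTheory.gaussianPDFReal 0 1 z) := by
    rw [← integral_neg]; congr 1; funext z; ring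
  rw [e1, this, neg_neg]
  congr 1; funext z; ring

lemma mp_update {A : Type} [Fintype A] [DecidableEq A] (a : A) :
    MeasurePreserving (fun p : (A → ℝ) × ℝ => Function.update p.1 a p.2)
      ((gA A).prod stdG) (gA A) := by
  have hm : Measurable (fun p : (A → ℝ) × ℝ => Function.update p.1 a p.2) := by
    apply measurable_pi_lambda
    intro b
    by_cases h : b = a
    · subst h; simpa using measurable_snd
    · simp only [Function.update_of_ne h]
      exact (measurable_pi_apply b).comp measurable_fst
  refine ⟨hm, ?_⟩
  unfold gA
  refine (Measure.pi_eq fun s hs => ?_).symm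
  rw [Measure.map_apply hm (MeasurableSet.univ_pi hs)]
  have : (fun p : (A → ℝ) × ℝ => Function.update p.1 a p.2) ⁻¹' (Set.univ.pi s) =
      (Set.univ.pi (Function.update s a Set.univ)) ×ˢ (s a) := by
    ext p
    simp only [Set.mem_preimage, Set.mem_pi, Set.mem_univ, true_imp_iff, Set.mem_prod]
    constructor
    · intro h
      refine ⟨fun b => ?_, by simpa using h a⟩
      by_cases hb : b = a
      · subst hb; simp
      · simpa [hb] using h b
    · rintro ⟨h1, h2⟩ b
      by_cases hb : b = a
      · subst hb; simpa using h2
      · simpa [hb] using h1 b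
  rw [this, Measure.prod_prod, Measure.pi_pi]
  rw [← Finset.mul_prod_erase _ _ (Finset.mem_univ a)]
  rw [← Finset.mul_prod_erase (a := a) (f := fun i => stdG (s i)) _ (Finset.mem_univ a)]
  simp only [Function.update_self, measure_univ, one_mul]
  rw [mul_comm]
  congr 1
  refine Finset.prod_congr rfl fun b hb => ?_
  rw [Function.update_of_ne (Finset.ne_of_mem_erase hb)]

lemma stein {A : Type} [Fintype A] [DecidableEq A] (a : A) {F F' : (A → ℝ) → ℝ}
    (hF : Continuous F) (hF' : Continuous F') {K K' : ℝ} (hK : 0 ≤ K)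
    (hb : ∀ g, |F g| ≤ K' * Real.exp (K * NN g)) (hb' : ∀ g, |F' g| ≤ K' * Real.exp (K * NN g))
    (hd : ∀ g z, HasDerivAt (fun z => F (Function.update g a z)) (F' (Function.update g a z)) z) :
    ∫ g, g a * F g ∂(gA A) = ∫ g, F' g ∂(gA A) := by
  have hK' : 0 ≤ K' := by
    have := (abs_nonneg _).trans (hb 0)
    by_contra h
    push Not at h
    have h2 := Real.exp_pos (K * NN (0 : A → ℝ))
    nlinarith
  have hNu : ∀ (g : A → ℝ) (z : ℝ), NN (Function.update g a z) ≤ NN g + |z| := by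
    intro g z
    unfold NN
    rw [← Finset.add_sum_erase _ _ (Finset.mem_univ a),
      ← Finset.add_sum_erase (a := a) (f := fun a => |g a|) _ (Finset.mem_univ a)]
    have : ∑ x ∈ Finset.univ.erase a, |Function.update g a z x| =
        ∑ x ∈ Finset.univ.erase a, |g x| :=
      Finset.sum_congr rfl fun b hb => by rw [Function.update_of_ne (Finset.ne_of_mem_erase hb)]
    rw [this]
    simp only [Function.update_self]
    have := abs_nonneg (g a)
    linarith
  have hbz : ∀ z : ℝ, |z| ≤ Real.exp |z| := fun z => by
    have := Real.add_one_le_exp |z|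
    linarith
  have hi1 : Integrable (fun g : A → ℝ => g a * F g) (gA A) := by
    refine int_of_bdE (K := K + 1) (K' := K') (by fun_prop) fun g => ?_
    rw [abs_mul]
    have h1 : |g a| ≤ Real.exp (NN g) := (hbz _).trans (Real.exp_le_exp.2 (abs_le_NN g a))
    calc |g a| * |F g| ≤ Real.exp (NN g) * (K' * Real.exp (K * NN g)) := by
          gcongr; exact hb g
      _ = K' * Real.exp ((K + 1) * NN g) := by rw [add_mul, Real.exp_add]; ring_nf
  have hi2 : Integrable F' (gA A) := int_of_bdE hF' hb'
  have mp := mp_update a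
  have hcu : Continuous (fun p : (A → ℝ) × ℝ => Function.update p.1 a p.2) := by fun_prop
  have e1 := integral_map (μ := (gA A).prod stdG) (f := fun g => g a * F g)
    mp.measurable.aemeasurable (by rw [mp.map_eq]; exact hi1.aestronglyMeasurable)
  have e2 := integral_map (μ := (gA A).prod stdG) (f := F')
    mp.measurable.aemeasurable (by rw [mp.map_eq]; exact hi2.aestronglyMeasurable)
  rw [mp.map_eq] at e1 e2
  rw [e1, e2, integral_prod, integral_prod]
  · congr 1
    funext g
    simp only [Function.update_self]
    have bnd : ∀ z : ℝ, ∀ v, v ≤ K' * Real.exp (K * NN (Function.update g a z)) →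
        v ≤ (K' * Real.exp (K * NN g)) * Real.exp (K * |z|) := by
      intro z v hv
      refine hv.trans ?_
      rw [mul_assoc, ← Real.exp_add]
      gcongr
      rw [← mul_add]
      exact mul_le_mul_of_nonneg_left (hNu g z) hK
    have cu : Continuous (fun z : ℝ => Function.update g a z) := by fun_prop
    apply stein1 (F := fun z => F (Function.update g a z))
      (F' := fun z => F' (Function.update g a z)) (hd g)
    · exact int_of_bd1 (hF.comp cu) (fun z => bnd z _ (hb _))
    · exact int_of_bd1 (hF'.comp cu) (fun z => bnd z _ (hb' _))
    · refine int_of_bd1 (K := K + 1) (K' := K' * Real.exp (K * NN g))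
        (continuous_id.mul (hF.comp cu)) fun z => ?_
      have := bnd z _ (hb _)
      calc |z * F (Function.update g a z)| = |z| * |F (Function.update g a z)| := abs_mul _ _
        _ ≤ Real.exp |z| * ((K' * Real.exp (K * NN g)) * Real.exp (K * |z|)) := by
            gcongr; exact hbz z
        _ = _ := by rw [add_mul, Real.exp_add]; ring_nf
  · exact (mp.integrable_comp hi2.aestronglyMeasurable).2 hi2
  · exact (mp.integrable_comp hi1.aestronglyMeasurable).2 hi1

open Filter Topology in
/-- Continuous families with locally uniform linear growth. -/
structure LG {Θ A : Type} [TopologicalSpace Θ] [Fintype A] (S : Set Θ)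
    (f : Θ → (A → ℝ) → ℝ) : Prop where
  cont : ContinuousOn (fun p : Θ × (A → ℝ) => f p.1 p.2) (S ×ˢ Set.univ)
  bd : ∀ θ₀ ∈ S, ∃ K : ℝ, 0 ≤ K ∧ ∀ᶠ θ in 𝓝[S] θ₀, ∀ w, |f θ w| ≤ K * (1 + NN w)

open Filter Topology in
/-- Continuous families with locally uniform exponential growth. -/
structure EG {Θ A : Type} [TopologicalSpace Θ] [Fintype A] (S : Set Θ)
    (f : Θ → (A → ℝ) → ℝ) : Prop where
  cont : ContinuousOn (fun p : Θ × (A → ℝ) => f p.1 p.2) (S ×ˢ Set.univ)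
  bd : ∀ θ₀ ∈ S, ∃ K : ℝ, 0 ≤ K ∧ ∀ᶠ θ in 𝓝[S] θ₀, ∀ w, |f θ w| ≤ K * Real.exp (K * NN w)

/-- Shift by scaled noise. -/
def sh {A : Type} (w σ g : A → ℝ) : A → ℝ := fun a => w a + σ a * g a

/-- Tilted expectation (unnormalised). -/
def EE {A : Type} [Fintype A] (μ : ℝ) (σ : A → ℝ) (f h : (A → ℝ) → ℝ) (w : A → ℝ) : ℝ :=
  ∫ g, Real.exp (μ * f (sh w σ g)) * h (sh w σ g) ∂(gA A)

/-- Tilted expectation (normalised). -/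
def Phi {A : Type} [Fintype A] (μ : ℝ) (σ : A → ℝ) (f h : (A → ℝ) → ℝ) (w : A → ℝ) : ℝ :=
  EE μ σ f h w / EE μ σ f (fun _ => 1) w

/-- One step of the Parisi recursion. -/
def TT {A : Type} [Fintype A] (μ : ℝ) (σ : A → ℝ) (f : (A → ℝ) → ℝ) (w : A → ℝ) : ℝ :=
  if μ = 0 then EE 0 σ f f w else Real.log (EE μ σ f (fun _ => 1) w) / μ

section mach
open Filter Topology
variable {Θ A : Type} [TopologicalSpace Θ] [Fintype A] {S : Set Θ}

lemma LG.cont1 {f : Θ → (A → ℝ) → ℝ} (hf : LG S f) {θ : Θ} (hθ : θ ∈ S) : Continuous (f θ) := by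
  rw [continuous_iff_continuousAt]
  intro w
  have h1 : ContinuousWithinAt (fun p : Θ × (A → ℝ) => f p.1 p.2) (S ×ˢ Set.univ) (θ, w) :=
    hf.cont (θ, w) ⟨hθ, trivial⟩
  have h2 : ContinuousWithinAt (fun v : A → ℝ => (θ, v)) Set.univ w := by fun_prop
  rw [← continuousWithinAt_univ]
  exact ContinuousWithinAt.comp (f := fun v : A → ℝ => (θ, v)) h1 h2
    (fun v _ => ⟨hθ, trivial⟩)

lemma LG.eg {f : Θ → (A → ℝ) → ℝ} (hf : LG S f) : EG S f := by
  refine ⟨hf.cont, fun θ₀ h0 => ?_⟩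
  obtain ⟨K, hK, hb⟩ := hf.bd θ₀ h0
  refine ⟨K + 1, by linarith, hb.mono fun θ h w => (h w).trans ?_⟩
  have h1 := NN_nonneg w
  have h2 := Real.add_one_le_exp ((K + 1) * NN w)
  have h3 : 1 + NN w ≤ Real.exp ((K + 1) * NN w) := by nlinarith
  calc K * (1 + NN w) ≤ (K + 1) * (1 + NN w) := by nlinarith
    _ ≤ _ := by gcongr

lemma EG.cont1 {f : Θ → (A → ℝ) → ℝ} (hf : EG S f) {θ : Θ} (hθ : θ ∈ S) : Continuous (f θ) := by
  rw [continuous_iff_continuousAt]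
  intro w
  have h1 : ContinuousWithinAt (fun p : Θ × (A → ℝ) => f p.1 p.2) (S ×ˢ Set.univ) (θ, w) :=
    hf.cont (θ, w) ⟨hθ, trivial⟩
  have h2 : ContinuousWithinAt (fun v : A → ℝ => (θ, v)) Set.univ w := by fun_prop
  rw [← continuousWithinAt_univ]
  exact ContinuousWithinAt.comp (f := fun v : A → ℝ => (θ, v)) h1 h2
    (fun v _ => ⟨hθ, trivial⟩)

lemma EG.cont2 {f : Θ → (A → ℝ) → ℝ} (hf : EG S f) (w : A → ℝ) :
    ContinuousOn (fun θ => f θ w) S := by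
  have : ContinuousOn (fun θ : Θ => (θ, w)) S := by fun_prop
  exact hf.cont.comp this (fun θ h => ⟨h, trivial⟩)

lemma bdE_mono {K K' x : ℝ} (hK : 0 ≤ K) (h : K ≤ K') (hx : 0 ≤ x) :
    K * Real.exp (K * x) ≤ K' * Real.exp (K' * x) := by
  have : K * x ≤ K' * x := mul_le_mul_of_nonneg_right h hx
  have h2 := Real.exp_le_exp.2 this
  have := Real.exp_pos (K * x)
  nlinarith [Real.exp_pos (K' * x)]

lemma EG.mul {f h : Θ → (A → ℝ) → ℝ} (hf : EG S f) (hh : EG S h) :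
    EG S (fun θ w => f θ w * h θ w) := by
  refine ⟨hf.cont.mul hh.cont, fun θ₀ h0 => ?_⟩
  obtain ⟨K, hK, hb⟩ := hf.bd θ₀ h0
  obtain ⟨K', hK', hb'⟩ := hh.bd θ₀ h0
  refine ⟨K * K' + K + K', by positivity, ?_⟩
  filter_upwards [hb, hb'] with θ h1 h2 w
  rw [abs_mul]
  have hN := NN_nonneg w
  calc |f θ w| * |h θ w| ≤ (K * Real.exp (K * NN w)) * (K' * Real.exp (K' * NN w)) :=
        mul_le_mul (h1 w) (h2 w) (abs_nonneg _) (by positivity)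
    _ = (K * K') * Real.exp ((K + K') * NN w) := by rw [add_mul, Real.exp_add]; ring
    _ ≤ (K * K' + K + K') * Real.exp ((K * K' + K + K') * NN w) := by
        gcongr
        · linarith
        · nlinarith [mul_nonneg hK hK']

lemma EG.add {f h : Θ → (A → ℝ) → ℝ} (hf : EG S f) (hh : EG S h) :
    EG S (fun θ w => f θ w + h θ w) := by
  refine ⟨hf.cont.add hh.cont, fun θ₀ h0 => ?_⟩
  obtain ⟨K, hK, hb⟩ := hf.bd θ₀ h0
  obtain ⟨K', hK', hb'⟩ := hh.bd θ₀ h0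
  refine ⟨K + K', by positivity, ?_⟩
  filter_upwards [hb, hb'] with θ h1 h2 w
  have hN := NN_nonneg w
  have e1 : Real.exp (K * NN w) ≤ Real.exp ((K + K') * NN w) := by gcongr; linarith
  have e2 : Real.exp (K' * NN w) ≤ Real.exp ((K + K') * NN w) := by gcongr; linarith
  calc |f θ w + h θ w| ≤ |f θ w| + |h θ w| := abs_add_le _ _
    _ ≤ K * Real.exp (K * NN w) + K' * Real.exp (K' * NN w) := add_le_add (h1 w) (h2 w)
    _ ≤ K * Real.exp ((K + K') * NN w) + K' * Real.exp ((K + K') * NN w) := by gcongr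
    _ = _ := by ring

lemma EG.of_scalar {c : Θ → ℝ} (hc : ContinuousOn c S) : EG S (fun θ (_ : A → ℝ) => c θ) := by
  refine ⟨hc.comp continuousOn_fst (fun p hp => hp.1), fun θ₀ h0 => ?_⟩
  refine ⟨|c θ₀| + 1, by positivity, ?_⟩
  have h1 : ∀ᶠ θ in 𝓝[S] θ₀, |c θ| < |c θ₀| + 1 :=
    ((hc θ₀ h0).abs).eventually (gt_mem_nhds (by linarith))
  filter_upwards [h1] with θ h w
  have hN := NN_nonneg w
  have : 1 ≤ Real.exp ((|c θ₀| + 1) * NN w) := Real.one_le_exp (by positivity)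
  have := abs_nonneg (c θ₀)
  nlinarith

lemma EG.one : EG S (fun (_ : Θ) (_ : A → ℝ) => (1:ℝ)) := EG.of_scalar continuousOn_const

lemma EG.smul {c : Θ → ℝ} (hc : ContinuousOn c S) {f : Θ → (A → ℝ) → ℝ} (hf : EG S f) :
    EG S (fun θ w => c θ * f θ w) := (EG.of_scalar hc).mul hf

lemma EG.sub {f h : Θ → (A → ℝ) → ℝ} (hf : EG S f) (hh : EG S h) :
    EG S (fun θ w => f θ w - h θ w) := by
  have := hf.add (hh.smul (c := fun _ => -1) continuousOn_const)
  refine (by simpa [sub_eq_add_neg] using this)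

lemma NN_sh {w σ g : A → ℝ} {M : ℝ} (hσ : ∀ a, |σ a| ≤ M) : NN (sh w σ g) ≤ NN w + M * NN g := by
  unfold NN sh
  rw [Finset.mul_sum, ← Finset.sum_add_distrib]
  refine Finset.sum_le_sum fun a _ => (abs_add_le _ _).trans ?_
  rw [abs_mul]
  have := mul_le_mul_of_nonneg_right (hσ a) (abs_nonneg (g a))
  linarith

lemma ev_sigma {σ : Θ → A → ℝ} (hσ : ContinuousOn σ S) {θ₀ : Θ} (h0 : θ₀ ∈ S) :
    ∃ M : ℝ, 0 ≤ M ∧ ∀ᶠ θ in 𝓝[S] θ₀, ∀ a, |σ θ a| ≤ M := by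
  refine ⟨NN (σ θ₀) + 1, by have := NN_nonneg (σ θ₀); linarith, ?_⟩
  have h1 : ContinuousWithinAt (fun θ => NN (σ θ)) S θ₀ :=
    NN_cont.continuousAt.comp_continuousWithinAt (hσ θ₀ h0)
  filter_upwards [h1.eventually (gt_mem_nhds (lt_add_one _))] with θ h a
  exact (abs_le_NN _ a).trans h.le

lemma ev_mu {μ : Θ → ℝ} (hμ : ContinuousOn μ S) {θ₀ : Θ} (h0 : θ₀ ∈ S) :
    ∃ M : ℝ, 0 ≤ M ∧ ∀ᶠ θ in 𝓝[S] θ₀, |μ θ| ≤ M := by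
  refine ⟨|μ θ₀| + 1, by positivity, ?_⟩
  filter_upwards [((hμ θ₀ h0).abs).eventually (gt_mem_nhds (lt_add_one _))] with θ h
  exact h.le

/-- Locally uniform bound on the exponent. -/
lemma LG.sh_bd {f : Θ → (A → ℝ) → ℝ} (hf : LG S f) {μ : Θ → ℝ} {σ : Θ → A → ℝ}
    (hμ : ContinuousOn μ S) (hσ : ContinuousOn σ S) {θ₀ : Θ} (h0 : θ₀ ∈ S) :
    ∃ K : ℝ, 0 ≤ K ∧ ∀ᶠ θ in 𝓝[S] θ₀, ∀ w g,
      |μ θ * f θ (sh w (σ θ) g)| ≤ K * (1 + NN w + NN g) := by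
  obtain ⟨K, hK, hb⟩ := hf.bd θ₀ h0
  obtain ⟨M, hM, hs⟩ := ev_sigma hσ h0
  obtain ⟨M', hM', hm⟩ := ev_mu hμ h0
  refine ⟨M' * K * (1 + M), by positivity, ?_⟩
  filter_upwards [hb, hs, hm] with θ h1 h2 h3 w g
  rw [abs_mul]
  have hN := NN_nonneg w
  have hN' := NN_nonneg g
  have h4 := NN_sh (w := w) (g := g) h2
  calc |μ θ| * |f θ (sh w (σ θ) g)| ≤ M' * (K * (1 + NN (sh w (σ θ) g))) :=
        mul_le_mul h3 (h1 _) (abs_nonneg _) hM'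
    _ ≤ M' * (K * ((1 + M) * (1 + NN w + NN g))) := by
        gcongr
        nlinarith [mul_nonneg hM hN]
    _ = _ := by ring

lemma EG.sh_bd {h : Θ → (A → ℝ) → ℝ} (hh : EG S h) {σ : Θ → A → ℝ}
    (hσ : ContinuousOn σ S) {θ₀ : Θ} (h0 : θ₀ ∈ S) :
    ∃ K : ℝ, 0 ≤ K ∧ ∀ᶠ θ in 𝓝[S] θ₀, ∀ w g,
      |h θ (sh w (σ θ) g)| ≤ K * Real.exp (K * NN w) * Real.exp (K * NN g) := by
  obtain ⟨K, hK, hb⟩ := hh.bd θ₀ h0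
  obtain ⟨M, hM, hs⟩ := ev_sigma hσ h0
  refine ⟨K * (1 + M), by positivity, ?_⟩
  filter_upwards [hb, hs] with θ h1 h2 w g
  have hN := NN_nonneg w
  have hN' := NN_nonneg g
  have h4 := NN_sh (w := w) (g := g) h2
  refine (h1 _).trans ?_
  rw [mul_assoc, ← Real.exp_add]
  have h5 : K ≤ K * (1 + M) := by nlinarith
  refine mul_le_mul h5 (Real.exp_le_exp.2 ?_) (Real.exp_pos _).le (by positivity)
  calc K * NN (sh w (σ θ) g) ≤ K * (NN w + M * NN g) := by gcongr
    _ ≤ _ := by nlinarith [mul_nonneg hK hN, mul_nonneg hK hN', mul_nonneg (mul_nonneg hK hM) hN]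

/-- Locally uniform bound on the integrand of `EE`. -/
lemma EE_bd {f h : Θ → (A → ℝ) → ℝ} (hf : LG S f) (hh : EG S h) {μ : Θ → ℝ} {σ : Θ → A → ℝ}
    (hμ : ContinuousOn μ S) (hσ : ContinuousOn σ S) {θ₀ : Θ} (h0 : θ₀ ∈ S) :
    ∃ K : ℝ, 0 ≤ K ∧ ∀ᶠ θ in 𝓝[S] θ₀, ∀ w g,
      |Real.exp (μ θ * f θ (sh w (σ θ) g)) * h θ (sh w (σ θ) g)|
        ≤ K * Real.exp (K * NN w) * Real.exp (K * NN g) := by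
  obtain ⟨K, hK, hb⟩ := hf.sh_bd hμ hσ h0
  obtain ⟨K', hK', hb'⟩ := hh.sh_bd hσ h0
  refine ⟨Real.exp K * K' + K + K', by positivity, ?_⟩
  filter_upwards [hb, hb'] with θ h1 h2 w g
  have hN := NN_nonneg w
  have hN' := NN_nonneg g
  rw [abs_mul, Real.abs_exp]
  have e0 : 0 ≤ Real.exp K * K' := by positivity
  calc Real.exp (μ θ * f θ (sh w (σ θ) g)) * |h θ (sh w (σ θ) g)|
      ≤ Real.exp (K * (1 + NN w + NN g)) *
        (K' * Real.exp (K' * NN w) * Real.exp (K' * NN g)) :=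
        mul_le_mul (Real.exp_le_exp.2 ((le_abs_self _).trans (h1 w g))) (h2 w g)
          (abs_nonneg _) (Real.exp_pos _).le
    _ = (Real.exp K * K') * Real.exp ((K + K') * NN w) * Real.exp ((K + K') * NN g) := by
        rw [show K * (1 + NN w + NN g) = K + K * NN w + K * NN g by ring, add_mul, add_mul,
          Real.exp_add, Real.exp_add, Real.exp_add, Real.exp_add]
        ring
    _ ≤ _ := by
        gcongr
        · linarith
        · linarith
        · linarith

lemma sh_cont : Continuous (fun p : (A → ℝ) × (A → ℝ) × (A → ℝ) => sh p.1 p.2.1 p.2.2) := by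
  unfold sh; fun_prop

lemma sh_cont_g (w σ : A → ℝ) : Continuous (fun g => sh w σ g) := by
  unfold sh; fun_prop

lemma integrand_cont {f h : Θ → (A → ℝ) → ℝ} (hf : LG S f) (hh : EG S h) {θ : Θ} (hθ : θ ∈ S)
    (c : ℝ) (w σ : A → ℝ) :
    Continuous (fun g => Real.exp (c * f θ (sh w σ g)) * h θ (sh w σ g)) := by
  have h1 := (hf.cont1 hθ).comp (sh_cont_g w σ)
  have h2 := (hh.cont1 hθ).comp (sh_cont_g w σ)
  exact (Real.continuous_exp.comp (continuous_const.mul h1)).mul h2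

lemma EE_int {f h : Θ → (A → ℝ) → ℝ} (hf : LG S f) (hh : EG S h) {θ : Θ} (hθ : θ ∈ S)
    (c : ℝ) (w σ : A → ℝ) :
    Integrable (fun g => Real.exp (c * f θ (sh w σ g)) * h θ (sh w σ g)) (gA A) := by
  obtain ⟨K, hK, hb⟩ := EE_bd hf hh (μ := fun _ => c) (σ := fun _ => σ) continuousOn_const
    continuousOn_const hθ
  exact int_of_bdE (integrand_cont hf hh hθ c w σ)
    (fun g => (hb.self_of_nhdsWithin hθ) w g)

lemma EE_EG [FirstCountableTopology Θ] {f h : Θ → (A → ℝ) → ℝ} (hf : LG S f) (hh : EG S h)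
    {μ : Θ → ℝ} {σ : Θ → A → ℝ} (hμ : ContinuousOn μ S) (hσ : ContinuousOn σ S) :
    EG S (fun θ w => EE (μ θ) (σ θ) (f θ) (h θ) w) := by
  constructor
  · rintro ⟨θ₀, w₀⟩ ⟨h0, -⟩
    obtain ⟨K, hK, hb⟩ := EE_bd hf hh hμ hσ h0
    have hfst : Tendsto (Prod.fst : Θ × (A → ℝ) → Θ) (𝓝[S ×ˢ Set.univ] (θ₀, w₀)) (𝓝[S] θ₀) := by
      refine tendsto_nhdsWithin_iff.2 ⟨?_, ?_⟩
      · exact continuous_fst.continuousAt.tendsto.mono_left nhdsWithin_le_nhds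
      · filter_upwards [self_mem_nhdsWithin] with p hp using hp.1
    have hw : ∀ᶠ p in 𝓝[S ×ˢ Set.univ] ((θ₀, w₀) : Θ × (A → ℝ)), NN p.2 < NN w₀ + 1 := by
      have : ContinuousAt (fun p : Θ × (A → ℝ) => NN p.2) (θ₀, w₀) :=
        (NN_cont.comp continuous_snd).continuousAt
      exact nhdsWithin_le_nhds (this.eventually (gt_mem_nhds (lt_add_one _)))
    unfold EE
    refine continuousWithinAt_of_dominated (bound := fun g =>
      K * Real.exp (K * (NN w₀ + 1)) * Real.exp (K * NN g)) ?_ ?_ ?_ ?_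
    · filter_upwards [self_mem_nhdsWithin] with p hp
      exact (integrand_cont hf hh hp.1 _ _ _).aestronglyMeasurable
    · filter_upwards [hfst.eventually hb, hw] with p h1 h2
      refine Filter.Eventually.of_forall fun g => (h1 p.2 g).trans ?_
      gcongr
    · exact (int_exp_NN K).const_mul _
    · refine Filter.Eventually.of_forall fun g => ?_
      have c1 : ContinuousWithinAt (fun p : Θ × (A → ℝ) => (p.1, sh p.2 (σ p.1) g))
          (S ×ˢ Set.univ) (θ₀, w₀) := by
        refine continuousWithinAt_fst.prodMk ?_
        have : ContinuousWithinAt (fun p : Θ × (A → ℝ) => (p.2, σ p.1, g))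
            (S ×ˢ Set.univ) (θ₀, w₀) := by
          refine continuousWithinAt_snd.prodMk (ContinuousWithinAt.prodMk ?_
            continuousWithinAt_const)
          exact ContinuousWithinAt.comp (hσ θ₀ h0) continuousWithinAt_fst (fun p hp => hp.1)
        exact sh_cont.continuousAt.comp_continuousWithinAt this
      have c2 : ContinuousWithinAt (fun p : Θ × (A → ℝ) => f p.1 (sh p.2 (σ p.1) g))
          (S ×ˢ Set.univ) (θ₀, w₀) :=
        ContinuousWithinAt.comp (t := S ×ˢ Set.univ)
          (g := fun p : Θ × (A → ℝ) => f p.1 p.2)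
          (f := fun p : Θ × (A → ℝ) => (p.1, sh p.2 (σ p.1) g))
          (hf.cont (θ₀, sh w₀ (σ θ₀) g) ⟨h0, trivial⟩) c1 (fun p hp => ⟨hp.1, trivial⟩)
      have c3 : ContinuousWithinAt (fun p : Θ × (A → ℝ) => h p.1 (sh p.2 (σ p.1) g))
          (S ×ˢ Set.univ) (θ₀, w₀) :=
        ContinuousWithinAt.comp (t := S ×ˢ Set.univ)
          (g := fun p : Θ × (A → ℝ) => h p.1 p.2)
          (f := fun p : Θ × (A → ℝ) => (p.1, sh p.2 (σ p.1) g))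
          (hh.cont (θ₀, sh w₀ (σ θ₀) g) ⟨h0, trivial⟩) c1 (fun p hp => ⟨hp.1, trivial⟩)
      have c4 : ContinuousWithinAt (fun p : Θ × (A → ℝ) => μ p.1) (S ×ˢ Set.univ) (θ₀, w₀) :=
        ContinuousWithinAt.comp (hμ θ₀ h0) continuousWithinAt_fst (fun p hp => hp.1)
      exact ((c4.mul c2).rexp).mul c3
  · intro θ₀ h0
    obtain ⟨K, hK, hb⟩ := EE_bd hf hh hμ hσ h0
    set I := ∫ g, Real.exp (K * NN g) ∂(gA A)
    have hI : 0 ≤ I := integral_nonneg fun g => (Real.exp_pos _).le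
    refine ⟨K * I + K, by positivity, ?_⟩
    filter_upwards [hb, self_mem_nhdsWithin] with θ h1 hθ w
    have hN := NN_nonneg w
    unfold EE
    have e0 : 0 ≤ K * I := by positivity
    calc |∫ g, Real.exp (μ θ * f θ (sh w (σ θ) g)) * h θ (sh w (σ θ) g) ∂(gA A)|
        ≤ ∫ g, K * Real.exp (K * NN w) * Real.exp (K * NN g) ∂(gA A) := by
          rw [← Real.norm_eq_abs]
          refine norm_integral_le_of_norm_le ((int_exp_NN K).const_mul _)
            (Filter.Eventually.of_forall fun g => h1 w g)
      _ = (K * I) * Real.exp (K * NN w) := by rw [integral_const_mul]; ring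
      _ ≤ _ := by
        gcongr
        · linarith
        · linarith

lemma EE_pos {f : Θ → (A → ℝ) → ℝ} (hf : LG S f) {θ : Θ} (hθ : θ ∈ S) (c : ℝ) (σ w : A → ℝ) :
    0 < EE c σ (f θ) (fun _ => 1) w := by
  have h1 := EE_int hf EG.one hθ c w σ
  unfold EE
  simp only [mul_one] at h1 ⊢
  exact integral_exp_pos h1

lemma EE_lower {f : Θ → (A → ℝ) → ℝ} (hf : LG S f) {μ : Θ → ℝ} {σ : Θ → A → ℝ}
    (hμ : ContinuousOn μ S) (hσ : ContinuousOn σ S) {θ₀ : Θ} (h0 : θ₀ ∈ S) :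
    ∃ K : ℝ, 0 ≤ K ∧ ∀ᶠ θ in 𝓝[S] θ₀, ∀ w,
      |Real.log (EE (μ θ) (σ θ) (f θ) (fun _ => 1) w)| ≤ K * (1 + NN w) := by
  obtain ⟨K, hK, hb⟩ := hf.sh_bd hμ hσ h0
  set I := ∫ g, Real.exp (K * NN g) ∂(gA A)
  set I' := ∫ g, Real.exp (-K * NN g) ∂(gA A)
  have hI : 0 < I := integral_exp_pos (int_exp_NN K)
  have hI' : 0 < I' := integral_exp_pos (int_exp_NN (-K))
  refine ⟨K + |Real.log I| + |Real.log I'|, by positivity, ?_⟩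
  filter_upwards [hb, self_mem_nhdsWithin] with θ h1 hθ w
  have hN := NN_nonneg w
  have hEint := EE_int hf EG.one hθ (μ θ) w (σ θ)
  have hpos := EE_pos hf hθ (μ θ) (σ θ) w
  have up : EE (μ θ) (σ θ) (f θ) (fun _ => 1) w ≤ Real.exp (K * (1 + NN w)) * I := by
    unfold EE
    rw [← integral_const_mul]
    refine integral_mono hEint ((int_exp_NN K).const_mul _) fun g => ?_
    simp only [mul_one]
    rw [← Real.exp_add]
    have := (le_abs_self _).trans (h1 w g)
    exact Real.exp_le_exp.2 (this.trans (by ring_nf; rfl))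
  have lo : Real.exp (-(K * (1 + NN w))) * I' ≤ EE (μ θ) (σ θ) (f θ) (fun _ => 1) w := by
    unfold EE
    rw [← integral_const_mul]
    refine integral_mono ((int_exp_NN (-K)).const_mul _) hEint fun g => ?_
    simp only [mul_one]
    rw [← Real.exp_add]
    have := (neg_abs_le (μ θ * f θ (sh w (σ θ) g)))
    have h2 := h1 w g
    exact Real.exp_le_exp.2 (by nlinarith)
  have up' := Real.log_le_log hpos up
  have lo' := Real.log_le_log (by positivity) lo
  rw [Real.log_mul (Real.exp_pos _).ne' hI.ne', Real.log_exp] at up'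
  rw [Real.log_mul (Real.exp_pos _).ne' hI'.ne', Real.log_exp] at lo'
  have a1 := le_abs_self (Real.log I)
  have a2 := neg_abs_le (Real.log I')
  have a3 := abs_nonneg (Real.log I)
  have a4 := abs_nonneg (Real.log I')
  rw [abs_le]
  constructor <;> nlinarith [mul_nonneg a3 hN, mul_nonneg a4 hN]

lemma EEinv_EG [FirstCountableTopology Θ] {f : Θ → (A → ℝ) → ℝ} (hf : LG S f)
    {μ : Θ → ℝ} {σ : Θ → A → ℝ} (hμ : ContinuousOn μ S) (hσ : ContinuousOn σ S) :
    EG S (fun θ w => (EE (μ θ) (σ θ) (f θ) (fun _ => 1) w)⁻¹) := by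
  refine ⟨(EE_EG hf EG.one hμ hσ).cont.inv₀ fun p hp => (EE_pos hf hp.1 _ _ _).ne', ?_⟩
  intro θ₀ h0
  obtain ⟨K, hK, hb⟩ := EE_lower hf hμ hσ h0
  refine ⟨K + Real.exp K, by positivity, ?_⟩
  filter_upwards [hb, self_mem_nhdsWithin] with θ h1 hθ w
  have hN := NN_nonneg w
  have hpos := EE_pos hf hθ (μ θ) (σ θ) w
  rw [abs_of_pos (inv_pos.2 hpos), ← Real.exp_log (inv_pos.2 hpos), Real.log_inv]
  have := (neg_abs_le _).trans' (neg_le_neg (h1 w))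
  calc Real.exp (-Real.log (EE (μ θ) (σ θ) (f θ) (fun _ => 1) w))
      ≤ Real.exp (K * (1 + NN w)) := Real.exp_le_exp.2 (by linarith)
    _ = Real.exp K * Real.exp (K * NN w) := by rw [← Real.exp_add]; ring_nf
    _ ≤ _ := by
      gcongr
      · linarith
      · linarith [Real.exp_pos K]

lemma Phi_EG [FirstCountableTopology Θ] {f h : Θ → (A → ℝ) → ℝ} (hf : LG S f) (hh : EG S h)
    {μ : Θ → ℝ} {σ : Θ → A → ℝ} (hμ : ContinuousOn μ S) (hσ : ContinuousOn σ S) :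
    EG S (fun θ w => Phi (μ θ) (σ θ) (f θ) (h θ) w) := by
  unfold Phi
  simp only [div_eq_mul_inv]
  exact (EE_EG hf hh hμ hσ).mul (EEinv_EG hf hμ hσ)

lemma TT_LG [FirstCountableTopology Θ] {f : Θ → (A → ℝ) → ℝ} (hf : LG S f)
    {μ : Θ → ℝ} {σ : Θ → A → ℝ} (hμ : ContinuousOn μ S) (hσ : ContinuousOn σ S)
    (hc : (∀ θ ∈ S, 0 < μ θ) ∨ (∀ θ ∈ S, μ θ = 0)) :
    LG S (fun θ w => TT (μ θ) (σ θ) (f θ) w) := by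
  rcases hc with hc | hc
  · constructor
    · have h1 : ContinuousOn (fun p : Θ × (A → ℝ) =>
          Real.log (EE (μ p.1) (σ p.1) (f p.1) (fun _ => 1) p.2) / μ p.1) (S ×ˢ Set.univ) := by
        refine ContinuousOn.div ((EE_EG hf EG.one hμ hσ).cont.log
          fun p hp => (EE_pos hf hp.1 _ _ _).ne')
          (hμ.comp continuousOn_fst (fun p hp => hp.1)) fun p hp => (hc p.1 hp.1).ne'
      refine h1.congr fun p hp => ?_
      simp only [TT, if_neg (hc p.1 hp.1).ne']
    · intro θ₀ h0
      obtain ⟨K, hK, hb⟩ := EE_lower hf hμ hσ h0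
      have hp := hc θ₀ h0
      refine ⟨K * (2 / μ θ₀), by positivity, ?_⟩
      have h2 : ∀ᶠ θ in 𝓝[S] θ₀, μ θ₀ / 2 < μ θ :=
        (hμ θ₀ h0).eventually (lt_mem_nhds (by linarith))
      filter_upwards [hb, h2, self_mem_nhdsWithin] with θ h1 h2 hθ w
      have hN := NN_nonneg w
      have hpos := hc θ hθ
      simp only [TT, if_neg hpos.ne']
      rw [abs_div, abs_of_pos hpos, div_eq_mul_inv]
      have h3 : (μ θ)⁻¹ ≤ 2 / μ θ₀ := by
        rw [← inv_div]
        exact inv_anti₀ (by positivity) h2.le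
      calc _ ≤ (K * (1 + NN w)) * (2 / μ θ₀) :=
            mul_le_mul (h1 w) h3 (by positivity) (by positivity)
        _ = _ := by ring
  · constructor
    · refine (EE_EG hf hf.eg (μ := fun _ => 0) continuousOn_const hσ).cont.congr fun p hp => ?_
      simp only [TT, if_pos (hc p.1 hp.1)]
    · intro θ₀ h0
      obtain ⟨K, hK, hb⟩ := hf.sh_bd (μ := fun _ => 1) continuousOn_const hσ h0
      have hNi : Integrable (fun g : A → ℝ => NN g) (gA A) := by
        refine int_of_bdE (K := 1) (K' := 1) NN_cont fun g => ?_
        rw [abs_of_nonneg (NN_nonneg g)]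
        have := Real.add_one_le_exp (1 * NN g)
        linarith
      set J := ∫ g, NN g ∂(gA A)
      have hJ : 0 ≤ J := integral_nonneg fun g => NN_nonneg g
      refine ⟨K * (1 + J), by positivity, ?_⟩
      filter_upwards [hb, self_mem_nhdsWithin] with θ h1 hθ w
      have hN := NN_nonneg w
      simp only [TT, if_pos (hc θ hθ), EE, zero_mul, Real.exp_zero, one_mul]
      have hi : Integrable (fun g : A → ℝ => K * (1 + NN w + NN g)) (gA A) :=
        ((integrable_const _).add hNi).const_mul K
      calc |∫ g, f θ (sh w (σ θ) g) ∂(gA A)| ≤ ∫ g, K * (1 + NN w + NN g) ∂(gA A) := by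
            rw [← Real.norm_eq_abs]
            refine norm_integral_le_of_norm_le hi
              (Filter.Eventually.of_forall fun g => ?_)
            have := h1 w g
            simpa using this
        _ = K * (1 + NN w + J) := by
            rw [integral_const_mul, integral_add (integrable_const _) hNi]
            simp [J]
        _ ≤ _ := by nlinarith [mul_nonneg hK hN, mul_nonneg (mul_nonneg hK hJ) hN]

end mach

section mach3
open Filter Topology
variable {Θ Θ' A : Type} [TopologicalSpace Θ] [TopologicalSpace Θ'] [Fintype A] {S : Set Θ}

lemma EG.reparam {f : Θ → (A → ℝ) → ℝ} (hf : EG S f) {T : Set Θ'} {φ : Θ' → Θ}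
    (hφ : ContinuousOn φ T) (hm : Set.MapsTo φ T S) : EG T (fun z => f (φ z)) := by
  constructor
  · refine hf.cont.comp (f := fun p : Θ' × (A → ℝ) => (φ p.1, p.2)) ?_
      (fun p hp => ⟨hm hp.1, trivial⟩)
    exact (hφ.comp continuousOn_fst (fun p hp => hp.1)).prodMk continuousOn_snd
  · intro z hz
    obtain ⟨K, hK, hb⟩ := hf.bd _ (hm hz)
    exact ⟨K, hK, ((hφ z hz).tendsto_nhdsWithin hm).eventually hb⟩

lemma LG.reparam {f : Θ → (A → ℝ) → ℝ} (hf : LG S f) {T : Set Θ'} {φ : Θ' → Θ}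
    (hφ : ContinuousOn φ T) (hm : Set.MapsTo φ T S) : LG T (fun z => f (φ z)) := by
  constructor
  · refine hf.cont.comp (f := fun p : Θ' × (A → ℝ) => (φ p.1, p.2)) ?_
      (fun p hp => ⟨hm hp.1, trivial⟩)
    exact (hφ.comp continuousOn_fst (fun p hp => hp.1)).prodMk continuousOn_snd
  · intro z hz
    obtain ⟨K, hK, hb⟩ := hf.bd _ (hm hz)
    exact ⟨K, hK, ((hφ z hz).tendsto_nhdsWithin hm).eventually hb⟩

lemma EG.comp_sh {h : Θ → (A → ℝ) → ℝ} (hh : EG S h) {σ : Θ → A → ℝ}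
    (hσ : ContinuousOn σ S) (w : A → ℝ) : EG S (fun θ g => h θ (sh w (σ θ) g)) := by
  constructor
  · refine hh.cont.comp (f := fun p : Θ × (A → ℝ) => (p.1, sh w (σ p.1) p.2)) ?_
      (fun p hp => ⟨hp.1, trivial⟩)
    refine continuousOn_fst.prodMk ?_
    have h1 : ContinuousOn (fun p : Θ × (A → ℝ) => (w, σ p.1, p.2)) (S ×ˢ Set.univ) :=
      continuousOn_const.prodMk ((hσ.comp continuousOn_fst (fun p hp => hp.1)).prodMk
        continuousOn_snd)
    exact sh_cont.comp_continuousOn h1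
  · intro θ₀ h0
    obtain ⟨K, hK, hb⟩ := hh.sh_bd hσ h0
    have e0 : 0 ≤ K * Real.exp (K * NN w) := by positivity
    refine ⟨K * Real.exp (K * NN w) + K, by positivity, ?_⟩
    filter_upwards [hb] with θ h1 g
    have hN := NN_nonneg g
    refine (h1 w g).trans ?_
    gcongr
    · linarith
    · linarith

lemma LG.exp {f : Θ → (A → ℝ) → ℝ} (hf : LG S f) {μ : Θ → ℝ} (hμ : ContinuousOn μ S) :
    EG S (fun θ w => Real.exp (μ θ * f θ w)) := by
  constructor
  · exact ((hμ.comp continuousOn_fst (fun p hp => hp.1)).mul hf.cont).rexp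
  · intro θ₀ h0
    obtain ⟨K, hK, hb⟩ := hf.bd θ₀ h0
    obtain ⟨M, hM, hm⟩ := ev_mu hμ h0
    refine ⟨Real.exp (M * K) + M * K, by positivity, ?_⟩
    filter_upwards [hb, hm] with θ h1 h2 w
    have hN := NN_nonneg w
    rw [Real.abs_exp]
    calc Real.exp (μ θ * f θ w) ≤ Real.exp (M * (K * (1 + NN w))) := by
          refine Real.exp_le_exp.2 ((le_abs_self _).trans ?_)
          rw [abs_mul]
          exact mul_le_mul h2 (h1 w) (abs_nonneg _) hM
      _ = Real.exp (M * K) * Real.exp (M * K * NN w) := by rw [← Real.exp_add]; ring_nf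
      _ ≤ _ := by
        have := Real.exp_pos (M * K)
        have : 0 ≤ M * K := by positivity
        gcongr
        · linarith
        · linarith

lemma EG.coord (a : A) : EG S (fun (_ : Θ) (w : A → ℝ) => w a) := by
  constructor
  · fun_prop
  · intro θ₀ h0
    refine ⟨1, by norm_num, Eventually.of_forall fun θ w => ?_⟩
    have := abs_le_NN w a
    have h2 := Real.add_one_le_exp (1 * NN w)
    linarith

lemma EG.int {h : Θ → (A → ℝ) → ℝ} (hh : EG S h) {θ : Θ} (hθ : θ ∈ S) :
    Integrable (h θ) (gA A) := by
  obtain ⟨K, hK, hb⟩ := hh.bd θ hθ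
  exact int_of_bdE (hh.cont1 hθ) (fun g => (hb.self_of_nhdsWithin hθ) g)

lemma EG.sum {ι : Type} (s : Finset ι) {h : ι → Θ → (A → ℝ) → ℝ} (hh : ∀ i ∈ s, EG S (h i)) :
    EG S (fun θ w => ∑ i ∈ s, h i θ w) := by
  classical
  induction s using Finset.induction_on with
  | empty => simpa using EG.of_scalar (S := S) (A := A) (c := fun _ => 0) continuousOn_const
  | insert i s hi ih =>
    simp only [Finset.sum_insert hi]
    exact (hh i (Finset.mem_insert_self _ _)).add
      (ih fun j hj => hh j (Finset.mem_insert_of_mem hj))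

/-- Differentiation under the integral sign. -/
lemma intd {T : Set ℝ} (hT : IsOpen T) {H H' : ℝ → (A → ℝ) → ℝ} (h1 : EG T H) (h2 : EG T H')
    {z0 : ℝ} (hz : z0 ∈ T) (hd : ∀ z ∈ T, ∀ g, HasDerivAt (fun z => H z g) (H' z g) z) :
    HasDerivAt (fun z => ∫ g, H z g ∂(gA A)) (∫ g, H' z0 g ∂(gA A)) z0 := by
  obtain ⟨K, hK, hb⟩ := h2.bd z0 hz
  have hev : ∀ᶠ z in 𝓝 z0, z ∈ T ∧ ∀ w, |H' z w| ≤ K * Real.exp (K * NN w) := by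
    rw [hT.nhdsWithin_eq hz] at hb
    exact (hT.eventually_mem hz).and hb
  refine (hasDerivAt_integral_of_dominated_loc_of_deriv_le (μ := gA A) (F := H) (F' := H')
    (s := {z | z ∈ T ∧ ∀ w, |H' z w| ≤ K * Real.exp (K * NN w)})
    (bound := fun g => K * Real.exp (K * NN g)) hev ?_ (h1.int hz)
    (h2.cont1 hz).aestronglyMeasurable ?_ ((int_exp_NN K).const_mul _) ?_).2
  · filter_upwards [hT.mem_nhds hz] with z hz' using (h1.cont1 hz').aestronglyMeasurable
  · exact Eventually.of_forall fun g z hz' => hz'.2 g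
  · exact Eventually.of_forall fun g z hz' => hd z hz'.1 g

/-- derivative of `EE` in a parameter of the functions. -/
lemma EE_deriv {T : Set ℝ} (hT : IsOpen T) {f f' h h' : ℝ → (A → ℝ) → ℝ}
    (hf : LG T f) (hf' : EG T f') (hh : EG T h) (hh' : EG T h')
    (df : ∀ z ∈ T, ∀ g, HasDerivAt (fun z => f z g) (f' z g) z)
    (dh : ∀ z ∈ T, ∀ g, HasDerivAt (fun z => h z g) (h' z g) z)
    (μ : ℝ) (σ w : A → ℝ) {z0 : ℝ} (hz : z0 ∈ T) :
    HasDerivAt (fun z => EE μ σ (f z) (h z) w)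
      (EE μ σ (f z0) (fun v => h' z0 v + μ * (f' z0 v * h z0 v)) w) z0 := by
  have e1 := (hf.exp (μ := fun _ => μ) continuousOn_const)
  have e2 := hh'.add ((hf'.mul hh).smul (c := fun _ => μ) continuousOn_const)
  unfold EE
  refine intd hT
    (H := fun z g => Real.exp (μ * f z (sh w σ g)) * h z (sh w σ g))
    (H' := fun z g => Real.exp (μ * f z (sh w σ g)) *
      (h' z (sh w σ g) + μ * (f' z (sh w σ g) * h z (sh w σ g))))
    ((e1.mul hh).comp_sh (σ := fun _ => σ) continuousOn_const w)
    ((e1.mul e2).comp_sh (σ := fun _ => σ) continuousOn_const w) hz ?_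
  intro z hz g
  have a1 := ((df z hz (sh w σ g)).const_mul μ).exp
  exact (a1.mul (dh z hz (sh w σ g))).congr_deriv (by ring)

lemma EE_zero_one (σ : A → ℝ) (f : (A → ℝ) → ℝ) (w : A → ℝ) : EE 0 σ f (fun _ => 1) w = 1 := by
  simp [EE]

lemma EE_congr_fun {μ : ℝ} {σ : A → ℝ} {f h h' : (A → ℝ) → ℝ} (e : ∀ v, h v = h' v)
    (w : A → ℝ) : EE μ σ f h w = EE μ σ f h' w := by
  rw [show h = h' from funext e]

lemma EE_const_mul (μ : ℝ) (σ : A → ℝ) (f h : (A → ℝ) → ℝ) (c : ℝ) (w : A → ℝ) :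
    EE μ σ f (fun v => c * h v) w = c * EE μ σ f h w := by
  unfold EE
  rw [← integral_const_mul]
  congr 1; funext g; ring

lemma TT_deriv {T : Set ℝ} (hT : IsOpen T) {f f' : ℝ → (A → ℝ) → ℝ}
    (hf : LG T f) (hf' : EG T f')
    (df : ∀ z ∈ T, ∀ g, HasDerivAt (fun z => f z g) (f' z g) z)
    (μ : ℝ) (σ w : A → ℝ) {z0 : ℝ} (hz : z0 ∈ T) :
    HasDerivAt (fun z => TT μ σ (f z) w) (Phi μ σ (f z0) (f' z0) w) z0 := by
  unfold TT
  by_cases hμ : μ = 0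
  · subst hμ
    simp only [if_true]
    refine (EE_deriv hT hf hf' hf.eg hf' df df 0 σ w hz).congr_deriv ?_
    simp [Phi, EE_zero_one]
  · simp only [if_neg hμ]
    have h1 := EE_deriv hT hf hf' EG.one (EG.of_scalar (c := fun _ => 0) continuousOn_const) df
      (fun z _ g => hasDerivAt_const z (1:ℝ)) μ σ w hz
    refine ((h1.log (EE_pos hf hz μ σ w).ne').div_const μ).congr_deriv ?_
    rw [Phi, EE_congr_fun (h' := fun v => μ * f' z0 v) (fun v => by ring), EE_const_mul]
    field_simp

lemma Phi_deriv {T : Set ℝ} (hT : IsOpen T) {f f' h h' : ℝ → (A → ℝ) → ℝ}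
    (hf : LG T f) (hf' : EG T f') (hh : EG T h) (hh' : EG T h')
    (df : ∀ z ∈ T, ∀ g, HasDerivAt (fun z => f z g) (f' z g) z)
    (dh : ∀ z ∈ T, ∀ g, HasDerivAt (fun z => h z g) (h' z g) z)
    (μ : ℝ) (σ w : A → ℝ) {z0 : ℝ} (hz : z0 ∈ T) :
    HasDerivAt (fun z => Phi μ σ (f z) (h z) w)
      (Phi μ σ (f z0) (fun v => h' z0 v + μ * (f' z0 v * h z0 v)) w
        - μ * (Phi μ σ (f z0) (f' z0) w * Phi μ σ (f z0) (h z0) w)) z0 := by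
  unfold Phi
  have h1 := EE_deriv hT hf hf' EG.one (EG.of_scalar (c := fun _ => 0) continuousOn_const) df
      (fun z _ g => hasDerivAt_const z (1:ℝ)) μ σ w hz
  have h2 := EE_deriv hT hf hf' hh hh' df dh μ σ w hz
  have hp := (EE_pos hf hz μ σ w).ne'
  refine (h2.div h1 hp).congr_deriv ?_
  rw [EE_congr_fun (h := fun v => (fun _ _ => (0:ℝ)) z0 v + μ * (f' z0 v * 1))
    (h' := fun v => μ * f' z0 v) (fun v => by ring), EE_const_mul]
  field_simp

/-- fixed functions -/
def LG1 (f : (A → ℝ) → ℝ) : Prop := LG (Set.univ : Set Unit) (fun _ => f)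
/-- fixed functions -/
def EG1 (f : (A → ℝ) → ℝ) : Prop := EG (Set.univ : Set Unit) (fun _ => f)

lemma LG.at {f : Θ → (A → ℝ) → ℝ} (hf : LG S f) {θ : Θ} (hθ : θ ∈ S) : LG1 (f θ) :=
  hf.reparam (T := (Set.univ : Set Unit)) (φ := fun _ => θ) continuousOn_const (fun _ _ => hθ)
lemma EG.at {f : Θ → (A → ℝ) → ℝ} (hf : EG S f) {θ : Θ} (hθ : θ ∈ S) : EG1 (f θ) :=
  hf.reparam (T := (Set.univ : Set Unit)) (φ := fun _ => θ) continuousOn_const (fun _ _ => hθ)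
lemma LG1.fam {f : (A → ℝ) → ℝ} (hf : LG1 f) : LG S (fun _ => f) :=
  LG.reparam (S := (Set.univ : Set Unit)) (f := fun _ => f) hf (φ := fun _ => ())
    continuousOn_const (fun _ _ => trivial)
lemma EG1.fam {f : (A → ℝ) → ℝ} (hf : EG1 f) : EG S (fun _ => f) :=
  EG.reparam (S := (Set.univ : Set Unit)) (f := fun _ => f) hf (φ := fun _ => ())
    continuousOn_const (fun _ _ => trivial)

lemma EG1.cont {f : (A → ℝ) → ℝ} (hf : EG1 f) : Continuous f :=
  EG.cont1 (S := (Set.univ : Set Unit)) (f := fun _ => f) hf (θ := ()) trivial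
lemma LG1.cont {f : (A → ℝ) → ℝ} (hf : LG1 f) : Continuous f :=
  LG.cont1 (S := (Set.univ : Set Unit)) (f := fun _ => f) hf (θ := ()) trivial
lemma EG1.bd {f : (A → ℝ) → ℝ} (hf : EG1 f) : ∃ K : ℝ, 0 ≤ K ∧ ∀ w, |f w| ≤ K * Real.exp (K * NN w) := by
  obtain ⟨K, hK, hb⟩ := EG.bd (S := (Set.univ : Set Unit)) (f := fun _ => f) hf () trivial
  exact ⟨K, hK, hb.self_of_nhdsWithin trivial⟩
lemma LG1.bd {f : (A → ℝ) → ℝ} (hf : LG1 f) : ∃ K : ℝ, 0 ≤ K ∧ ∀ w, |f w| ≤ K * (1 + NN w) := by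
  obtain ⟨K, hK, hb⟩ := LG.bd (S := (Set.univ : Set Unit)) (f := fun _ => f) hf () trivial
  exact ⟨K, hK, hb.self_of_nhdsWithin trivial⟩
lemma LG1.mk {f : (A → ℝ) → ℝ} (hc : Continuous f) {K : ℝ} (hK : 0 ≤ K)
    (hb : ∀ w, |f w| ≤ K * (1 + NN w)) : LG1 f :=
  ⟨(hc.comp continuous_snd).continuousOn, fun _ _ => ⟨K, hK, Eventually.of_forall fun _ => hb⟩⟩
lemma EG1.mk {f : (A → ℝ) → ℝ} (hc : Continuous f) {K : ℝ} (hK : 0 ≤ K)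
    (hb : ∀ w, |f w| ≤ K * Real.exp (K * NN w)) : EG1 f :=
  ⟨(hc.comp continuous_snd).continuousOn, fun _ _ => ⟨K, hK, Eventually.of_forall fun _ => hb⟩⟩
lemma LG1.eg {f : (A → ℝ) → ℝ} (hf : LG1 f) : EG1 f := LG.eg hf
lemma EG1.add {f h : (A → ℝ) → ℝ} (hf : EG1 f) (hh : EG1 h) : EG1 (fun w => f w + h w) :=
  EG.add hf hh
lemma EG1.sub {f h : (A → ℝ) → ℝ} (hf : EG1 f) (hh : EG1 h) : EG1 (fun w => f w - h w) :=
  EG.sub hf hh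
lemma EG1.mul {f h : (A → ℝ) → ℝ} (hf : EG1 f) (hh : EG1 h) : EG1 (fun w => f w * h w) :=
  EG.mul hf hh
lemma EG1.smul (c : ℝ) {f : (A → ℝ) → ℝ} (hf : EG1 f) : EG1 (fun w => c * f w) :=
  EG.smul (c := fun _ => c) continuousOn_const hf
lemma EG1.const (c : ℝ) : EG1 (fun _ : A → ℝ => c) := EG.of_scalar continuousOn_const
lemma EG1.coord (a : A) : EG1 (fun w : A → ℝ => w a) := EG.coord a
lemma EG1.sum {ι : Type} (s : Finset ι) {h : ι → (A → ℝ) → ℝ} (hh : ∀ i ∈ s, EG1 (h i)) :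
    EG1 (fun w => ∑ i ∈ s, h i w) := EG.sum (h := fun i _ => h i) s hh
lemma EG1.comp_sh {h : (A → ℝ) → ℝ} (hh : EG1 h) (σ w : A → ℝ) : EG1 (fun g => h (sh w σ g)) :=
  EG.comp_sh (σ := fun _ => σ) hh continuousOn_const w
lemma LG1.exp {f : (A → ℝ) → ℝ} (hf : LG1 f) (c : ℝ) : EG1 (fun w => Real.exp (c * f w)) :=
  LG.exp (μ := fun _ => c) hf continuousOn_const
lemma EG1.int {f : (A → ℝ) → ℝ} (hf : EG1 f) : Integrable f (gA A) :=
  EG.int (S := (Set.univ : Set Unit)) (h := fun _ => f) hf (θ := ()) trivial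
lemma LG1.EEint {f h : (A → ℝ) → ℝ} (hf : LG1 f) (hh : EG1 h) (c : ℝ) (w σ : A → ℝ) :
    Integrable (fun g => Real.exp (c * f (sh w σ g)) * h (sh w σ g)) (gA A) :=
  (((hf.exp c).mul hh).comp_sh σ w).int
lemma LG1.EEpos {f : (A → ℝ) → ℝ} (hf : LG1 f) (c : ℝ) (σ w : A → ℝ) :
    0 < EE c σ f (fun _ => 1) w :=
  EE_pos (S := (Set.univ : Set Unit)) (f := fun _ => f) hf (θ := ()) trivial c σ w
lemma LG1.Phi {f h : (A → ℝ) → ℝ} (hf : LG1 f) (hh : EG1 h) (c : ℝ) (σ : A → ℝ) :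
    EG1 (Phi c σ f h) :=
  Phi_EG (μ := fun _ => c) (σ := fun _ => σ) hf hh continuousOn_const continuousOn_const
lemma LG1.TT {f : (A → ℝ) → ℝ} (hf : LG1 f) {c : ℝ} (hc : 0 ≤ c) (σ : A → ℝ) :
    LG1 (TT c σ f) := by
  refine TT_LG (μ := fun _ => c) (σ := fun _ => σ) hf continuousOn_const continuousOn_const ?_
  rcases hc.eq_or_lt with h | h
  · exact Or.inr fun _ _ => h.symm
  · exact Or.inl fun _ _ => h

lemma Phi_add {f h h' : (A → ℝ) → ℝ} (hf : LG1 f) (hh : EG1 h) (hh' : EG1 h') (c : ℝ)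
    (σ w : A → ℝ) :
    Phi c σ f (fun v => h v + h' v) w = Phi c σ f h w + Phi c σ f h' w := by
  unfold Phi
  rw [← add_div]
  congr 1
  unfold EE
  rw [← integral_add (hf.EEint hh c w σ) (hf.EEint hh' c w σ)]
  congr 1; funext g; ring

lemma Phi_smul (f h : (A → ℝ) → ℝ) (b c : ℝ) (σ w : A → ℝ) :
    Phi c σ f (fun v => b * h v) w = b * Phi c σ f h w := by
  unfold Phi
  rw [EE_const_mul, mul_div_assoc]

lemma Phi_one {f : (A → ℝ) → ℝ} (hf : LG1 f) (c : ℝ) (σ w : A → ℝ) :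
    Phi c σ f (fun _ => 1) w = 1 := div_self (hf.EEpos c σ w).ne'

lemma Phi_const {f : (A → ℝ) → ℝ} (hf : LG1 f) (b c : ℝ) (σ w : A → ℝ) :
    Phi c σ f (fun _ => b) w = b := by
  have := Phi_smul f (fun _ => 1) b c σ w
  rw [Phi_one hf] at this
  simpa using this

lemma Phi_sum {ι : Type} (s : Finset ι) {f : (A → ℝ) → ℝ} {h : ι → (A → ℝ) → ℝ} (hf : LG1 f)
    (hh : ∀ i ∈ s, EG1 (h i)) (c : ℝ) (σ w : A → ℝ) :
    Phi c σ f (fun v => ∑ i ∈ s, h i v) w = ∑ i ∈ s, Phi c σ f (h i) w := by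
  classical
  induction s using Finset.induction_on with
  | empty => simpa using Phi_const hf 0 c σ w
  | insert i s hi ih =>
    simp only [Finset.sum_insert hi]
    rw [Phi_add hf (hh i (Finset.mem_insert_self _ _))
      (EG1.sum s fun j hj => hh j (Finset.mem_insert_of_mem hj)),
      ih fun j hj => hh j (Finset.mem_insert_of_mem hj)]

lemma Phi_nonneg {f h : (A → ℝ) → ℝ} (hf : LG1 f) (h0 : ∀ v, 0 ≤ h v) (c : ℝ) (σ w : A → ℝ) :
    0 ≤ Phi c σ f h w :=
  div_nonneg (integral_nonneg fun g => mul_nonneg (Real.exp_pos _).le (h0 _)) (hf.EEpos c σ w).le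

lemma Phi_pos {f h : (A → ℝ) → ℝ} (hf : LG1 f) (hh : EG1 h) (h0 : ∀ v, 0 < h v) (c : ℝ)
    (σ w : A → ℝ) : 0 < Phi c σ f h w := by
  refine div_pos ?_ (hf.EEpos c σ w)
  unfold EE
  have hc : Continuous fun g => Real.exp (c * f (sh w σ g)) * h (sh w σ g) :=
    (((hf.exp c).mul hh).comp_sh σ w).cont
  exact integral_pos_of_integrable_nonneg_nonzero hc (hf.EEint hh c w σ)
    (fun g => mul_nonneg (Real.exp_pos _).le (h0 _).le) (x := 0)
    (mul_pos (Real.exp_pos _) (h0 _)).ne'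

/-- variance is nonnegative -/
lemma Phi_sq {f h : (A → ℝ) → ℝ} (hf : LG1 f) (hh : EG1 h) (c : ℝ) (σ w : A → ℝ) :
    (Phi c σ f h w) ^ 2 ≤ Phi c σ f (fun v => h v ^ 2) w := by
  set b := Phi c σ f h w with hb
  have h1 : 0 ≤ Phi c σ f (fun v => (h v - b) ^ 2) w := Phi_nonneg hf (fun v => sq_nonneg _) _ _ _
  have h2 : (fun v => (h v - b) ^ 2) = fun v => (h v * h v + (-(2 * b)) * h v) + b ^ 2 := by
    funext v; ring
  rw [h2, Phi_add hf ((hh.mul hh).add (hh.smul _)) (EG1.const _), Phi_add hf (hh.mul hh) (hh.smul _),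
    Phi_smul, Phi_const hf, ← hb] at h1
  simp only [pow_two (h _)]
  nlinarith

end mach3

section mach4
open Filter Topology
variable {A : Type} [Fintype A] [DecidableEq A]

/-- directional derivative relation -/
def DD (a : A) (f d : (A → ℝ) → ℝ) : Prop :=
  ∀ w, HasDerivAt (fun z : ℝ => f (w + Pi.single a z)) (d w) 0

lemma DD.at {a : A} {f d : (A → ℝ) → ℝ} (h : DD a f d) (w : A → ℝ) (z : ℝ) :
    HasDerivAt (fun z : ℝ => f (w + Pi.single a z)) (d (w + Pi.single a z)) z := by
  have h1 := h (w + Pi.single a z)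
  have h2 : HasDerivAt (fun y : ℝ => y - z) 1 z := (hasDerivAt_id z).sub_const z
  have h1' : HasDerivAt (fun y : ℝ => f (w + Pi.single a z + Pi.single a y))
      (d (w + Pi.single a z)) (z - z) := by rwa [sub_self]
  have h3 := HasDerivAt.comp (h := fun y : ℝ => y - z) z h1' h2
  refine (h3.congr_deriv (by ring)).congr_of_eventuallyEq (Eventually.of_forall fun y => ?_)
  simp only [Function.comp, add_assoc, ← Pi.single_add]
  congr 3; ring_nf

lemma DD.congr {a : A} {f d d' : (A → ℝ) → ℝ} (h : DD a f d) (e : ∀ w, d w = d' w) : DD a f d' :=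
  fun w => (h w).congr_deriv (e w)

lemma update_eq_add_single (g : A → ℝ) (a : A) (z : ℝ) :
    Function.update g a z = Function.update g a 0 + Pi.single a z := by
  funext b
  by_cases h : b = a
  · subst h; simp
  · simp [h]

lemma sh_add_single (w σ g : A → ℝ) (a : A) (z : ℝ) :
    sh (w + Pi.single a z) σ g = sh w σ g + Pi.single a z := by
  funext b; simp [sh]; ring

lemma sh_update_g (w σ g : A → ℝ) (a : A) (z : ℝ) :
    sh w σ (Function.update g a z) = sh w σ (Function.update g a 0) + Pi.single a (σ a * z) := by
  funext b
  by_cases h : b = a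
  · subst h; simp [sh]
  · simp [h, sh]

lemma sh_update_s (w σ g : A → ℝ) (a : A) (z : ℝ) :
    sh w (Function.update σ a z) g = sh w (Function.update σ a 0) g + Pi.single a (z * g a) := by
  funext b
  by_cases h : b = a
  · subst h; simp [sh]
  · simp [h, sh]

lemma NN_single (a : A) (z : ℝ) : NN (Pi.single a z : A → ℝ) = |z| := by
  unfold NN
  rw [Finset.sum_eq_single a]
  · simp
  · intro b _ hb; simp [hb]
  · simp

lemma single_cont (a : A) : Continuous (fun p : ℝ × (A → ℝ) => p.2 + Pi.single a p.1) := by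
  refine continuous_pi fun b => ?_
  by_cases h : b = a
  · subst h; simp; fun_prop
  · simp [h]; fun_prop

lemma LG1.trans {f : (A → ℝ) → ℝ} (hf : LG1 f) (a : A) :
    LG (Set.univ : Set ℝ) (fun z v => f (v + Pi.single a z)) := by
  refine ⟨(hf.cont.comp (single_cont a)).continuousOn, fun z₀ _ => ?_⟩
  obtain ⟨K, hK, hb⟩ := hf.bd
  refine ⟨K * (|z₀| + 2), by positivity, ?_⟩
  have : ∀ᶠ z in 𝓝[Set.univ] z₀, |z| < |z₀| + 1 :=
    nhdsWithin_le_nhds (continuous_abs.continuousAt.eventually (gt_mem_nhds (lt_add_one _)))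
  filter_upwards [this] with z hz v
  have h1 := NN_add v (Pi.single a z)
  rw [NN_single] at h1
  have h2 := NN_nonneg v
  have h3 := abs_nonneg z₀
  calc _ ≤ K * (1 + NN (v + Pi.single a z)) := hb _
    _ ≤ K * ((|z₀| + 2) * (1 + NN v)) := by
      refine mul_le_mul_of_nonneg_left ?_ hK
      nlinarith [mul_nonneg h3 h2]
    _ = _ := by ring

lemma EG1.trans {f : (A → ℝ) → ℝ} (hf : EG1 f) (a : A) :
    EG (Set.univ : Set ℝ) (fun z v => f (v + Pi.single a z)) := by
  refine ⟨(hf.cont.comp (single_cont a)).continuousOn, fun z₀ _ => ?_⟩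
  obtain ⟨K, hK, hb⟩ := hf.bd
  refine ⟨K * Real.exp (K * (|z₀| + 1)) + K, by positivity, ?_⟩
  have : ∀ᶠ z in 𝓝[Set.univ] z₀, |z| < |z₀| + 1 :=
    nhdsWithin_le_nhds (continuous_abs.continuousAt.eventually (gt_mem_nhds (lt_add_one _)))
  filter_upwards [this] with z hz v
  have h1 := NN_add v (Pi.single a z)
  rw [NN_single] at h1
  have h2 := NN_nonneg v
  have e0 : 0 ≤ K * Real.exp (K * (|z₀| + 1)) := by positivity
  calc _ ≤ K * Real.exp (K * NN (v + Pi.single a z)) := hb _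
    _ ≤ K * Real.exp (K * (NN v + (|z₀| + 1))) := by gcongr; linarith
    _ = (K * Real.exp (K * (|z₀| + 1))) * Real.exp (K * NN v) := by
      rw [mul_add, Real.exp_add]; ring
    _ ≤ _ := by
      gcongr
      · linarith
      · linarith

lemma EE_trans (μ : ℝ) (σ : A → ℝ) (f h : (A → ℝ) → ℝ) (w : A → ℝ) (a : A) (z : ℝ) :
    EE μ σ f h (w + Pi.single a z)
      = EE μ σ (fun v => f (v + Pi.single a z)) (fun v => h (v + Pi.single a z)) w := by
  simp only [EE, sh_add_single]

lemma DD_TT {a : A} {f d : (A → ℝ) → ℝ} (hf : LG1 f) (hd : EG1 d) (h : DD a f d) (μ : ℝ)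
    (σ : A → ℝ) : DD a (TT μ σ f) (Phi μ σ f d) := by
  intro w
  have h1 := TT_deriv isOpen_univ (hf.trans a) (hd.trans a) (fun z _ g => h.at g z) μ σ w
    (Set.mem_univ (0:ℝ))
  simp only [Pi.single_zero, add_zero] at h1
  refine h1.congr_of_eventuallyEq (Eventually.of_forall fun z => ?_)
  simp only [TT, EE_trans]

lemma DD_Phi {a : A} {f d h h' : (A → ℝ) → ℝ} (hf : LG1 f) (hd : EG1 d) (hh : EG1 h)
    (hh' : EG1 h') (df : DD a f d) (dh : DD a h h') (μ : ℝ) (σ : A → ℝ) :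
    DD a (Phi μ σ f h) (fun w => Phi μ σ f (fun v => h' v + μ * (d v * h v)) w
      - μ * (Phi μ σ f d w * Phi μ σ f h w)) := by
  intro w
  have h1 := Phi_deriv isOpen_univ (hf.trans a) (hd.trans a) (hh.trans a) (hh'.trans a)
    (fun z _ g => df.at g z) (fun z _ g => dh.at g z) μ σ w (Set.mem_univ (0:ℝ))
  simp only [Pi.single_zero, add_zero] at h1
  refine h1.congr_of_eventuallyEq (Eventually.of_forall fun z => ?_)
  simp only [Phi, EE_trans]

/-- Stein in the shifted form. -/
lemma stein_sh {a : A} {F F' : (A → ℝ) → ℝ} (hF : EG1 F) (hF' : EG1 F') (h : DD a F F')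
    (w σ : A → ℝ) :
    ∫ g, g a * F (sh w σ g) ∂(gA A) = σ a * ∫ g, F' (sh w σ g) ∂(gA A) := by
  rw [← integral_const_mul]
  have e1 := hF.comp_sh σ w
  have e2 := (hF'.comp_sh σ w).smul (σ a)
  obtain ⟨K1, hK1, b1⟩ := e1.bd
  obtain ⟨K2, hK2, b2⟩ := e2.bd
  refine stein a e1.cont e2.cont (K := K1 + K2) (K' := K1 + K2) (by positivity)
    (fun g => (b1 g).trans (bdE_mono hK1 (by linarith) (NN_nonneg g)))
    (fun g => (b2 g).trans (bdE_mono hK2 (by linarith) (NN_nonneg g))) ?_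
  intro g z
  have h1 := h.at (sh w σ (Function.update g a 0)) (σ a * z)
  have h2 : HasDerivAt (fun y : ℝ => σ a * y) (σ a) z := by
    simpa using (hasDerivAt_id z).const_mul (σ a)
  refine ((HasDerivAt.comp z h1 h2).congr_deriv ?_).congr_of_eventuallyEq
    (Eventually.of_forall fun y => ?_)
  · rw [sh_update_g w σ g a z]; ring
  · simp only [Function.comp]
    rw [sh_update_g w σ g a y]

lemma upd_cont (σ : A → ℝ) (a : A) : Continuous (fun z : ℝ => Function.update σ a z) := by
  fun_prop

lemma Esig {a : A} {F F' F'' : (A → ℝ) → ℝ} (hF : EG1 F) (hF' : EG1 F') (hF'' : EG1 F'')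
    (h : DD a F F') (h' : DD a F' F'') (w σ : A → ℝ) {v : ℝ} (hv : 0 < v) :
    HasDerivAt (fun z => ∫ g, F (sh w (Function.update σ a (√z)) g) ∂(gA A))
      ((1 / 2) * ∫ g, F'' (sh w (Function.update σ a (√v)) g) ∂(gA A)) v := by
  have h1 : HasDerivAt (fun z => ∫ g, F (sh w (Function.update σ a z) g) ∂(gA A))
      (∫ g, g a * F' (sh w (Function.update σ a (√v)) g) ∂(gA A)) (√v) := by
    refine intd isOpen_univ (H := fun z g => F (sh w (Function.update σ a z) g))
      (H' := fun z g => g a * F' (sh w (Function.update σ a z) g)) ?_ ?_ trivial ?_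
    · exact EG.comp_sh hF.fam (upd_cont σ a).continuousOn w
    · exact (EG.coord a).mul (EG.comp_sh hF'.fam (upd_cont σ a).continuousOn w)
    · intro z _ g
      have h1 := h.at (sh w (Function.update σ a 0) g) (z * g a)
      have h2 : HasDerivAt (fun y : ℝ => y * g a) (g a) z := by
        simpa using (hasDerivAt_id z).mul_const (g a)
      refine ((HasDerivAt.comp z h1 h2).congr_deriv ?_).congr_of_eventuallyEq
        (Eventually.of_forall fun y => ?_)
      · rw [sh_update_s w σ g a z]; ring
      · simp only [Function.comp]
        rw [sh_update_s w σ g a y]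
  rw [stein_sh hF' hF'' h'] at h1
  have h2 := Real.hasDerivAt_sqrt hv.ne'
  refine (HasDerivAt.comp v h1 h2).congr_deriv ?_
  have : √v ≠ 0 := (Real.sqrt_pos.2 hv).ne'
  simp only [Function.update_self]
  field_simp

lemma DD.exp {a : A} {f d : (A → ℝ) → ℝ} (h : DD a f d) (μ : ℝ) :
    DD a (fun w => Real.exp (μ * f w)) (fun w => Real.exp (μ * f w) * (μ * d w)) := by
  intro w
  refine (((h w).const_mul μ).exp).congr_deriv ?_
  simp

lemma DD.mul {a : A} {f d f' d' : (A → ℝ) → ℝ} (h : DD a f d) (h' : DD a f' d') :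
    DD a (fun w => f w * f' w) (fun w => d w * f' w + f w * d' w) := by
  intro w
  refine ((h w).mul (h' w)).congr_deriv ?_
  simp

lemma DD.smul {a : A} {f d : (A → ℝ) → ℝ} (h : DD a f d) (c : ℝ) :
    DD a (fun w => c * f w) (fun w => c * d w) := fun w => (h w).const_mul c

lemma TTsig {a : A} {f d e : (A → ℝ) → ℝ} (hf : LG1 f) (hd : EG1 d) (he : EG1 e)
    (df : DD a f d) (dd : DD a d e) (μ : ℝ) (σ w : A → ℝ) {v : ℝ} (hv : 0 < v) :
    HasDerivAt (fun z => TT μ (Function.update σ a (√z)) f w)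
      ((1 / 2) * Phi μ (Function.update σ a (√v)) f (fun x => e x + μ * d x ^ 2) w) v := by
  unfold TT
  by_cases hμ : μ = 0
  · subst hμ
    simp only [if_true]
    have := Esig hf.eg hd he df dd w σ hv
    simpa [EE, Phi] using this
  · simp only [if_neg hμ]
    have := Esig (hf.exp μ) ((hf.exp μ).mul (hd.smul μ))
      (((hf.exp μ).mul (hd.smul μ)).mul (hd.smul μ) |>.add ((hf.exp μ).mul (he.smul μ)))
      (df.exp μ) ((df.exp μ).mul (dd.smul μ)) w σ hv
    have e1 : ∀ τ : A → ℝ, ∫ g, Real.exp (μ * f (sh w τ g)) ∂(gA A) = EE μ τ f (fun _ => 1) w := by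
      intro τ; simp [EE]
    have e2 : ∫ g, (Real.exp (μ * f (sh w (Function.update σ a √v) g))
        * (μ * d (sh w (Function.update σ a √v) g)) * (μ * d (sh w (Function.update σ a √v) g)) +
        Real.exp (μ * f (sh w (Function.update σ a √v) g)) *
          (μ * e (sh w (Function.update σ a √v) g))) ∂(gA A)
        = μ * EE μ (Function.update σ a √v) f (fun x => e x + μ * d x ^ 2) w := by
      unfold EE
      rw [← integral_const_mul]
      congr 1; funext g; ring
    simp only [e1, e2] at this
    refine ((this.log (hf.EEpos μ _ w).ne').div_const μ).congr_deriv ?_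
    unfold Phi
    have := (hf.EEpos μ (Function.update σ a √v) w).ne'
    field_simp

lemma TTmu {f : (A → ℝ) → ℝ} (hf : LG1 f) {μ : ℝ} (hμ : 0 < μ) (σ w : A → ℝ) :
    HasDerivAt (fun z => TT z σ f w) ((Phi μ σ f f w - TT μ σ f w) / μ) μ := by
  have h1 : HasDerivAt (fun z => EE z σ f (fun _ => 1) w) (EE μ σ f f w) μ := by
    unfold EE
    refine intd isOpen_univ (H := fun z g => Real.exp (z * f (sh w σ g)) * 1)
      (H' := fun z g => Real.exp (z * f (sh w σ g)) * f (sh w σ g)) ?_ ?_ trivial ?_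
    · exact EG.comp_sh ((LG.exp hf.fam (μ := fun z => z) continuousOn_id).mul EG.one)
        (σ := fun _ => σ) continuousOn_const w
    · exact EG.comp_sh ((LG.exp hf.fam (μ := fun z => z) continuousOn_id).mul hf.eg.fam)
        (σ := fun _ => σ) continuousOn_const w
    · intro z _ g
      have : HasDerivAt (fun y : ℝ => y * f (sh w σ g)) (f (sh w σ g)) z := by
        simpa using (hasDerivAt_id z).mul_const (f (sh w σ g))
      exact (this.exp.mul_const 1).congr_deriv (by ring)
  have hp := hf.EEpos μ σ w
  have h2 := (h1.log hp.ne').div (hasDerivAt_id μ) hμ.ne'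
  have h3 : (fun z => TT z σ f w) =ᶠ[𝓝 μ]
      (fun z => Real.log (EE z σ f (fun _ => 1) w)) / id := by
    filter_upwards [lt_mem_nhds hμ] with z hz
    simp [TT, hz.ne']
  refine (h2.congr_of_eventuallyEq h3).congr_deriv ?_
  simp only [TT, if_neg hμ.ne', Phi, id]
  field_simp

lemma mgf_one (c : ℝ) : ∫ z, Real.exp (c * z - c ^ 2 / 2) ∂stdG = 1 := by
  have h := congrFun (ProbabilityTheory.mgf_id_gaussianReal (μ := 0) (v := 1)) c
  simp only [ProbabilityTheory.mgf, id] at h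
  have : ∀ z, Real.exp (c * z - c ^ 2 / 2) = Real.exp (-(c ^ 2 / 2)) * Real.exp (c * z) := by
    intro z; rw [← Real.exp_add]; ring_nf
  simp only [this]
  rw [integral_const_mul]
  unfold stdG
  rw [h, ← Real.exp_add]
  simp

lemma mgf_A (α : A → ℝ) : ∫ g, Real.exp (∑ a, α a * g a - (∑ a, α a ^ 2) / 2) ∂(gA A) = 1 := by
  have h : ∀ g : A → ℝ, Real.exp (∑ a, α a * g a - (∑ a, α a ^ 2) / 2)
      = ∏ a, Real.exp (α a * g a - α a ^ 2 / 2) := by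
    intro g
    rw [← Real.exp_sum, Finset.sum_sub_distrib, Finset.sum_div]
  simp only [h]
  unfold gA
  rw [integral_fintype_prod_eq_prod (f := fun a z => Real.exp (α a * z - α a ^ 2 / 2))]
  simp [mgf_one]

lemma KL_gap {f : (A → ℝ) → ℝ} {d : A → (A → ℝ) → ℝ} {e : (A → ℝ) → ℝ} (hf : LG1 f)
    (hd : ∀ a, EG1 (d a)) (df : ∀ a, DD a f (d a)) {μ : ℝ} (hμ : 0 < μ) (σ w : A → ℝ)
    {a0 : A} (hσ : σ a0 ≠ 0) (dd : DD a0 (d a0) e) (he : ∀ w, 0 < e w) :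
    (1 / 2) * ∑ a, σ a ^ 2 * Phi μ σ f (d a) w ^ 2 < (Phi μ σ f f w - TT μ σ f w) / μ := by
  set Z := EE μ σ f (fun _ => 1) w with hZ
  have hZ0 : 0 < Z := hf.EEpos μ σ w
  set α : A → ℝ := fun a => μ * σ a * Phi μ σ f (d a) w with hα
  set c : ℝ := (∑ a, α a ^ 2) / 2 with hc
  set j : (A → ℝ) → ℝ := fun g => ∑ a, α a * g a - c - μ * f (sh w σ g) + Real.log Z with hj
  have hα' : ∀ a, ∫ g, g a * Real.exp (μ * f (sh w σ g)) ∂(gA A) = α a * Z := by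
    intro a
    rw [stein_sh (hf.exp μ) ((hf.exp μ).mul ((hd a).smul μ)) ((df a).exp μ)]
    have : ∫ g, Real.exp (μ * f (sh w σ g)) * (μ * d a (sh w σ g)) ∂(gA A)
        = μ * EE μ σ f (d a) w := by
      unfold EE
      rw [← integral_const_mul]
      congr 1; funext g; ring
    rw [this]
    simp only [hα, Phi]
    rw [← hZ]
    field_simp
  have jE : EG1 j := by
    have h1 : EG1 (fun g : A → ℝ => ∑ a, α a * g a) :=
      EG1.sum _ (h := fun a g => α a * g a) fun a _ => (EG1.coord a).smul _
    exact ((h1.sub (EG1.const c)).sub ((hf.eg.comp_sh σ w).smul μ)).add (EG1.const _)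
  have fE : EG1 (fun g => Real.exp (μ * f (sh w σ g))) := (hf.exp μ).comp_sh σ w
  have gE : EG1 (fun g : A → ℝ => Z * Real.exp (∑ a, α a * g a - c)) := by
    refine EG1.smul Z ?_
    have : LG1 (fun g : A → ℝ => ∑ a, α a * g a - c) := by
      refine LG1.mk (by fun_prop) (K := NN α + |c|) (by have := NN_nonneg α; positivity) fun g => ?_
      have h1 : |∑ a, α a * g a| ≤ NN α * NN g := by
        refine (Finset.abs_sum_le_sum_abs _ _).trans ?_
        rw [NN, Finset.sum_mul]
        refine Finset.sum_le_sum fun a _ => ?_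
        rw [abs_mul]
        exact mul_le_mul_of_nonneg_left (abs_le_NN g a) (abs_nonneg _)
      have h2 := abs_sub (∑ a, α a * g a) c
      have := NN_nonneg α
      have := NN_nonneg g
      nlinarith [mul_nonneg (abs_nonneg c) (NN_nonneg g)]
    simpa using this.exp 1
  -- pointwise identity
  have key : ∀ g, Real.exp (μ * f (sh w σ g)) * Real.exp (j g)
      = Z * Real.exp (∑ a, α a * g a - c) := by
    intro g
    have hz : Z * Real.exp (∑ a, α a * g a - c)
        = Real.exp (Real.log Z + (∑ a, α a * g a - c)) := by
      rw [Real.exp_add, Real.exp_log hZ0]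
    rw [hz, ← Real.exp_add]
    congr 1
    simp only [hj]; ring
  have i1 : ∫ g, Real.exp (μ * f (sh w σ g)) * Real.exp (j g) ∂(gA A) = Z := by
    simp only [key]
    rw [integral_const_mul, mgf_A, mul_one]
  have iZ : ∫ g, Real.exp (μ * f (sh w σ g)) ∂(gA A) = Z := by simp [hZ, EE]
  have ij : ∫ g, Real.exp (μ * f (sh w σ g)) * j g ∂(gA A)
      = Z * (c - μ * Phi μ σ f f w + μ * TT μ σ f w) := by
    have e1 : ∀ g, Real.exp (μ * f (sh w σ g)) * j g =
        (∑ a, α a * (g a * Real.exp (μ * f (sh w σ g)))) +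
        ((Real.log Z - c) * Real.exp (μ * f (sh w σ g)) +
          (-μ) * (Real.exp (μ * f (sh w σ g)) * f (sh w σ g))) := by
      intro g
      simp only [hj]
      have : ∑ a, α a * (g a * Real.exp (μ * f (sh w σ g)))
          = (∑ a, α a * g a) * Real.exp (μ * f (sh w σ g)) := by
        rw [Finset.sum_mul]; exact Finset.sum_congr rfl fun a _ => by ring
      rw [this]; ring
    simp only [e1]
    have t1 : ∀ a, EG1 (fun g : A → ℝ => α a * (g a * Real.exp (μ * f (sh w σ g)))) := fun a =>
      ((EG1.coord a).mul fE).smul (α a)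
    have t2 : EG1 (fun g : A → ℝ => (Real.log Z - c) * Real.exp (μ * f (sh w σ g))) := fE.smul _
    have t3 : EG1 (fun g : A → ℝ => (-μ) * (Real.exp (μ * f (sh w σ g)) * f (sh w σ g))) :=
      (fE.mul (hf.eg.comp_sh σ w)).smul _
    rw [integral_add (EG1.sum _ (h := fun a (g : A → ℝ) =>
      α a * (g a * Real.exp (μ * f (sh w σ g)))) fun a _ => t1 a).int (t2.add t3).int,
      integral_add t2.int t3.int, integral_finsetSum _ (fun a _ => (t1 a).int)]
    simp only [integral_const_mul, hα', iZ]
    have hTT : μ * TT μ σ f w = Real.log Z := by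
      simp only [TT, if_neg hμ.ne', ← hZ]; field_simp
    have hPhi : ∫ g, Real.exp (μ * f (sh w σ g)) * f (sh w σ g) ∂(gA A) = Z * Phi μ σ f f w := by
      simp only [Phi, ← hZ]
      rw [mul_div_cancel₀ _ hZ0.ne']
      rfl
    rw [hPhi, hTT]
    have : ∑ a, α a * (α a * Z) = 2 * c * Z := by
      rw [hc, mul_div_cancel₀ _ two_ne_zero, Finset.sum_mul]
      exact Finset.sum_congr rfl fun a _ => by ring
    rw [this]; ring
  -- nonzero
  have hne : ∃ g, j g ≠ 0 := by
    by_contra hcon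
    push Not at hcon
    have h1 : ∀ g, μ * σ a0 * d a0 (sh w σ g) = α a0 := by
      intro g
      have hL : HasDerivAt (fun z => μ * f (sh w σ (Function.update g a0 z)))
          (μ * (d a0 (sh w σ g) * σ a0)) (g a0) := by
        have h1 := (df a0).at (sh w σ (Function.update g a0 0)) (σ a0 * g a0)
        have h2 : HasDerivAt (fun y : ℝ => σ a0 * y) (σ a0) (g a0) := by
          simpa using (hasDerivAt_id (g a0)).const_mul (σ a0)
        have h3 := (HasDerivAt.comp (g a0) h1 h2).const_mul μ
        rw [← sh_update_g w σ g a0, Function.update_eq_self] at h3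
        refine h3.congr_of_eventuallyEq (Eventually.of_forall fun y => ?_)
        simp only [Function.comp]
        rw [sh_update_g w σ g a0 y]
      have hR : HasDerivAt (fun z => ∑ a, α a * (Function.update g a0 z) a - c + Real.log Z)
          (α a0) (g a0) := by
        have : (fun z => ∑ a, α a * (Function.update g a0 z) a - c + Real.log Z)
            = fun z => α a0 * z + (∑ a ∈ Finset.univ.erase a0, α a * g a - c + Real.log Z) := by
          funext z
          rw [← Finset.add_sum_erase _ _ (Finset.mem_univ a0)]
          rw [Finset.sum_congr rfl (g := fun a => α a * g a)]
          · simp; ring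
          · intro b hb
            rw [Function.update_of_ne (Finset.ne_of_mem_erase hb)]
        rw [this]
        simpa using ((hasDerivAt_id (g a0)).const_mul (α a0)).add_const
          (∑ a ∈ Finset.univ.erase a0, α a * g a - c + Real.log Z)
      have : (fun z => μ * f (sh w σ (Function.update g a0 z)))
          = fun z => ∑ a, α a * (Function.update g a0 z) a - c + Real.log Z := by
        funext z
        have := hcon (Function.update g a0 z)
        simp only [hj] at this
        linarith
      rw [this] at hL
      have := hL.unique hR
      linarith
    have h2 : HasDerivAt (fun z => d a0 (w + Pi.single a0 z)) (e w) 0 := dd w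
    have h3 : (fun z => d a0 (w + Pi.single a0 z)) = fun _ => α a0 / (μ * σ a0) := by
      funext z
      have := h1 (Pi.single a0 (z / σ a0))
      have hs : sh w σ (Pi.single a0 (z / σ a0)) = w + Pi.single a0 z := by
        funext b
        by_cases hb : b = a0
        · subst hb; simp [sh]; field_simp
        · simp [sh, hb]
      rw [hs] at this
      rw [← this]
      field_simp
    rw [h3] at h2
    have := h2.unique (hasDerivAt_const (0:ℝ) _)
    exact (he w).ne' this
  obtain ⟨g0, hg0⟩ := hne
  have pos : 0 < ∫ g, Real.exp (μ * f (sh w σ g)) * (Real.exp (j g) - 1 - j g) ∂(gA A) := by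
    have hE : EG1 (fun g => Real.exp (μ * f (sh w σ g)) * (Real.exp (j g) - 1 - j g)) := by
      have := (gE.sub fE).sub (fE.mul jE)
      refine (by simpa [EG1, mul_sub, key] using this)
    refine integral_pos_of_integrable_nonneg_nonzero hE.cont hE.int (fun g => ?_) (x := g0) ?_
    · have := Real.add_one_le_exp (j g)
      exact mul_nonneg (Real.exp_pos _).le (by linarith)
    · have := Real.add_one_lt_exp hg0
      exact (mul_pos (Real.exp_pos _) (by linarith)).ne'
  have eq : ∫ g, Real.exp (μ * f (sh w σ g)) * (Real.exp (j g) - 1 - j g) ∂(gA A)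
      = Z - Z - Z * (c - μ * Phi μ σ f f w + μ * TT μ σ f w) := by
    have hi1 : Integrable (fun g => Real.exp (μ * f (sh w σ g)) * Real.exp (j g)) (gA A) := by
      simp only [key]; exact gE.int
    have hs : ∀ g, Real.exp (μ * f (sh w σ g)) * (Real.exp (j g) - 1 - j g)
        = Real.exp (μ * f (sh w σ g)) * Real.exp (j g) - Real.exp (μ * f (sh w σ g))
          - Real.exp (μ * f (sh w σ g)) * j g := fun g => by ring
    simp only [hs]
    have hi2 : Integrable (fun g => Real.exp (μ * f (sh w σ g)) * Real.exp (j g)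
        - Real.exp (μ * f (sh w σ g))) (gA A) := hi1.sub fE.int
    rw [integral_sub hi2 (fE.mul jE).int, integral_sub hi1 fE.int, i1, iZ, ij]
  rw [eq] at pos
  have h4 : c < μ * (Phi μ σ f f w - TT μ σ f w) := by
    by_contra hcon
    push Not at hcon
    have : 0 ≤ Z * (c - μ * Phi μ σ f f w + μ * TT μ σ f w) :=
      mul_nonneg hZ0.le (by linarith)
    linarith
  have h5 : c = μ ^ 2 * ((1 / 2) * ∑ a, σ a ^ 2 * Phi μ σ f (d a) w ^ 2) := by
    rw [hc, Finset.mul_sum, Finset.mul_sum, Finset.sum_div]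
    exact Finset.sum_congr rfl fun a _ => by simp only [hα]; ring
  rw [lt_div_iff₀ hμ]
  rw [h5] at h4
  have : μ * (μ * ((1 / 2) * ∑ a, σ a ^ 2 * Phi μ σ f (d a) w ^ 2))
    < μ * (Phi μ σ f f w - TT μ σ f w) := by linarith [h4]
  have := lt_of_mul_lt_mul_left this hμ.le
  linarith

end mach4

section box
open Filter Topology
variable {ι : Type} [DecidableEq ι]

/-- Total derivative along a path in a box from continuous partial derivatives. -/
lemma box_deriv {J : ι → Set ℝ} (hJ : ∀ i, (J i).OrdConnected) {f : (ι → ℝ) → ℝ}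
    {D : ι → (ι → ℝ) → ℝ} (s : Finset ι)
    (hfc : ContinuousOn f (Set.univ.pi J))
    (hD : ∀ i ∈ s, ContinuousOn (D i) (Set.univ.pi J))
    (hd : ∀ i ∈ s, ∀ θ ∈ Set.univ.pi J, ∀ z ∈ interior (J i),
      HasDerivAt (fun z => f (Function.update θ i z)) (D i (Function.update θ i z)) z)
    {T : Set ℝ} {t0 : ℝ} (ht0 : t0 ∈ T) {θ : ℝ → ι → ℝ} {θ' : ι → ℝ}
    (hθ : ∀ t ∈ T, θ t ∈ Set.univ.pi J) (hconst : ∀ i ∉ s, ∀ t, θ t i = θ t0 i)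
    (hθ' : ∀ i ∈ s, HasDerivWithinAt (fun t => θ t i) (θ' i) T t0) :
    HasDerivWithinAt (fun t => f (θ t)) (∑ i ∈ s, D i (θ t0) * θ' i) T t0 := by
  induction s using Finset.induction_on generalizing θ with
  | empty =>
    have : ∀ t, θ t = θ t0 := fun t => funext fun i => hconst i (by simp) t
    simp only [this, Finset.sum_empty]
    exact hasDerivWithinAt_const _ _ _
  | insert i s hi ih =>
    have mem : ∀ t ∈ T, ∀ z ∈ J i, Function.update (θ t) i z ∈ Set.univ.pi J := by
      intro t ht z hz k _
      by_cases h : k = i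
      · subst h; simpa using hz
      · simpa [h] using hθ t ht k trivial
    set θ2 : ℝ → ι → ℝ := fun t => Function.update (θ t) i (θ t0 i) with hθ2
    have h20 : θ2 t0 = θ t0 := by simp [hθ2]
    have ih' := ih (fun k hk => hD k (Finset.mem_insert_of_mem hk))
      (fun k hk => hd k (Finset.mem_insert_of_mem hk)) (θ := θ2)
      (fun t ht => mem t ht _ (hθ t0 ht0 i trivial))
      (fun k hk t => by
        by_cases h : k = i
        · subst h; simp [hθ2]
        · simp only [hθ2, Function.update_of_ne h]
          exact hconst k (by simp [h, hk]) t)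
      (fun k hk => by
        have h : k ≠ i := fun h => hi (h ▸ hk)
        simp only [hθ2, Function.update_of_ne h]
        exact hθ' k (Finset.mem_insert_of_mem hk))
    rw [h20] at ih'
    rw [Finset.sum_insert hi]
    -- mean value
    have mvt : ∀ t ∈ T, ∃ c ∈ Set.uIcc (θ t0 i) (θ t i),
        f (θ t) - f (θ2 t) = D i (Function.update (θ t) i c) * (θ t i - θ t0 i) := by
      intro t ht
      have m0 : θ t0 i ∈ J i := hθ t0 ht0 i trivial
      have m1 : θ t i ∈ J i := hθ t ht i trivial
      have cont : ContinuousOn (fun z => f (Function.update (θ t) i z)) (J i) := by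
        refine hfc.comp (f := fun z => Function.update (θ t) i z) ?_ (fun z hz => mem t ht z hz)
        exact Continuous.continuousOn (by fun_prop)
      have gen : ∀ a ∈ J i, ∀ b ∈ J i, a < b → ∃ c ∈ Set.Ioo a b,
          D i (Function.update (θ t) i c) = (f (Function.update (θ t) i b)
            - f (Function.update (θ t) i a)) / (b - a) := by
        intro a ha b hb hab
        have hsub : Set.Icc a b ⊆ J i := (hJ i).out ha hb
        refine exists_hasDerivAt_eq_slope (fun z => f (Function.update (θ t) i z))
          (fun z => D i (Function.update (θ t) i z)) hab (cont.mono hsub) fun z hz => ?_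
        refine hd i (Finset.mem_insert_self _ _) (θ t) (hθ t ht) z ?_
        exact interior_mono hsub (by rwa [interior_Icc])
      rcases lt_trichotomy (θ t0 i) (θ t i) with h | h | h
      · obtain ⟨c, hc, e⟩ := gen _ m0 _ m1 h
        refine ⟨c, Set.Icc_subset_uIcc ⟨hc.1.le, hc.2.le⟩, ?_⟩
        rw [e, Function.update_eq_self, div_mul_cancel₀ _ (by linarith : θ t i - θ t0 i ≠ 0) ]
      · refine ⟨θ t0 i, Set.left_mem_uIcc, ?_⟩
        simp [hθ2, h]
      · obtain ⟨c, hc, e⟩ := gen _ m1 _ m0 h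
        refine ⟨c, Set.Icc_subset_uIcc' ⟨hc.1.le, hc.2.le⟩, ?_⟩
        rw [e, Function.update_eq_self]
        have : θ t0 i - θ t i ≠ 0 := by linarith
        field_simp
        simp only [hθ2]; ring
    choose! c hc hce using mvt
    have hci : ContinuousWithinAt (fun t => θ t i) T t0 :=
      (hθ' i (Finset.mem_insert_self _ _)).continuousWithinAt
    have hctend : Tendsto c (𝓝[T] t0) (𝓝 (θ t0 i)) := by
      rw [tendsto_iff_dist_tendsto_zero]
      have h1 : Tendsto (fun t => dist (θ t i) (θ t0 i)) (𝓝[T] t0) (𝓝 0) :=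
        (tendsto_iff_dist_tendsto_zero).1 hci
      refine squeeze_zero' (Eventually.of_forall fun _ => dist_nonneg) ?_ h1
      filter_upwards [self_mem_nhdsWithin] with t ht
      have := Set.abs_sub_left_of_mem_uIcc (hc t ht)
      rw [Real.dist_eq, Real.dist_eq]
      exact this
    have hDt : Tendsto (fun t => D i (Function.update (θ t) i (c t))) (𝓝[T] t0)
        (𝓝 (D i (θ t0))) := by
      refine Tendsto.comp (hD i (Finset.mem_insert_self _ _) (θ t0) (hθ t0 ht0)) ?_
      refine tendsto_nhdsWithin_iff.2 ⟨?_, ?_⟩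
      · rw [tendsto_pi_nhds]
        intro k
        by_cases h : k = i
        · subst h; simpa using hctend
        · simp only [Function.update_of_ne h]
          by_cases hk : k ∈ s
          · exact (hθ' k (Finset.mem_insert_of_mem hk)).continuousWithinAt
          · have : (fun t => θ t k) = fun _ => θ t0 k :=
              funext fun t => hconst k (by simp [h, hk]) t
            rw [this]; exact tendsto_const_nhds
      · filter_upwards [self_mem_nhdsWithin] with t ht
        exact mem t ht _ ((hJ i).uIcc_subset (hθ t0 ht0 i trivial) (hθ t ht i trivial) (hc t ht))
    have first : HasDerivWithinAt (fun t => f (θ t) - f (θ2 t)) (D i (θ t0) * θ' i) T t0 := by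
      rw [hasDerivWithinAt_iff_tendsto_slope]
      have hs := hasDerivWithinAt_iff_tendsto_slope.1 (hθ' i (Finset.mem_insert_self _ _))
      have hm : 𝓝[T \ {t0}] t0 ≤ 𝓝[T] t0 := nhdsWithin_mono _ Set.sdiff_subset
      refine ((hDt.mono_left hm).mul hs).congr' ?_
      filter_upwards [self_mem_nhdsWithin] with t ht
      simp only [slope, vsub_eq_sub, smul_eq_mul]
      rw [hce t ht.1, hce t0 ht0]
      ring
    have := first.add ih'
    refine this.congr_of_mem (fun t _ => ?_) ht0
    simp

end box

section recur
open Filter Topology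
variable {A : Type} [Fintype A] [DecidableEq A]

/-- Parameter coordinates: variances `(k,a)` and tilting parameters `k`. -/
abbrev Ix (A : Type) : Type := ℕ × A ⊕ ℕ

/-- Standard deviations. -/
def sg (θ : Ix A → ℝ) (k : ℕ) (a : A) : ℝ := √(θ (Sum.inl (k, a)))
/-- Tilting parameters. -/
def mu (θ : Ix A → ℝ) (k : ℕ) : ℝ := θ (Sum.inr k)

/-- Parisi recursion. -/
def fK (L : (A → ℝ) → ℝ) (θ : Ix A → ℝ) : ℕ → (A → ℝ) → ℝ
  | 0 => L
  | k+1 => TT (mu θ (k+1)) (sg θ k) (fK L θ k)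

/-- First derivatives. -/
def dK (L : (A → ℝ) → ℝ) (d0 : A → (A → ℝ) → ℝ) (θ : Ix A → ℝ) : ℕ → A → (A → ℝ) → ℝ
  | 0 => d0
  | k+1 => fun a => Phi (mu θ (k+1)) (sg θ k) (fK L θ k) (dK L d0 θ k a)

/-- `Φ_k`. -/
def PK (L : (A → ℝ) → ℝ) (θ : Ix A → ℝ) (k : ℕ) (h : (A → ℝ) → ℝ) : (A → ℝ) → ℝ :=
  Phi (mu θ (k+1)) (sg θ k) (fK L θ k) h

/-- Second derivatives. -/
def eK (L : (A → ℝ) → ℝ) (d0 e0 : A → (A → ℝ) → ℝ) (θ : Ix A → ℝ) : ℕ → A → (A → ℝ) → ℝ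
  | 0 => e0
  | k+1 => fun a w => PK L θ k (fun v => eK L d0 e0 θ k a v + mu θ (k+1) * (dK L d0 θ k a v) ^ 2) w
      - mu θ (k+1) * (dK L d0 θ (k+1) a w) ^ 2

/-- Composition of the `Φ`s. -/
def PU (L : (A → ℝ) → ℝ) (θ : Ix A → ℝ) (k : ℕ) : ℕ → ((A → ℝ) → ℝ) → (A → ℝ) → ℝ
  | 0, h => h
  | j+1, h => if j < k then h else PK L θ j (PU L θ k j h)

/-- The box. -/
def JJ (A : Type) (r : ℕ) : Ix A → Set ℝ
  | Sum.inl _ => Set.Ici 0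
  | Sum.inr k => if k = 0 then {1} else if k ≤ r then Set.Ioi 0 else {0}

/-- The box of parameters. -/
def SS (A : Type) (r : ℕ) : Set (Ix A → ℝ) := Set.univ.pi (JJ A r)

/-- Regularity of the base function. -/
structure HL (L : (A → ℝ) → ℝ) (d0 e0 : A → (A → ℝ) → ℝ) : Prop where
  lg : LG1 L
  dg : ∀ a, EG1 (d0 a)
  eg : ∀ a, EG1 (e0 a)
  df : ∀ a, DD a L (d0 a)
  dd : ∀ a, DD a (d0 a) (e0 a)

lemma JJ_conn (r : ℕ) (i : Ix A) : (JJ A r i).OrdConnected := by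
  rcases i with ⟨k, a⟩ | k
  · exact Set.ordConnected_Ici
  · simp only [JJ]
    split_ifs
    · exact Set.ordConnected_singleton
    · exact Set.ordConnected_Ioi
    · exact Set.ordConnected_singleton

lemma mu_pos {r : ℕ} {θ : Ix A → ℝ} (hθ : θ ∈ SS A r) {k : ℕ} (hk : k ≤ r) : 0 < mu θ k := by
  have := hθ (Sum.inr k) trivial
  simp only [JJ] at this
  unfold mu
  split_ifs at this
  · have : θ (Sum.inr k) = 1 := this
    linarith
  · exact this

lemma mu_zero {r : ℕ} {θ : Ix A → ℝ} (hθ : θ ∈ SS A r) {k : ℕ} (hk : r < k) : mu θ k = 0 := by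
  have := hθ (Sum.inr k) trivial
  simp only [JJ] at this
  rw [if_neg (by omega), if_neg (by omega)] at this
  exact this

lemma mu_nonneg {r : ℕ} {θ : Ix A → ℝ} (hθ : θ ∈ SS A r) (k : ℕ) : 0 ≤ mu θ k := by
  rcases le_or_gt k r with h | h
  · exact (mu_pos hθ h).le
  · exact (mu_zero hθ h).ge

lemma mu_cont (r k : ℕ) : ContinuousOn (fun θ : Ix A → ℝ => mu θ k) (SS A r) :=
  (continuous_apply _).continuousOn
lemma sg_cont (r k : ℕ) : ContinuousOn (fun θ : Ix A → ℝ => sg θ k) (SS A r) := by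
  refine Continuous.continuousOn (continuous_pi fun a => ?_)
  exact Real.continuous_sqrt.comp (continuous_apply _)

variable {L : (A → ℝ) → ℝ} {d0 e0 : A → (A → ℝ) → ℝ} {r : ℕ}

lemma fK_LG (H : LG1 L) (k : ℕ) : LG (SS A r) (fun θ => fK L θ k) := by
  induction k with
  | zero => exact H.fam
  | succ k ih =>
    refine TT_LG (μ := fun θ => mu θ (k+1)) (σ := fun θ => sg θ k) ih (mu_cont r _) (sg_cont r _) ?_
    rcases le_or_gt (k+1) r with h | h
    · exact Or.inl fun θ hθ => mu_pos hθ h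
    · exact Or.inr fun θ hθ => mu_zero hθ h

lemma PK_EG (H : LG1 L) (k : ℕ) {h : (Ix A → ℝ) → (A → ℝ) → ℝ} (hh : EG (SS A r) h) :
    EG (SS A r) (fun θ => PK L θ k (h θ)) :=
  Phi_EG (μ := fun θ => mu θ (k+1)) (σ := fun θ => sg θ k) (fK_LG H k) hh (mu_cont r _) (sg_cont r _)

lemma PU_EG (H : LG1 L) (k j : ℕ) {h : (Ix A → ℝ) → (A → ℝ) → ℝ} (hh : EG (SS A r) h) :
    EG (SS A r) (fun θ => PU L θ k j (h θ)) := by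
  induction j with
  | zero => exact hh
  | succ j ih =>
    simp only [PU]
    by_cases hj : j < k
    · simpa [hj] using hh
    · simp only [hj, if_false]
      exact PK_EG H j ih

lemma dK_EG (H : HL L d0 e0) (k : ℕ) (a : A) : EG (SS A r) (fun θ => dK L d0 θ k a) := by
  induction k with
  | zero => exact (H.dg a).fam
  | succ k ih => exact PK_EG H.lg k ih

lemma eK_EG (H : HL L d0 e0) (k : ℕ) (a : A) : EG (SS A r) (fun θ => eK L d0 e0 θ k a) := by
  induction k with
  | zero => exact (H.eg a).fam
  | succ k ih =>
    refine EG.sub (PK_EG H.lg k (h := fun θ v => eK L d0 e0 θ k a v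
      + mu θ (k+1) * (dK L d0 θ k a v) ^ 2) ?_) ?_
    · refine ih.add ?_
      simp only [pow_two]
      exact EG.smul (mu_cont r _) ((dK_EG H k a).mul (dK_EG H k a))
    · simp only [pow_two]
      exact EG.smul (mu_cont r _) ((dK_EG H (k+1) a).mul (dK_EG H (k+1) a))

variable {θ : Ix A → ℝ}

lemma fK_LG1 (H : LG1 L) (hθ : θ ∈ SS A r) (k : ℕ) : LG1 (fK L θ k) := (fK_LG H k).at hθ
lemma dK_EG1 (H : HL L d0 e0) (hθ : θ ∈ SS A r) (k : ℕ) (a : A) : EG1 (dK L d0 θ k a) :=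
  (dK_EG H k a).at hθ
lemma eK_EG1 (H : HL L d0 e0) (hθ : θ ∈ SS A r) (k : ℕ) (a : A) : EG1 (eK L d0 e0 θ k a) :=
  (eK_EG H k a).at hθ
lemma PK_EG1 (H : LG1 L) (hθ : θ ∈ SS A r) (k : ℕ) {h : (A → ℝ) → ℝ} (hh : EG1 h) :
    EG1 (PK L θ k h) := (PK_EG (h := fun _ => h) H k hh.fam).at hθ
lemma PU_EG1 (H : LG1 L) (hθ : θ ∈ SS A r) (k j : ℕ) {h : (A → ℝ) → ℝ} (hh : EG1 h) :
    EG1 (PU L θ k j h) := (PU_EG (h := fun _ => h) H k j hh.fam).at hθ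
lemma EG1.sq {h : (A → ℝ) → ℝ} (hh : EG1 h) : EG1 (fun w => h w ^ 2) := by
  simp only [pow_two]; exact hh.mul hh

lemma fK_DD (H : HL L d0 e0) (hθ : θ ∈ SS A r) (k : ℕ) (a : A) :
    DD a (fK L θ k) (dK L d0 θ k a) := by
  induction k with
  | zero => exact H.df a
  | succ k ih => exact DD_TT (fK_LG1 H.lg hθ k) (dK_EG1 H hθ k a) ih _ _

lemma dK_DD (H : HL L d0 e0) (hθ : θ ∈ SS A r) (k : ℕ) (a : A) :
    DD a (dK L d0 θ k a) (eK L d0 e0 θ k a) := by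
  induction k with
  | zero => exact H.dd a
  | succ k ih =>
    refine (DD_Phi (fK_LG1 H.lg hθ k) (dK_EG1 H hθ k a) (dK_EG1 H hθ k a) (eK_EG1 H hθ k a)
      (fK_DD H hθ k a) ih _ _).congr fun w => ?_
    simp only [eK, dK, PK, pow_two]

/- PU algebra -/
lemma PU_low (k : ℕ) (h : (A → ℝ) → ℝ) {j : ℕ} (hj : j ≤ k) : PU L θ k j h = h := by
  cases j with
  | zero => rfl
  | succ j => simp only [PU]; rw [if_pos (by omega)]

lemma PU_succ (k : ℕ) (h : (A → ℝ) → ℝ) {j : ℕ} (hj : k ≤ j) :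
    PU L θ k (j+1) h = PK L θ j (PU L θ k j h) := by
  simp only [PU]; rw [if_neg (by omega)]

lemma PU_shift (k : ℕ) (h : (A → ℝ) → ℝ) {j : ℕ} (hj : k + 1 ≤ j) :
    PU L θ k j h = PU L θ (k+1) j (PK L θ k h) := by
  induction j, hj using Nat.le_induction with
  | base => rw [PU_succ k h le_rfl, PU_low k h le_rfl, PU_low _ _ le_rfl]
  | succ j hj ih => rw [PU_succ k h (by omega), PU_succ (k+1) _ hj, ih]

lemma PU_add (H : LG1 L) (hθ : θ ∈ SS A r) (k : ℕ) {h h' : (A → ℝ) → ℝ} (hh : EG1 h)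
    (hh' : EG1 h') (j : ℕ) :
    PU L θ k j (fun v => h v + h' v) = fun v => PU L θ k j h v + PU L θ k j h' v := by
  induction j with
  | zero => rfl
  | succ j ih =>
    by_cases hj : j < k
    · simp only [PU, hj, if_true]
    · simp only [PU, hj, if_false]
      rw [ih]
      funext v
      exact Phi_add (fK_LG1 H hθ j) (PU_EG1 H hθ k j hh) (PU_EG1 H hθ k j hh') _ _ _

lemma PU_smul (k : ℕ) (h : (A → ℝ) → ℝ) (b : ℝ) (j : ℕ) :
    PU L θ k j (fun v => b * h v) = fun v => b * PU L θ k j h v := by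
  induction j with
  | zero => rfl
  | succ j ih =>
    by_cases hj : j < k
    · simp only [PU, hj, if_true]
    · simp only [PU, hj, if_false]
      rw [ih]
      funext v
      exact Phi_smul _ _ _ _ _ _

lemma PU_const (H : LG1 L) (hθ : θ ∈ SS A r) (k : ℕ) (b : ℝ) (j : ℕ) :
    PU L θ k j (fun v => b) = fun v => b := by
  induction j with
  | zero => rfl
  | succ j ih =>
    by_cases hj : j < k
    · simp only [PU, hj, if_true]
    · simp only [PU, hj, if_false]
      rw [ih]
      funext v
      exact Phi_const (fK_LG1 H hθ j) _ _ _ _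

lemma PU_sum (H : LG1 L) (hθ : θ ∈ SS A r) (k : ℕ) {ι : Type} (s : Finset ι)
    {h : ι → (A → ℝ) → ℝ} (hh : ∀ i ∈ s, EG1 (h i)) (j : ℕ) :
    PU L θ k j (fun v => ∑ i ∈ s, h i v) = fun v => ∑ i ∈ s, PU L θ k j (h i) v := by
  induction j with
  | zero => rfl
  | succ j ih =>
    by_cases hj : j < k
    · simp only [PU, hj, if_true]
    · simp only [PU, hj, if_false]
      rw [ih]
      funext v
      exact Phi_sum s (fK_LG1 H hθ j) (fun i hi => PU_EG1 H hθ k j (hh i hi)) _ _ _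

lemma PU_nonneg (H : LG1 L) (hθ : θ ∈ SS A r) (k : ℕ) {h : (A → ℝ) → ℝ} (h0 : ∀ v, 0 ≤ h v)
    (j : ℕ) : ∀ v, 0 ≤ PU L θ k j h v := by
  induction j with
  | zero => exact h0
  | succ j ih =>
    by_cases hj : j < k
    · simpa only [PU, hj, if_true] using h0
    · simp only [PU, hj, if_false]
      exact fun v => Phi_nonneg (fK_LG1 H hθ j) ih _ _ _

lemma PU_pos (H : LG1 L) (hθ : θ ∈ SS A r) (k : ℕ) {h : (A → ℝ) → ℝ} (hh : EG1 h)
    (h0 : ∀ v, 0 < h v) (j : ℕ) : ∀ v, 0 < PU L θ k j h v := by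
  induction j with
  | zero => exact h0
  | succ j ih =>
    by_cases hj : j < k
    · simpa only [PU, hj, if_true] using h0
    · simp only [PU, hj, if_false]
      exact fun v => Phi_pos (fK_LG1 H hθ j) (PU_EG1 H hθ k j hh) ih _ _ _

/-- `∂` in a variance, normalised. -/
def XK (L : (A → ℝ) → ℝ) (d0 e0 : A → (A → ℝ) → ℝ) (r : ℕ) (θ : Ix A → ℝ) (k : ℕ) (a : A) : ℝ :=
  PU L θ k (r+1) (fun v => eK L d0 e0 θ k a v + mu θ (k+1) * (dK L d0 θ k a v) ^ 2) 0
/-- Overlap. -/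
def SK (L : (A → ℝ) → ℝ) (d0 : A → (A → ℝ) → ℝ) (r : ℕ) (θ : Ix A → ℝ) (k : ℕ) (a : A) : ℝ :=
  PU L θ k (r+1) (fun v => (dK L d0 θ k a v) ^ 2) 0
/-- Entropy gap. -/
def gapK (L : (A → ℝ) → ℝ) (θ : Ix A → ℝ) (k : ℕ) (w : A → ℝ) : ℝ :=
  (PK L θ k (fK L θ k) w - fK L θ (k+1) w) / mu θ (k+1)
/-- `∂` in a tilting parameter. -/
def GK (L : (A → ℝ) → ℝ) (r : ℕ) (θ : Ix A → ℝ) (k : ℕ) : ℝ :=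
  PU L θ (k+1) (r+1) (gapK L θ k) 0

lemma XK_rec (H : HL L d0 e0) (hθ : θ ∈ SS A r) {k : ℕ} (hk : k + 1 ≤ r) (a : A) :
    XK L d0 e0 r θ (k+1) a = XK L d0 e0 r θ k a
      + (mu θ (k+2) - mu θ (k+1)) * SK L d0 r θ (k+1) a := by
  have h1 : EG1 (fun v => eK L d0 e0 θ k a v + mu θ (k+1) * (dK L d0 θ k a v) ^ 2) :=
    (eK_EG1 H hθ k a).add ((dK_EG1 H hθ k a).sq.smul _)
  have h2 : (fun v => eK L d0 e0 θ (k+1) a v + mu θ (k+1+1) * (dK L d0 θ (k+1) a v) ^ 2)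
      = fun v => PK L θ k (fun v => eK L d0 e0 θ k a v + mu θ (k+1) * (dK L d0 θ k a v) ^ 2) v
        + (mu θ (k+2) - mu θ (k+1)) * (dK L d0 θ (k+1) a v) ^ 2 := by
    funext v; simp only [eK]; ring
  unfold XK SK
  rw [h2, PU_add H.lg hθ _ (PK_EG1 H.lg hθ k h1) ((dK_EG1 H hθ (k+1) a).sq.smul _), PU_smul,
    PU_shift k _ (by omega)]

lemma eK_nonneg (H : HL L d0 e0) (hθ : θ ∈ SS A r) (a : A) (h0 : ∀ w, 0 ≤ e0 a w) (k : ℕ) :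
    ∀ w, 0 ≤ eK L d0 e0 θ k a w := by
  induction k with
  | zero => exact h0
  | succ k ih =>
    intro w
    simp only [eK, PK]
    rw [Phi_add (fK_LG1 H.lg hθ k) (eK_EG1 H hθ k a) ((dK_EG1 H hθ k a).sq.smul _), Phi_smul]
    have h1 := Phi_nonneg (fK_LG1 H.lg hθ k) ih (mu θ (k+1)) (sg θ k) w
    have h2 := Phi_sq (fK_LG1 H.lg hθ k) (dK_EG1 H hθ k a) (mu θ (k+1)) (sg θ k) w
    have h3 := mul_le_mul_of_nonneg_left h2 (mu_nonneg hθ (k+1))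
    simp only [dK]
    linarith

lemma eK_pos (H : HL L d0 e0) (hθ : θ ∈ SS A r) (a : A) (h0 : ∀ w, 0 < e0 a w) (k : ℕ) :
    ∀ w, 0 < eK L d0 e0 θ k a w := by
  induction k with
  | zero => exact h0
  | succ k ih =>
    intro w
    simp only [eK, PK]
    rw [Phi_add (fK_LG1 H.lg hθ k) (eK_EG1 H hθ k a) ((dK_EG1 H hθ k a).sq.smul _), Phi_smul]
    have h1 := Phi_pos (fK_LG1 H.lg hθ k) (eK_EG1 H hθ k a) ih (mu θ (k+1)) (sg θ k) w
    have h2 := Phi_sq (fK_LG1 H.lg hθ k) (dK_EG1 H hθ k a) (mu θ (k+1)) (sg θ k) w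
    have h3 := mul_le_mul_of_nonneg_left h2 (mu_nonneg hθ (k+1))
    simp only [dK]
    linarith

lemma XK_nonneg (H : HL L d0 e0) (hθ : θ ∈ SS A r) (a : A) (h0 : ∀ w, 0 ≤ e0 a w) (k : ℕ) :
    0 ≤ XK L d0 e0 r θ k a := by
  refine PU_nonneg H.lg hθ k (fun v => ?_) _ _
  exact add_nonneg (eK_nonneg H hθ a h0 k v) (mul_nonneg (mu_nonneg hθ _) (sq_nonneg _))

lemma gapK_EG (H : LG1 L) {k : ℕ} (hk : k + 1 ≤ r) : EG (SS A r) (fun θ => gapK L θ k) := by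
  have h1 : EG (SS A r) (fun θ w => (mu θ (k+1))⁻¹ * (PK L θ k (fK L θ k) w - fK L θ (k+1) w)) :=
    EG.smul ((mu_cont r _).inv₀ fun θ hθ => (mu_pos hθ hk).ne')
      ((PK_EG H k (fK_LG H k).eg).sub (fK_LG H (k+1)).eg)
  refine (congrArg (EG (SS A r)) ?_).mp h1
  funext θ w
  simp only [gapK]; rw [div_eq_inv_mul]

lemma GK_gt (H : HL L d0 e0) (hθ : θ ∈ SS A r) {k : ℕ} (hk : k + 1 ≤ r) (a0 : A)
    (hσ : sg θ k a0 ≠ 0) (h0 : ∀ w, 0 < e0 a0 w) :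
    (1 / 2) * ∑ a, sg θ k a ^ 2 * SK L d0 r θ (k+1) a < GK L r θ k := by
  have hgap : ∀ w, 0 < gapK L θ k w - (1/2) * ∑ a, sg θ k a ^ 2 * dK L d0 θ (k+1) a w ^ 2 := by
    intro w
    have := KL_gap (fK_LG1 H.lg hθ k) (fun a => dK_EG1 H hθ k a) (fun a => fK_DD H hθ k a)
      (mu_pos hθ hk) (sg θ k) w hσ (dK_DD H hθ k a0) (eK_pos H hθ a0 h0 k)
    simp only [gapK, PK, dK, fK] at this ⊢
    linarith
  have hg1 : EG1 (gapK L θ k) := (gapK_EG H.lg hk).at hθ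
  have hs1 : EG1 (fun w => ∑ a, sg θ k a ^ 2 * dK L d0 θ (k+1) a w ^ 2) :=
    EG1.sum _ fun a _ => (dK_EG1 H hθ (k+1) a).sq.smul _
  have h1 := PU_pos H.lg hθ (k+1) (hg1.sub (hs1.smul (1/2))) hgap (r+1) 0
  have e1 : (fun w => gapK L θ k w - (1/2) * ∑ a, sg θ k a ^ 2 * dK L d0 θ (k+1) a w ^ 2)
      = fun w => gapK L θ k w + (-(1/2)) * ∑ a, sg θ k a ^ 2 * dK L d0 θ (k+1) a w ^ 2 := by
    funext w; ring
  rw [e1, PU_add H.lg hθ _ hg1 (hs1.smul _), PU_smul,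
    PU_sum H.lg hθ _ _ (fun a _ => (dK_EG1 H hθ (k+1) a).sq.smul _)] at h1
  simp only [PU_smul] at h1
  unfold GK SK
  linarith

/- partial derivatives -/
lemma fK_indep {i : Ix A} {θ : Ix A → ℝ} {z : ℝ} {k : ℕ}
    (hi : (∃ a, i = Sum.inl (k, a)) ∨ i = Sum.inr (k+1)) :
    ∀ j ≤ k, fK L (Function.update θ i z) j = fK L θ j := by
  intro j
  induction j with
  | zero => intro _; rfl
  | succ j ih =>
    intro hj
    simp only [fK]
    rw [ih (by omega)]
    congr 1
    · unfold mu
      rw [Function.update_of_ne]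
      rcases hi with ⟨a, rfl⟩ | rfl
      · simp
      · simp; omega
    · funext b
      unfold sg
      rw [Function.update_of_ne]
      rcases hi with ⟨a, rfl⟩ | rfl
      · simp; omega
      · simp

lemma upd_mem {θ : Ix A → ℝ} (hθ : θ ∈ SS A r) (i : Ix A) {z : ℝ} (hz : z ∈ JJ A r i) :
    Function.update θ i z ∈ SS A r := by
  intro j _
  by_cases h : j = i
  · subst h; simpa using hz
  · rw [Function.update_of_ne h]; exact hθ j trivial

lemma fK_partial_up (H : LG1 L) (hθ : θ ∈ SS A r) {i : Ix A} {k : ℕ}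
    (hi : (∃ a, i = Sum.inl (k, a)) ∨ i = Sum.inr (k+1))
    {B : (Ix A → ℝ) → (A → ℝ) → ℝ} (hB : EG (SS A r) B)
    (hbase : ∀ z ∈ interior (JJ A r i), ∀ w,
      HasDerivAt (fun z => fK L (Function.update θ i z) (k+1) w) (B (Function.update θ i z) w) z)
    {j : ℕ} (hj : k + 1 ≤ j) :
    ∀ z ∈ interior (JJ A r i), ∀ w, HasDerivAt (fun z => fK L (Function.update θ i z) j w)
      (PU L (Function.update θ i z) (k+1) j (B (Function.update θ i z)) w) z := by
  induction j, hj using Nat.le_induction with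
  | base =>
    intro z hz w
    rw [PU_low _ _ le_rfl]
    exact hbase z hz w
  | succ j hj ih =>
    intro z hz w
    have hmaps : Set.MapsTo (fun z : ℝ => Function.update θ i z) (interior (JJ A r i)) (SS A r) :=
      fun z hz => upd_mem hθ i (interior_subset hz)
    have hc : ContinuousOn (fun z : ℝ => Function.update θ i z) (interior (JJ A r i)) :=
      (show Continuous fun z : ℝ => Function.update θ i z by fun_prop).continuousOn
    have h1 := TT_deriv isOpen_interior ((fK_LG H j).reparam hc hmaps)
      ((PU_EG H (k+1) j hB).reparam hc hmaps) ih (mu θ (j+1)) (sg θ j) w hz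
    have hmu : ∀ z, mu (Function.update θ i z) (j+1) = mu θ (j+1) := by
      intro z
      unfold mu
      rw [Function.update_of_ne]
      rcases hi with ⟨a, rfl⟩ | rfl
      · simp
      · simp; omega
    have hsg : ∀ z, sg (Function.update θ i z) j = sg θ j := by
      intro z
      funext b
      unfold sg
      rw [Function.update_of_ne]
      rcases hi with ⟨a, rfl⟩ | rfl
      · simp; omega
      · simp
    rw [PU_succ _ _ hj]
    simp only [PK, fK, hmu, hsg]
    exact h1

/-- All partial derivatives of the Parisi functional. -/
def DP (L : (A → ℝ) → ℝ) (d0 e0 : A → (A → ℝ) → ℝ) (r : ℕ) : Ix A → (Ix A → ℝ) → ℝ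
  | Sum.inl (k, a), θ => (1 / 2) * XK L d0 e0 r θ k a
  | Sum.inr 0, θ => 0
  | Sum.inr (k+1), θ => GK L r θ k

/-- The relevant coordinates. -/
def sIx (A : Type) [Fintype A] [DecidableEq A] (r : ℕ) : Finset (Ix A) :=
  (Finset.range (r+1) ×ˢ Finset.univ).disjSum ((Finset.range r).map ⟨Nat.succ, Nat.succ_injective⟩)

lemma mem_sIx_inl {k : ℕ} {a : A} : (Sum.inl (k, a) : Ix A) ∈ sIx A r ↔ k < r + 1 := by
  simp [sIx]
lemma mem_sIx_inr {k : ℕ} : (Sum.inr k : Ix A) ∈ sIx A r ↔ 1 ≤ k ∧ k ≤ r := by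
  simp only [sIx, Finset.inr_mem_disjSum, Finset.mem_map, Finset.mem_range,
    Function.Embedding.coeFn_mk]
  constructor
  · rintro ⟨a, h, rfl⟩; omega
  · rintro ⟨h1, h2⟩; exact ⟨k - 1, by omega, by omega⟩

lemma DP_cont (H : HL L d0 e0) (i : Ix A) (hi : i ∈ sIx A r) :
    ContinuousOn (DP L d0 e0 r i) (SS A r) := by
  rcases i with ⟨k, a⟩ | k
  · refine ContinuousOn.mul continuousOn_const ?_
    refine (PU_EG H.lg k (r+1) (h := fun θ v => eK L d0 e0 θ k a v
      + mu θ (k+1) * (dK L d0 θ k a v) ^ 2) ?_).cont2 0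
    refine (eK_EG H k a).add ?_
    simp only [pow_two]
    exact EG.smul (mu_cont r _) ((dK_EG H k a).mul (dK_EG H k a))
  · obtain ⟨h1, h2⟩ := mem_sIx_inr.1 hi
    obtain ⟨k, rfl⟩ : ∃ k', k = k' + 1 := ⟨k - 1, by omega⟩
    exact (PU_EG H.lg (k+1) (r+1) (gapK_EG H.lg h2)).cont2 0

lemma DP_deriv (H : HL L d0 e0) (i : Ix A) (hi : i ∈ sIx A r) (hθ : θ ∈ SS A r)
    {z : ℝ} (hz : z ∈ interior (JJ A r i)) :
    HasDerivAt (fun z => fK L (Function.update θ i z) (r+1) 0)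
      (DP L d0 e0 r i (Function.update θ i z)) z := by
  rcases i with ⟨k, a⟩ | k
  · have hk := mem_sIx_inl.1 hi
    have hB : EG (SS A r) (fun θ v => eK L d0 e0 θ k a v + mu θ (k+1) * (dK L d0 θ k a v) ^ 2) := by
      refine (eK_EG H k a).add ?_
      simp only [pow_two]
      exact EG.smul (mu_cont r _) ((dK_EG H k a).mul (dK_EG H k a))
    have key := fK_partial_up H.lg hθ (i := Sum.inl (k, a)) (k := k) (Or.inl ⟨a, rfl⟩)
      (B := fun θ w => (1/2) * PK L θ k (fun v => eK L d0 e0 θ k a v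
        + mu θ (k+1) * (dK L d0 θ k a v) ^ 2) w)
      (EG.smul continuousOn_const (PK_EG H.lg k hB)) ?_ (j := r+1) (by omega) z hz 0
    · refine key.congr_deriv ?_
      rw [PU_smul]
      simp only [DP, XK]
      rw [PU_shift k _ (by omega)]
    · intro z hz w
      have hz0 : 0 < z := by simpa [JJ] using hz
      set θ' := Function.update θ (Sum.inl (k, a)) z with hθ'
      have hmem : θ' ∈ SS A r := upd_mem hθ _ (interior_subset hz)
      have h1 := TTsig (fK_LG1 H.lg hmem k) (dK_EG1 H hmem k a) (eK_EG1 H hmem k a)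
        (fK_DD H hmem k a) (dK_DD H hmem k a) (mu θ' (k+1)) (sg θ' k) w hz0
      have e1 : Function.update (sg θ' k) a (√z) = sg θ' k := by
        rw [Function.update_eq_self_iff]
        simp [sg, hθ']
      rw [e1] at h1
      refine h1.congr_of_eventuallyEq (Eventually.of_forall fun y => ?_)
      have e2 : Function.update θ (Sum.inl (k, a)) y = Function.update θ' (Sum.inl (k, a)) y := by
        rw [hθ']; simp
      simp only [fK]
      rw [e2, fK_indep (k := k) (Or.inl ⟨a, rfl⟩) k le_rfl]
      congr 1
      funext b
      by_cases hb : b = a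
      · subst hb; simp [sg]
      · simp [sg, hb]
  · obtain ⟨h1, h2⟩ := mem_sIx_inr.1 hi
    obtain ⟨k, rfl⟩ : ∃ k', k = k' + 1 := ⟨k - 1, by omega⟩
    refine fK_partial_up H.lg hθ (i := Sum.inr (k+1)) (k := k) (Or.inr rfl)
      (B := fun θ => gapK L θ k) (gapK_EG H.lg h2) ?_ (j := r+1) (by omega) z hz 0
    intro z hz w
    have hz0 : 0 < z := by
      have := interior_subset hz
      simp only [JJ] at this
      rw [if_neg (by omega), if_pos h2] at this
      exact this
    set θ' := Function.update θ (Sum.inr (k+1)) z with hθ'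
    have hmem : θ' ∈ SS A r := upd_mem hθ _ (interior_subset hz)
    have hmu : mu θ' (k+1) = z := by simp [mu, hθ']
    have h3 := TTmu (fK_LG1 H.lg hmem k) hz0 (sg θ' k) w
    have e3 : gapK L θ' k w = (Phi z (sg θ' k) (fK L θ' k) (fK L θ' k) w
        - TT z (sg θ' k) (fK L θ' k) w) / z := by
      simp only [gapK, PK, fK, hmu]
    rw [e3]
    refine h3.congr_of_eventuallyEq (Eventually.of_forall fun y => ?_)
    have e2 : Function.update θ (Sum.inr (k+1)) y = Function.update θ' (Sum.inr (k+1)) y := by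
      rw [hθ']; simp
    simp only [fK]
    rw [e2, fK_indep (k := k) (Or.inr rfl) k le_rfl]
    congr 1
    · simp [mu]
    
lemma fK_cont (H : LG1 L) : ContinuousOn (fun θ : Ix A → ℝ => fK L θ (r+1) 0) (SS A r) :=
  (fK_LG H (r+1)).eg.cont2 0

end recur

section conc
open Filter Topology
variable {A : Type} [Fintype A] [DecidableEq A]

/-- linear functional -/
def lin (φ : A → ℝ) (w : A → ℝ) : ℝ := ∑ a, φ a * w a
/-- `A` -/
def Ac (β : ℝ) (φ : Fin l → Fin l → A → ℝ) (i1 i2 : Fin l) (w : A → ℝ) : ℝ :=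
  Real.exp (β * lin (φ i1 i2) w)
/-- `C` -/
def Cc (β : ℝ) (φ : Fin l → Fin l → A → ℝ) (i1 : Fin l) (w : A → ℝ) : ℝ := ∑ i2, Ac β φ i1 i2 w
/-- `Z` -/
def Zc (β s : ℝ) (φ : Fin l → Fin l → A → ℝ) (w : A → ℝ) : ℝ := ∑ i1, Cc β φ i1 w ^ s
/-- `log Z` -/
def Lc (β s : ℝ) (φ : Fin l → Fin l → A → ℝ) (w : A → ℝ) : ℝ := Real.log (Zc β s φ w)
/-- outer weight -/
def g1 (β s : ℝ) (φ : Fin l → Fin l → A → ℝ) (i1 : Fin l) (w : A → ℝ) : ℝ :=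
  Cc β φ i1 w ^ s / Zc β s φ w
/-- inner weight -/
def g2 (β : ℝ) (φ : Fin l → Fin l → A → ℝ) (i1 i2 : Fin l) (w : A → ℝ) : ℝ :=
  Ac β φ i1 i2 w / Cc β φ i1 w
/-- Gibbs weight -/
def g0 (β s : ℝ) (φ : Fin l → Fin l → A → ℝ) (i1 i2 : Fin l) (w : A → ℝ) : ℝ :=
  g1 β s φ i1 w * g2 β φ i1 i2 w
/-- first derivative of `log Z` -/
def dc (β s : ℝ) (φ : Fin l → Fin l → A → ℝ) (a : A) (w : A → ℝ) : ℝ :=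
  s * β * ∑ i1, ∑ i2, g0 β s φ i1 i2 w * φ i1 i2 a
/-- diagonal part -/
def Hc (β s : ℝ) (φ : Fin l → Fin l → A → ℝ) (a : A) (w : A → ℝ) : ℝ :=
  β ^ 2 * (s * (s - 1) * (∑ i1, g1 β s φ i1 w * (∑ i2, g2 β φ i1 i2 w * φ i1 i2 a) ^ 2)
    + s * ∑ i1, ∑ i2, g0 β s φ i1 i2 w * φ i1 i2 a ^ 2)
/-- second derivative of `log Z` -/
def ec (β s : ℝ) (φ : Fin l → Fin l → A → ℝ) (a : A) (w : A → ℝ) : ℝ :=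
  Hc β s φ a w - dc β s φ a w ^ 2

variable {β s : ℝ} {φ : Fin l → Fin l → A → ℝ}

lemma Ac_pos (i1 i2 : Fin l) (w : A → ℝ) : 0 < Ac β φ i1 i2 w := Real.exp_pos _
lemma Cc_pos (hl : 1 ≤ l) (i1 : Fin l) (w : A → ℝ) : 0 < Cc β φ i1 w :=
  Finset.sum_pos (fun i _ => Ac_pos _ _ _) ⟨⟨0, hl⟩, Finset.mem_univ _⟩
lemma Zc_pos (hl : 1 ≤ l) (w : A → ℝ) : 0 < Zc β s φ w :=
  Finset.sum_pos (fun i _ => Real.rpow_pos_of_pos (Cc_pos hl _ _) _) ⟨⟨0, hl⟩, Finset.mem_univ _⟩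
lemma g1_pos (hl : 1 ≤ l) (i1 : Fin l) (w : A → ℝ) : 0 < g1 β s φ i1 w :=
  div_pos (Real.rpow_pos_of_pos (Cc_pos hl _ _) _) (Zc_pos hl _)
lemma g2_pos (hl : 1 ≤ l) (i1 i2 : Fin l) (w : A → ℝ) : 0 < g2 β φ i1 i2 w :=
  div_pos (Ac_pos _ _ _) (Cc_pos hl _ _)
lemma g1_sum (hl : 1 ≤ l) (w : A → ℝ) : ∑ i1, g1 β s φ i1 w = 1 := by
  unfold g1; rw [← Finset.sum_div]; exact div_self (Zc_pos hl w).ne'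
lemma g2_sum (hl : 1 ≤ l) (i1 : Fin l) (w : A → ℝ) : ∑ i2, g2 β φ i1 i2 w = 1 := by
  unfold g2; rw [← Finset.sum_div]; exact div_self (Cc_pos hl i1 w).ne'
lemma g0_sum (hl : 1 ≤ l) (w : A → ℝ) : ∑ i1, ∑ i2, g0 β s φ i1 i2 w = 1 := by
  unfold g0
  simp only [← Finset.mul_sum, g2_sum hl, mul_one, g1_sum hl]
lemma g1_le (hl : 1 ≤ l) (i1 : Fin l) (w : A → ℝ) : g1 β s φ i1 w ≤ 1 := by
  rw [← g1_sum (β := β) (s := s) (φ := φ) hl w]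
  exact Finset.single_le_sum (f := fun i => g1 β s φ i w) (fun i _ => (g1_pos hl i w).le)
    (Finset.mem_univ _)
lemma g2_le (hl : 1 ≤ l) (i1 i2 : Fin l) (w : A → ℝ) : g2 β φ i1 i2 w ≤ 1 := by
  rw [← g2_sum (β := β) (φ := φ) hl i1 w]
  exact Finset.single_le_sum (f := fun i => g2 β φ i1 i w) (fun i _ => (g2_pos hl i1 i w).le)
    (Finset.mem_univ _)

lemma lin_cont (ψ : A → ℝ) : Continuous (lin ψ) := by unfold lin; fun_prop
lemma Ac_cont (i1 i2 : Fin l) : Continuous (Ac β φ i1 i2) :=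
  Real.continuous_exp.comp (continuous_const.mul (lin_cont _))
lemma Cc_cont (i1 : Fin l) : Continuous (Cc β φ i1) :=
  continuous_finsetSum _ fun i _ => Ac_cont i1 i
lemma Cs_cont (hl : 1 ≤ l) (i1 : Fin l) (s : ℝ) : Continuous (fun w => Cc β φ i1 w ^ s) :=
  (Cc_cont i1).rpow_const fun w => Or.inl (Cc_pos hl i1 w).ne'
lemma Zc_cont (hl : 1 ≤ l) : Continuous (Zc β s φ) :=
  continuous_finsetSum _ fun i _ => Cs_cont hl i s
lemma g1_EG1 (hl : 1 ≤ l) (i1 : Fin l) : EG1 (g1 β s φ i1) := by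
  refine EG1.mk ((Cs_cont hl i1 s).div (Zc_cont hl) fun w => (Zc_pos hl w).ne') zero_le_one
    fun w => ?_
  rw [abs_of_pos (g1_pos hl i1 w)]
  have := Real.one_le_exp (by have := NN_nonneg w; linarith : 0 ≤ 1 * NN w)
  linarith [g1_le (β := β) (s := s) (φ := φ) hl i1 w]
lemma g2_EG1 (hl : 1 ≤ l) (i1 i2 : Fin l) : EG1 (g2 β φ i1 i2) := by
  refine EG1.mk ((Ac_cont i1 i2).div (Cc_cont i1) fun w => (Cc_pos hl i1 w).ne') zero_le_one
    fun w => ?_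
  rw [abs_of_pos (g2_pos hl i1 i2 w)]
  have := Real.one_le_exp (by have := NN_nonneg w; linarith : 0 ≤ 1 * NN w)
  linarith [g2_le (β := β) (φ := φ) hl i1 i2 w]
lemma g0_EG1 (hl : 1 ≤ l) (i1 i2 : Fin l) : EG1 (g0 β s φ i1 i2) :=
  (g1_EG1 hl i1).mul (g2_EG1 hl i1 i2)
lemma EG1.mulc {h : (A → ℝ) → ℝ} (hh : EG1 h) (c : ℝ) : EG1 (fun w => h w * c) :=
  hh.mul (EG1.const c)
lemma dc_EG1 (hl : 1 ≤ l) (a : A) : EG1 (dc β s φ a) :=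
  (EG1.sum _ fun i1 _ => EG1.sum _ fun i2 _ => (g0_EG1 hl i1 i2).mulc _).smul _
lemma Hc_EG1 (hl : 1 ≤ l) (a : A) : EG1 (Hc β s φ a) := by
  refine EG1.smul _ (EG1.add (EG1.smul _ ?_) (EG1.smul _ ?_))
  · exact EG1.sum _ fun i1 _ => (g1_EG1 hl i1).mul
      (EG1.sum _ fun i2 _ => (g2_EG1 hl i1 i2).mulc _).sq
  · exact EG1.sum _ fun i1 _ => EG1.sum _ fun i2 _ => (g0_EG1 hl i1 i2).mulc _
lemma ec_EG1 (hl : 1 ≤ l) (a : A) : EG1 (ec β s φ a) := (Hc_EG1 hl a).sub (dc_EG1 hl a).sq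

lemma lse_bd (hl : 1 ≤ l) {v : Fin l → ℝ} {B : ℝ} (hv : ∀ i, |v i| ≤ B) :
    |Real.log (∑ i, Real.exp (v i))| ≤ B + Real.log l := by
  have hl0 : (1:ℝ) ≤ l := by exact_mod_cast hl
  have h1 : Real.exp (-B) ≤ ∑ i, Real.exp (v i) := by
    refine le_trans ?_ (Finset.single_le_sum (f := fun i => Real.exp (v i))
      (fun i _ => (Real.exp_pos _).le) (Finset.mem_univ ⟨0, hl⟩))
    exact Real.exp_le_exp.2 (abs_le.1 (hv _)).1
  have h2 : ∑ i, Real.exp (v i) ≤ l * Real.exp B := by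
    calc ∑ i, Real.exp (v i) ≤ ∑ _i : Fin l, Real.exp B :=
          Finset.sum_le_sum fun i _ => Real.exp_le_exp.2 (abs_le.1 (hv i)).2
      _ = l * Real.exp B := by simp
  have h3 := Real.log_le_log (Real.exp_pos _) h1
  have h4 := Real.log_le_log (lt_of_lt_of_le (Real.exp_pos _) h1) h2
  rw [Real.log_exp] at h3
  rw [Real.log_mul (by positivity) (Real.exp_pos _).ne', Real.log_exp] at h4
  have := Real.log_nonneg hl0
  rw [abs_le]; constructor <;> linarith

lemma Lc_LG1 (hl : 1 ≤ l) : LG1 (Lc β s φ) := by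
  set M : ℝ := ∑ i1, ∑ i2, NN (φ i1 i2) with hM
  have hM0 : 0 ≤ M := Finset.sum_nonneg fun i _ => Finset.sum_nonneg fun j _ => NN_nonneg _
  have hM1 : ∀ i1 i2, NN (φ i1 i2) ≤ M := by
    intro i1 i2
    refine (Finset.single_le_sum (f := fun j => NN (φ i1 j)) (fun j _ => NN_nonneg _)
      (Finset.mem_univ i2)).trans ?_
    exact Finset.single_le_sum (f := fun i => ∑ j, NN (φ i j))
      (fun j _ => Finset.sum_nonneg fun j _ => NN_nonneg _) (Finset.mem_univ i1)
  have hl0 : (1:ℝ) ≤ l := by exact_mod_cast hl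
  have hlog := Real.log_nonneg hl0
  have hlin : ∀ i1 i2 w, |lin (φ i1 i2) w| ≤ M * NN w := by
    intro i1 i2 w
    unfold lin
    refine (Finset.abs_sum_le_sum_abs _ _).trans ?_
    rw [NN, Finset.mul_sum]
    refine Finset.sum_le_sum fun a _ => ?_
    rw [abs_mul]
    exact mul_le_mul_of_nonneg_right ((abs_le_NN _ a).trans (hM1 i1 i2)) (abs_nonneg _)
  refine LG1.mk (K := |s| * (|β| * M + Real.log l) + Real.log l)
    ((Zc_cont hl).log fun w => (Zc_pos hl w).ne') (by positivity) fun w => ?_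
  have hN := NN_nonneg w
  have h1 : ∀ i1, |Real.log (Cc β φ i1 w)| ≤ |β| * (M * NN w) + Real.log l := by
    intro i1
    refine lse_bd hl fun i2 => ?_
    rw [abs_mul]
    exact mul_le_mul_of_nonneg_left (hlin i1 i2 w) (abs_nonneg _)
  have h2 : |Lc β s φ w| ≤ |s| * (|β| * (M * NN w) + Real.log l) + Real.log l := by
    unfold Lc Zc
    have : ∀ i1, Cc β φ i1 w ^ s = Real.exp (s * Real.log (Cc β φ i1 w)) := by
      intro i1
      rw [Real.rpow_def_of_pos (Cc_pos hl i1 w), mul_comm]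
    simp only [this]
    refine lse_bd hl fun i1 => ?_
    rw [abs_mul]
    exact mul_le_mul_of_nonneg_left (h1 i1) (abs_nonneg _)
  refine h2.trans ?_
  have e : (|s| * (|β| * M + Real.log l) + Real.log l) * (1 + NN w)
    = (|s| * (|β| * (M * NN w) + Real.log l) + Real.log l)
      + (|s| * (|β| * M) + (|s| * Real.log l + Real.log l) * NN w) := by ring
  rw [e]
  have : 0 ≤ |s| * (|β| * M) + (|s| * Real.log l + Real.log l) * NN w := by positivity
  linarith

lemma lin_single (ψ w : A → ℝ) (a : A) (z : ℝ) : lin ψ (w + Pi.single a z) = lin ψ w + ψ a * z := by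
  unfold lin
  simp only [Pi.add_apply, mul_add, Finset.sum_add_distrib]
  congr 1
  rw [Finset.sum_eq_single a]
  · simp
  · intro b _ hb; simp [hb]
  · simp

lemma DD_Ac (i1 i2 : Fin l) (a : A) :
    DD a (Ac β φ i1 i2) (fun w => β * (Ac β φ i1 i2 w * φ i1 i2 a)) := by
  intro w
  unfold Ac
  simp only [lin_single]
  have h : HasDerivAt (fun z : ℝ => β * (lin (φ i1 i2) w + φ i1 i2 a * z)) (β * φ i1 i2 a) 0 := by
    simpa using (((hasDerivAt_id (0:ℝ)).const_mul (φ i1 i2 a)).const_add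
      (lin (φ i1 i2) w)).const_mul β
  refine h.exp.congr_deriv ?_
  simp; ring

lemma DD.sum {ι : Type} (t : Finset ι) {a : A} {f d : ι → (A → ℝ) → ℝ}
    (h : ∀ i ∈ t, DD a (f i) (d i)) : DD a (fun w => ∑ i ∈ t, f i w) (fun w => ∑ i ∈ t, d i w) :=
  fun w => HasDerivAt.fun_sum fun i hi => h i hi w

lemma DD.rpow {a : A} {f d : (A → ℝ) → ℝ} (h : DD a f d) (hp : ∀ w, 0 < f w) (s : ℝ) :
    DD a (fun w => f w ^ s) (fun w => s * f w ^ (s-1) * d w) := by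
  intro w
  have := (h w).rpow_const (p := s) (Or.inl (hp _).ne')
  refine this.congr_deriv ?_
  simp; ring

lemma DD.div {a : A} {f d f' d' : (A → ℝ) → ℝ} (h : DD a f d) (h' : DD a f' d')
    (hp : ∀ w, 0 < f' w) :
    DD a (fun w => f w / f' w) (fun w => (d w * f' w - f w * d' w) / f' w ^ 2) := by
  intro w
  refine ((h w).div (h' w) (hp _).ne').congr_deriv ?_
  simp

lemma DD.log {a : A} {f d : (A → ℝ) → ℝ} (h : DD a f d) (hp : ∀ w, 0 < f w) :
    DD a (fun w => Real.log (f w)) (fun w => d w / f w) := by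
  intro w
  refine ((h w).log (hp _).ne').congr_deriv ?_
  simp

lemma HL_c (hl : 1 ≤ l) : HL (Lc β s φ) (dc β s φ) (ec β s φ) := by
  have hC : ∀ i1 a, DD a (Cc β φ i1) (fun w => ∑ i2, β * (Ac β φ i1 i2 w * φ i1 i2 a)) :=
    fun i1 a => DD.sum _ fun i2 _ => DD_Ac i1 i2 a
  have hC2 : ∀ i1 a, DD a (fun w => ∑ i2, β * (Ac β φ i1 i2 w * φ i1 i2 a))
      (fun w => ∑ i2, β * (β * (Ac β φ i1 i2 w * φ i1 i2 a) * φ i1 i2 a)) := by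
    intro i1 a
    refine DD.sum _ fun i2 _ => DD.smul ?_ β
    intro w
    exact (DD_Ac i1 i2 a w).mul_const _
  have hZ : ∀ a, DD a (Zc β s φ) (fun w => ∑ i1, s * Cc β φ i1 w ^ (s-1)
      * ∑ i2, β * (Ac β φ i1 i2 w * φ i1 i2 a)) :=
    fun a => DD.sum _ fun i1 _ => (hC i1 a).rpow (fun w => Cc_pos hl i1 w) s
  have hZ2 : ∀ a, DD a (fun w => ∑ i1, s * Cc β φ i1 w ^ (s-1)
      * ∑ i2, β * (Ac β φ i1 i2 w * φ i1 i2 a))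
      (fun w => ∑ i1, ((s * ((s-1) * Cc β φ i1 w ^ (s-1-1)
        * ∑ i2, β * (Ac β φ i1 i2 w * φ i1 i2 a))) * (∑ i2, β * (Ac β φ i1 i2 w * φ i1 i2 a))
        + (s * Cc β φ i1 w ^ (s-1)) *
          ∑ i2, β * (β * (Ac β φ i1 i2 w * φ i1 i2 a) * φ i1 i2 a))) :=
    fun a => DD.sum _ fun i1 _ => (((hC i1 a).rpow (fun w => Cc_pos hl i1 w) (s-1)).smul s).mul
      (hC2 i1 a)
  have hr1 : ∀ i1 w, Cc β φ i1 w ^ (s-1) = Cc β φ i1 w ^ s / Cc β φ i1 w :=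
    fun i1 w => Real.rpow_sub_one (Cc_pos hl i1 w).ne' s
  have hr2 : ∀ i1 w, Cc β φ i1 w ^ (s-1-1) = Cc β φ i1 w ^ s / Cc β φ i1 w / Cc β φ i1 w :=
    fun i1 w => by rw [Real.rpow_sub_one (Cc_pos hl i1 w).ne', hr1]
  have hN : ∀ a w, (∑ i1, s * Cc β φ i1 w ^ (s-1)
      * ∑ i2, β * (Ac β φ i1 i2 w * φ i1 i2 a)) / Zc β s φ w = dc β s φ a w := by
    intro a w
    unfold dc g0 g1 g2
    rw [Finset.sum_div, Finset.mul_sum]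
    refine Finset.sum_congr rfl fun i1 _ => ?_
    rw [hr1, Finset.mul_sum, Finset.mul_sum, Finset.sum_div]
    refine Finset.sum_congr rfl fun i2 _ => ?_
    have := (Cc_pos (β := β) (φ := φ) hl i1 w).ne'
    have := (Zc_pos (β := β) (s := s) (φ := φ) hl w).ne'
    field_simp
  have hdf : ∀ a, DD a (Lc β s φ) (dc β s φ a) :=
    fun a => ((hZ a).log fun w => Zc_pos hl w).congr (hN a)
  refine ⟨Lc_LG1 hl, dc_EG1 hl, ec_EG1 hl, hdf, fun a => ?_⟩
  have e : dc β s φ a = fun w => (∑ i1, s * Cc β φ i1 w ^ (s-1)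
      * ∑ i2, β * (Ac β φ i1 i2 w * φ i1 i2 a)) / Zc β s φ w := funext fun w => (hN a w).symm
  rw [e]
  refine ((hZ2 a).div (hZ a) (fun w => Zc_pos hl w)).congr fun w => ?_
  have hZ0 := (Zc_pos (β := β) (s := s) (φ := φ) hl w).ne'
  rw [sub_div, ec, ← hN a w]
  congr 1
  · rw [pow_two, mul_div_mul_right _ _ hZ0]
    have eH : Hc β s φ a w = ∑ i1, (β ^ 2 * (s * (s - 1) * (g1 β s φ i1 w *
        (∑ i2, g2 β φ i1 i2 w * φ i1 i2 a) ^ 2))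
        + β ^ 2 * (s * ∑ i2, g0 β s φ i1 i2 w * φ i1 i2 a ^ 2)) := by
      rw [Finset.sum_add_distrib, ← Finset.mul_sum, ← Finset.mul_sum, ← Finset.mul_sum,
        ← Finset.mul_sum, Hc]
      ring
    rw [eH, Finset.sum_div]
    refine Finset.sum_congr rfl fun i1 _ => ?_
    unfold g0 g1
    have hC0 := (Cc_pos (β := β) (φ := φ) hl i1 w).ne'
    rw [hr1, hr2, add_div]
    congr 1
    · have e1 : ∑ i2, β * (Ac β φ i1 i2 w * φ i1 i2 a)
          = β * Cc β φ i1 w * ∑ i2, g2 β φ i1 i2 w * φ i1 i2 a := by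
        rw [Finset.mul_sum]
        refine Finset.sum_congr rfl fun i2 _ => ?_
        unfold g2
        field_simp
      rw [e1]
      field_simp
    · rw [Finset.mul_sum, Finset.sum_div, Finset.mul_sum, Finset.mul_sum]
      refine Finset.sum_congr rfl fun i2 _ => ?_
      unfold g2
      field_simp
  · field_simp

/- structural sums -/
variable {r : ℕ} {θ : Ix A → ℝ}

/-- Averaged Gibbs weights. -/
def gk (β s : ℝ) (φ : Fin l → Fin l → A → ℝ) (θ : Ix A → ℝ) (k : ℕ) (i1 i2 : Fin l) :
    (A → ℝ) → ℝ := PU (Lc β s φ) θ 0 k (g0 β s φ i1 i2)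

/-- Replica averages. -/
def EBk (β s : ℝ) (φ : Fin l → Fin l → A → ℝ) (r : ℕ) (θ : Ix A → ℝ) (k : ℕ)
    (f : Fin l → Fin l → Fin l → Fin l → ℝ) : ℝ :=
  ∑ i1, ∑ i2, ∑ p1, ∑ p2, f i1 i2 p1 p2 *
    PU (Lc β s φ) θ k (r+1) (fun w => gk β s φ θ k i1 i2 w * gk β s φ θ k p1 p2 w) 0

lemma dK_PU (L : (A → ℝ) → ℝ) (d0 : A → (A → ℝ) → ℝ) (k : ℕ) (a : A) :
    dK L d0 θ k a = PU L θ 0 k (d0 a) := by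
  induction k with
  | zero => rfl
  | succ k ih => rw [PU_succ _ _ (Nat.zero_le k), ← ih]; rfl

lemma gk_EG1 (hl : 1 ≤ l) (hθ : θ ∈ SS A r) (k : ℕ) (i1 i2 : Fin l) :
    EG1 (gk β s φ θ k i1 i2) := PU_EG1 (Lc_LG1 hl) hθ 0 k (g0_EG1 hl i1 i2)

lemma PU_mulc (L : (A → ℝ) → ℝ) (k : ℕ) (h : (A → ℝ) → ℝ) (b : ℝ) (j : ℕ) :
    PU L θ k j (fun v => h v * b) = fun v => PU L θ k j h v * b := by
  have := PU_smul (L := L) (θ := θ) k h b j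
  simp only [mul_comm b] at this
  exact this

lemma dK_gk (hl : 1 ≤ l) (hθ : θ ∈ SS A r) (k : ℕ) (a : A) (w : A → ℝ) :
    dK (Lc β s φ) (dc β s φ) θ k a w = s * β * ∑ i1, ∑ i2, gk β s φ θ k i1 i2 w * φ i1 i2 a := by
  rw [dK_PU]
  have : dc β s φ a = fun w => s * β * ∑ i1, ∑ i2, g0 β s φ i1 i2 w * φ i1 i2 a := rfl
  rw [this, PU_smul, PU_sum (Lc_LG1 hl) hθ _ _
    (fun i1 _ => EG1.sum _ fun i2 _ => (g0_EG1 hl i1 i2).mulc _)]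
  have h2 : ∀ i1, PU (Lc β s φ) θ 0 k (fun w => ∑ i2, g0 β s φ i1 i2 w * φ i1 i2 a)
      = fun w => ∑ i2, gk β s φ θ k i1 i2 w * φ i1 i2 a := by
    intro i1
    rw [PU_sum (Lc_LG1 hl) hθ _ _ (fun i2 _ => (g0_EG1 hl i1 i2).mulc _)]
    simp only [PU_mulc]
    rfl
  simp only [h2]

lemma sum4_mul {ι : Type} [Fintype ι] (f g : ι → ι → ℝ) :
    (∑ i, ∑ j, f i j) * (∑ i, ∑ j, g i j) = ∑ i, ∑ j, ∑ p, ∑ q, f i j * g p q := by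
  rw [Finset.sum_mul]
  refine Finset.sum_congr rfl fun i _ => ?_
  rw [Finset.sum_mul]
  refine Finset.sum_congr rfl fun j _ => ?_
  rw [Finset.mul_sum]
  refine Finset.sum_congr rfl fun p _ => ?_
  rw [Finset.mul_sum]

lemma PU_sum4 {L : (A → ℝ) → ℝ} (H : LG1 L) (hθ : θ ∈ SS A r) (k j : ℕ)
    {F : Fin l → Fin l → Fin l → Fin l → (A → ℝ) → ℝ} (hF : ∀ a b c d, EG1 (F a b c d))
    (v : A → ℝ) :
    PU L θ k j (fun w => ∑ a, ∑ b, ∑ c, ∑ d, F a b c d w) v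
      = ∑ a, ∑ b, ∑ c, ∑ d, PU L θ k j (F a b c d) v := by
  have h1 : ∀ a b c, PU L θ k j (fun w => ∑ d, F a b c d w) = fun v => ∑ d, PU L θ k j (F a b c d) v :=
    fun a b c => PU_sum H hθ k Finset.univ (h := fun d => F a b c d) (fun d _ => hF a b c d) j
  have e1 : ∀ a b c, EG1 (fun w => ∑ d, F a b c d w) :=
    fun a b c => EG1.sum Finset.univ (h := fun d => F a b c d) (fun d _ => hF a b c d)
  have e2 : ∀ a b, EG1 (fun w => ∑ c, ∑ d, F a b c d w) :=
    fun a b => EG1.sum Finset.univ (h := fun c w => ∑ d, F a b c d w) (fun c _ => e1 a b c)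
  have e3 : ∀ a, EG1 (fun w => ∑ b, ∑ c, ∑ d, F a b c d w) :=
    fun a => EG1.sum Finset.univ (h := fun b w => ∑ c, ∑ d, F a b c d w) (fun b _ => e2 a b)
  rw [PU_sum H hθ k Finset.univ (h := fun a w => ∑ b, ∑ c, ∑ d, F a b c d w) (fun a _ => e3 a) j]
  refine Finset.sum_congr rfl fun a _ => ?_
  rw [PU_sum H hθ k Finset.univ (h := fun b w => ∑ c, ∑ d, F a b c d w) (fun b _ => e2 a b) j]
  refine Finset.sum_congr rfl fun b _ => ?_
  rw [PU_sum H hθ k Finset.univ (h := fun c w => ∑ d, F a b c d w) (fun c _ => e1 a b c) j]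
  refine Finset.sum_congr rfl fun c _ => ?_
  rw [h1]

lemma SK_EBk (hl : 1 ≤ l) (hθ : θ ∈ SS A r) (k : ℕ) (a : A) :
    SK (Lc β s φ) (dc β s φ) r θ k a
      = (s * β) ^ 2 * EBk β s φ r θ k (fun i1 i2 p1 p2 => φ i1 i2 a * φ p1 p2 a) := by
  unfold SK EBk
  have hg := fun i1 i2 => gk_EG1 (β := β) (s := s) (φ := φ) hl hθ k i1 i2
  have hgg := fun i1 i2 p1 p2 => (hg i1 i2).mul (hg p1 p2)
  have e : (fun v => dK (Lc β s φ) (dc β s φ) θ k a v ^ 2) = fun v => (s*β)^2 *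
      ∑ i1, ∑ i2, ∑ p1, ∑ p2, (φ i1 i2 a * φ p1 p2 a) *
        (gk β s φ θ k i1 i2 v * gk β s φ θ k p1 p2 v) := by
    funext v
    rw [dK_gk hl hθ, mul_pow, pow_two (∑ i1, ∑ i2, gk β s φ θ k i1 i2 v * φ i1 i2 a), sum4_mul]
    congr 1
    refine Finset.sum_congr rfl fun i1 _ => Finset.sum_congr rfl fun i2 _ =>
      Finset.sum_congr rfl fun p1 _ => Finset.sum_congr rfl fun p2 _ => by ring
  have H := Lc_LG1 (β := β) (s := s) (φ := φ) hl
  rw [e, PU_smul]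
  beta_reduce
  rw [PU_sum4 H hθ _ _ (F := fun i1 i2 p1 p2 v => (φ i1 i2 a * φ p1 p2 a) *
        (gk β s φ θ k i1 i2 v * gk β s φ θ k p1 p2 v)) (fun i1 i2 p1 p2 => (hgg i1 i2 p1 p2).smul _)]
  simp only [PU_smul]

lemma EBk_one (hl : 1 ≤ l) (hθ : θ ∈ SS A r) (k : ℕ) :
    EBk β s φ r θ k (fun _ _ _ _ => 1) = 1 := by
  have hg := fun i1 i2 => gk_EG1 (β := β) (s := s) (φ := φ) hl hθ k i1 i2
  have hgg := fun i1 i2 p1 p2 => (hg i1 i2).mul (hg p1 p2)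
  have H := Lc_LG1 (β := β) (s := s) (φ := φ) hl
  have hsum : ∀ w, ∑ i1, ∑ i2, gk β s φ θ k i1 i2 w = 1 := by
    intro w
    have h1 : PU (Lc β s φ) θ 0 k (fun w => ∑ i1, ∑ i2, g0 β s φ i1 i2 w) = fun _ => 1 := by
      simp only [g0_sum hl]
      exact PU_const H hθ _ _ _
    rw [PU_sum H hθ _ _ (fun i1 _ => EG1.sum _ fun i2 _ => g0_EG1 hl i1 i2)] at h1
    have h2 := congrFun h1 w
    rw [← h2]
    refine Finset.sum_congr rfl fun i1 _ => ?_
    rw [PU_sum H hθ _ _ (fun i2 _ => g0_EG1 hl i1 i2)]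
    rfl
  have h3 : PU (Lc β s φ) θ k (r+1) (fun w => ∑ i1, ∑ i2, ∑ p1, ∑ p2,
      gk β s φ θ k i1 i2 w * gk β s φ θ k p1 p2 w) 0 = 1 := by
    simp only [← sum4_mul, hsum, mul_one]
    exact congrFun (PU_const H hθ _ _ _) 0
  rw [PU_sum4 H hθ _ _ (F := fun i1 i2 p1 p2 v => gk β s φ θ k i1 i2 v * gk β s φ θ k p1 p2 v)
    hgg] at h3
  refine Eq.trans ?_ h3
  unfold EBk
  refine Finset.sum_congr rfl fun i1 _ => Finset.sum_congr rfl fun i2 _ =>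
      Finset.sum_congr rfl fun p1 _ => Finset.sum_congr rfl fun p2 _ => by rw [one_mul]

lemma EBk_add (k : ℕ) (f g : Fin l → Fin l → Fin l → Fin l → ℝ) :
    EBk β s φ r θ k (fun i1 i2 p1 p2 => f i1 i2 p1 p2 + g i1 i2 p1 p2)
      = EBk β s φ r θ k f + EBk β s φ r θ k g := by
  unfold EBk
  simp only [add_mul, Finset.sum_add_distrib]
lemma EBk_smul (k : ℕ) (c : ℝ) (f : Fin l → Fin l → Fin l → Fin l → ℝ) :
    EBk β s φ r θ k (fun i1 i2 p1 p2 => c * f i1 i2 p1 p2) = c * EBk β s φ r θ k f := by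
  unfold EBk
  simp only [mul_assoc, Finset.mul_sum]
lemma EBk_sum {ι : Type} (t : Finset ι) (k : ℕ) (f : ι → Fin l → Fin l → Fin l → Fin l → ℝ) :
    EBk β s φ r θ k (fun i1 i2 p1 p2 => ∑ i ∈ t, f i i1 i2 p1 p2)
      = ∑ i ∈ t, EBk β s φ r θ k (f i) := by
  classical
  induction t using Finset.induction_on with
  | empty => simp [EBk]
  | insert i t hi ih => simp only [Finset.sum_insert hi, EBk_add, ih]

/-- Averaged diagonal part. -/
def hb (β s : ℝ) (φ : Fin l → Fin l → A → ℝ) (r : ℕ) (θ : Ix A → ℝ) (a : A) : ℝ :=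
  PU (Lc β s φ) θ 0 (r+1) (Hc β s φ a) 0

lemma mu_at_zero (hθ : θ ∈ SS A r) : mu θ 0 = 1 := by
  have := hθ (Sum.inr 0) trivial
  simpa [JJ, mu] using this

lemma XK_sum (hl : 1 ≤ l) (hθ : θ ∈ SS A r) (a : A) {k : ℕ} (hk : k ≤ r) :
    XK (Lc β s φ) (dc β s φ) (ec β s φ) r θ k a = hb β s φ r θ a
      + ∑ j ∈ Finset.range (k+1), (mu θ (j+1) - mu θ j) * SK (Lc β s φ) (dc β s φ) r θ j a := by
  have H := HL_c (β := β) (s := s) (φ := φ) hl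
  induction k with
  | zero =>
    simp only [zero_add, Finset.range_one, Finset.sum_singleton, mu_at_zero hθ]
    unfold XK hb SK
    have : (fun v => eK (Lc β s φ) (dc β s φ) (ec β s φ) θ 0 a v
        + mu θ (0+1) * dK (Lc β s φ) (dc β s φ) θ 0 a v ^ 2)
        = fun v => Hc β s φ a v + (mu θ 1 - 1) * dK (Lc β s φ) (dc β s φ) θ 0 a v ^ 2 := by
      funext v; simp only [eK, dK, ec]; ring
    rw [this, PU_add H.lg hθ _ (Hc_EG1 hl a) ((dK_EG1 H hθ 0 a).sq.smul _), PU_smul]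
  | succ k ih =>
    rw [XK_rec H hθ hk, ih (by omega), Finset.sum_range_succ _ (k+1)]
    ring

end conc

section blocks
open Filter Topology

/-- Noise coordinates. -/
abbrev AA (m n : ℕ) : Type := (Fin m × Fin n) ⊕ (Fin m ⊕ Fin n)

/-- The covectors. -/
def ph (x : Fin l → Fin n → ℝ) (y : Fin l → Fin m → ℝ) (i1 i2 : Fin l) : AA m n → ℝ
  | Sum.inl jk => y i2 jk.1 * x i1 jk.2
  | Sum.inr (Sum.inl j) => y i2 j
  | Sum.inr (Sum.inr k) => x i1 k

/-- Parameters. -/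
def TH (m n r : ℕ) (T : ℝ) (a b mv : ℕ → ℝ) : Ix (AA m n) → ℝ
  | Sum.inl (k, Sum.inl _) => if k = r then T else 0
  | Sum.inl (k, Sum.inr (Sum.inl _)) => if k ≤ r then a k else 0
  | Sum.inl (k, Sum.inr (Sum.inr _)) => if k ≤ r then b k else 0
  | Sum.inr k => if k ≤ r then mv k else 0

/-- Admissible. -/
structure Adm (r : ℕ) (T : ℝ) (a b mv : ℕ → ℝ) : Prop where
  hT : 0 ≤ T
  ha : ∀ k, k ≤ r → 0 ≤ a k
  hb : ∀ k, k ≤ r → 0 ≤ b k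
  h0 : mv 0 = 1
  hm : ∀ k, 1 ≤ k → k ≤ r → 0 < mv k

lemma TH_mem {r : ℕ} {T : ℝ} {a b mv : ℕ → ℝ} (h : Adm r T a b mv) :
    TH m n r T a b mv ∈ SS (AA m n) r := by
  rintro i -
  rcases i with ⟨k, g | j | j⟩ | k
  · simp only [TH, JJ, Set.mem_Ici]; split_ifs; exacts [h.hT, le_rfl]
  · simp only [TH, JJ, Set.mem_Ici]; split_ifs with hk; exacts [h.ha k hk, le_rfl]
  · simp only [TH, JJ, Set.mem_Ici]; split_ifs with hk; exacts [h.hb k hk, le_rfl]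
  · simp only [TH, JJ]
    rcases Nat.eq_zero_or_pos k with rfl | hk
    · simp [h.h0]
    · rw [if_neg (by omega)]
      split_ifs with hk2
      · exact h.hm k hk hk2
      · simp

variable {β s : ℝ} {x : Fin l → Fin n → ℝ} {y : Fin l → Fin m → ℝ} {r : ℕ}

lemma sumsq {d : ℕ} {v : Fin d → ℝ} (h : nrm2 v = 1) : ∑ i, v i ^ 2 = 1 := by
  unfold nrm2 at h
  rwa [Real.sqrt_eq_one] at h

lemma Hc_h (hl : 1 ≤ l) (hxu : ∀ i, nrm2 (x i) = 1) (w : AA m n → ℝ) :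
    ∑ k : Fin n, Hc β s (ph x y) (Sum.inr (Sum.inr k)) w = (s * β) ^ 2 := by
  unfold Hc
  simp only [ph]
  rw [← Finset.mul_sum, Finset.sum_add_distrib, ← Finset.mul_sum, ← Finset.mul_sum]
  have e1 : ∑ k : Fin n, ∑ i1, g1 β s (ph x y) i1 w * (∑ i2, g2 β (ph x y) i1 i2 w * x i1 k) ^ 2
      = 1 := by
    rw [Finset.sum_comm]
    rw [← g1_sum (β := β) (s := s) (φ := ph x y) hl w]
    refine Finset.sum_congr rfl fun i1 _ => ?_
    simp only [← Finset.sum_mul, g2_sum hl, one_mul]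
    rw [← Finset.mul_sum, sumsq (hxu i1), mul_one]
  have e2 : ∑ k : Fin n, ∑ i1, ∑ i2, g0 β s (ph x y) i1 i2 w * x i1 k ^ 2 = 1 := by
    rw [Finset.sum_comm]
    rw [← g0_sum (β := β) (s := s) (φ := ph x y) hl w]
    refine Finset.sum_congr rfl fun i1 _ => ?_
    rw [Finset.sum_comm]
    refine Finset.sum_congr rfl fun i2 _ => ?_
    rw [← Finset.mul_sum, sumsq (hxu i1), mul_one]
  rw [e1, e2]; ring

lemma Hc_G (hxu : ∀ i, nrm2 (x i) = 1) (w : AA m n → ℝ) :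
    ∑ jk : Fin m × Fin n, Hc β s (ph x y) (Sum.inl jk) w
      = ∑ j : Fin m, Hc β s (ph x y) (Sum.inr (Sum.inl j)) w := by
  unfold Hc
  simp only [ph]
  rw [Fintype.sum_prod_type]
  refine Finset.sum_congr rfl fun j _ => ?_
  simp only
  rw [← Finset.mul_sum, Finset.sum_add_distrib, ← Finset.mul_sum, ← Finset.mul_sum]
  have e1 : ∑ k : Fin n, ∑ i1, g1 β s (ph x y) i1 w *
      (∑ i2, g2 β (ph x y) i1 i2 w * (y i2 j * x i1 k)) ^ 2
      = ∑ i1, g1 β s (ph x y) i1 w * (∑ i2, g2 β (ph x y) i1 i2 w * y i2 j) ^ 2 := by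
    rw [Finset.sum_comm]
    refine Finset.sum_congr rfl fun i1 _ => ?_
    simp only [← mul_assoc, ← Finset.sum_mul, mul_pow]
    rw [← Finset.mul_sum, sumsq (hxu i1), mul_one]
  have e2 : ∑ k : Fin n, ∑ i1, ∑ i2, g0 β s (ph x y) i1 i2 w * (y i2 j * x i1 k) ^ 2
      = ∑ i1, ∑ i2, g0 β s (ph x y) i1 i2 w * y i2 j ^ 2 := by
    rw [Finset.sum_comm]
    refine Finset.sum_congr rfl fun i1 _ => ?_
    rw [Finset.sum_comm]
    refine Finset.sum_congr rfl fun i2 _ => ?_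
    simp only [mul_pow, ← mul_assoc]
    rw [← Finset.mul_sum, sumsq (hxu i1), mul_one]
  rw [e1, e2]

variable {θ : Ix (AA m n) → ℝ}

lemma hb_h (hl : 1 ≤ l) (hxu : ∀ i, nrm2 (x i) = 1) (hθ : θ ∈ SS (AA m n) r) :
    ∑ k : Fin n, hb β s (ph x y) r θ (Sum.inr (Sum.inr k)) = (s * β) ^ 2 := by
  have h := PU_sum (Lc_LG1 (β := β) (s := s) (φ := ph x y) hl) hθ 0 Finset.univ
    (h := fun k : Fin n => Hc β s (ph x y) (Sum.inr (Sum.inr k))) (fun k _ => Hc_EG1 hl _) (r+1)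
  simp only [Hc_h hl hxu] at h
  rw [PU_const (Lc_LG1 hl) hθ] at h
  exact (congrFun h 0).symm

lemma hb_G (hl : 1 ≤ l) (hxu : ∀ i, nrm2 (x i) = 1) (hθ : θ ∈ SS (AA m n) r) :
    ∑ jk : Fin m × Fin n, hb β s (ph x y) r θ (Sum.inl jk)
      = ∑ j : Fin m, hb β s (ph x y) r θ (Sum.inr (Sum.inl j)) := by
  have h := PU_sum (Lc_LG1 (β := β) (s := s) (φ := ph x y) hl) hθ 0 Finset.univ
    (h := fun k : Fin m × Fin n => Hc β s (ph x y) (Sum.inl k)) (fun k _ => Hc_EG1 hl _) (r+1)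
  have h' := PU_sum (Lc_LG1 (β := β) (s := s) (φ := ph x y) hl) hθ 0 Finset.univ
    (h := fun k : Fin m => Hc β s (ph x y) (Sum.inr (Sum.inl k))) (fun k _ => Hc_EG1 hl _) (r+1)
  simp only [Hc_G hxu] at h
  rw [h'] at h
  exact (congrFun h 0).symm

/-- overlaps -/
def Ry (β s : ℝ) (x : Fin l → Fin n → ℝ) (y : Fin l → Fin m → ℝ) (r : ℕ) (θ : Ix (AA m n) → ℝ)
    (k : ℕ) : ℝ := EBk β s (ph x y) r θ k (fun i1 i2 p1 p2 => dotv (y p2) (y i2))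
/-- overlaps -/
def Rx (β s : ℝ) (x : Fin l → Fin n → ℝ) (y : Fin l → Fin m → ℝ) (r : ℕ) (θ : Ix (AA m n) → ℝ)
    (k : ℕ) : ℝ := EBk β s (ph x y) r θ k (fun i1 i2 p1 p2 => dotv (x p1) (x i1))
/-- overlaps -/
def RG (β s : ℝ) (x : Fin l → Fin n → ℝ) (y : Fin l → Fin m → ℝ) (r : ℕ) (θ : Ix (AA m n) → ℝ)
    (k : ℕ) : ℝ := EBk β s (ph x y) r θ k
      (fun i1 i2 p1 p2 => dotv (x p1) (x i1) * dotv (y p2) (y i2))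

lemma SK_u (hl : 1 ≤ l) (hθ : θ ∈ SS (AA m n) r) (k : ℕ) :
    ∑ j : Fin m, SK (Lc β s (ph x y)) (dc β s (ph x y)) r θ k (Sum.inr (Sum.inl j))
      = (s*β)^2 * Ry β s x y r θ k := by
  simp only [SK_EBk hl hθ, ← Finset.mul_sum, ← EBk_sum]
  congr 2
  funext i1 i2 p1 p2
  simp only [ph, dotv]
  exact Finset.sum_congr rfl fun j _ => mul_comm _ _

lemma SK_h (hl : 1 ≤ l) (hθ : θ ∈ SS (AA m n) r) (k : ℕ) :
    ∑ j : Fin n, SK (Lc β s (ph x y)) (dc β s (ph x y)) r θ k (Sum.inr (Sum.inr j))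
      = (s*β)^2 * Rx β s x y r θ k := by
  simp only [SK_EBk hl hθ, ← Finset.mul_sum, ← EBk_sum]
  congr 2
  funext i1 i2 p1 p2
  simp only [ph, dotv]
  exact Finset.sum_congr rfl fun j _ => mul_comm _ _

lemma SK_G (hl : 1 ≤ l) (hθ : θ ∈ SS (AA m n) r) (k : ℕ) :
    ∑ j : Fin m × Fin n, SK (Lc β s (ph x y)) (dc β s (ph x y)) r θ k (Sum.inl j)
      = (s*β)^2 * RG β s x y r θ k := by
  simp only [SK_EBk hl hθ, ← Finset.mul_sum, ← EBk_sum]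
  congr 2
  funext i1 i2 p1 p2
  simp only [ph, dotv]
  rw [mul_comm (∑ i, x p1 i * x i1 i), Finset.sum_mul_sum, Fintype.sum_prod_type]
  exact Finset.sum_congr rfl fun j _ => Finset.sum_congr rfl fun k _ => by ring

/-- the common unknown -/
def Hu (β s : ℝ) (x : Fin l → Fin n → ℝ) (y : Fin l → Fin m → ℝ) (r : ℕ) (θ : Ix (AA m n) → ℝ) :
    ℝ := ∑ j : Fin m, hb β s (ph x y) r θ (Sum.inr (Sum.inl j)) / (s * β) ^ 2

/-- derivative in u-variances -/
def du (β s : ℝ) (x : Fin l → Fin n → ℝ) (y : Fin l → Fin m → ℝ) (r : ℕ) (θ : Ix (AA m n) → ℝ)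
    (k : ℕ) : ℝ := Hu β s x y r θ
      + ∑ j ∈ Finset.range (k+1), (mu θ (j+1) - mu θ j) * Ry β s x y r θ j
/-- derivative in h-variances -/
def dh (β s : ℝ) (x : Fin l → Fin n → ℝ) (y : Fin l → Fin m → ℝ) (r : ℕ) (θ : Ix (AA m n) → ℝ)
    (k : ℕ) : ℝ := 1
      + ∑ j ∈ Finset.range (k+1), (mu θ (j+1) - mu θ j) * Rx β s x y r θ j
/-- derivative in G-variance -/
def dG (β s : ℝ) (x : Fin l → Fin n → ℝ) (y : Fin l → Fin m → ℝ) (r : ℕ) (θ : Ix (AA m n) → ℝ)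
    (k : ℕ) : ℝ := Hu β s x y r θ
      + ∑ j ∈ Finset.range (k+1), (mu θ (j+1) - mu θ j) * RG β s x y r θ j

lemma blk {ι : Type} [Fintype ι] (hl : 1 ≤ l) (hθ : θ ∈ SS (AA m n) r) {k : ℕ} (hk : k ≤ r)
    (e : ι → AA m n) {h : ℝ} {R : ℕ → ℝ} (hh : ∑ i, hb β s (ph x y) r θ (e i) = (s*β)^2*h)
    (hS : ∀ k, ∑ i, SK (Lc β s (ph x y)) (dc β s (ph x y)) r θ k (e i) = (s*β)^2 * R k) :
    ∑ i, XK (Lc β s (ph x y)) (dc β s (ph x y)) (ec β s (ph x y)) r θ k (e i)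
      = (s*β)^2 * (h + ∑ j ∈ Finset.range (k+1), (mu θ (j+1) - mu θ j) * R j) := by
  simp only [XK_sum hl hθ _ hk]
  rw [Finset.sum_add_distrib, hh, Finset.sum_comm, mul_add, Finset.mul_sum]
  congr 1
  refine Finset.sum_congr rfl fun j _ => ?_
  rw [← Finset.mul_sum, hS]; ring

lemma XK_u (hs : s ≠ 0) (hβ : 0 < β) (hl : 1 ≤ l) (hθ : θ ∈ SS (AA m n) r) {k : ℕ} (hk : k ≤ r) :
    ∑ i : Fin m, XK (Lc β s (ph x y)) (dc β s (ph x y)) (ec β s (ph x y)) r θ k (Sum.inr (Sum.inl i))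
      = (s*β)^2 * du β s x y r θ k := by
  refine blk hl hθ hk (fun i => Sum.inr (Sum.inl i)) ?_ (SK_u hl hθ)
  rw [Hu, ← Finset.sum_div]; field_simp

lemma XK_G (hxu : ∀ i, nrm2 (x i) = 1) (hs : s ≠ 0) (hβ : 0 < β) (hl : 1 ≤ l)
    (hθ : θ ∈ SS (AA m n) r) {k : ℕ} (hk : k ≤ r) :
    ∑ i : Fin m × Fin n, XK (Lc β s (ph x y)) (dc β s (ph x y)) (ec β s (ph x y)) r θ k (Sum.inl i)
      = (s*β)^2 * dG β s x y r θ k := by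
  refine blk hl hθ hk (fun i => Sum.inl i) ?_ (SK_G hl hθ)
  rw [hb_G hl hxu hθ, Hu, ← Finset.sum_div]; field_simp

lemma XK_h (hxu : ∀ i, nrm2 (x i) = 1) (hl : 1 ≤ l)
    (hθ : θ ∈ SS (AA m n) r) {k : ℕ} (hk : k ≤ r) :
    ∑ i : Fin n, XK (Lc β s (ph x y)) (dc β s (ph x y)) (ec β s (ph x y)) r θ k (Sum.inr (Sum.inr i))
      = (s*β)^2 * dh β s x y r θ k := by
  refine blk hl hθ hk (fun i => Sum.inr (Sum.inr i)) ?_ (SK_h hl hθ)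
  rw [hb_h hl hxu hθ]; ring

/-- h-block second derivative is a variance. -/
lemma ec_h (hl : 1 ≤ l) (k : Fin n) (w : AA m n → ℝ) :
    ec β s (ph x y) (Sum.inr (Sum.inr k)) w
      = (s*β)^2 * ∑ i1, g1 β s (ph x y) i1 w * (x i1 k - ∑ j, g1 β s (ph x y) j w * x j k)^2 := by
  set M := ∑ j, g1 β s (ph x y) j w * x j k with hM
  have e0 : ∑ i1, ∑ i2, g0 β s (ph x y) i1 i2 w * x i1 k = M := by
    refine Finset.sum_congr rfl fun i1 _ => ?_
    simp only [g0, ← Finset.sum_mul, ← Finset.mul_sum, g2_sum hl, mul_one]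
  have e1 : ∑ i1, ∑ i2, g0 β s (ph x y) i1 i2 w * x i1 k ^ 2
      = ∑ i1, g1 β s (ph x y) i1 w * x i1 k ^ 2 := by
    refine Finset.sum_congr rfl fun i1 _ => ?_
    simp only [g0, ← Finset.sum_mul, ← Finset.mul_sum, g2_sum hl, mul_one]
  have e2 : ∑ i1, g1 β s (ph x y) i1 w * (x i1 k - M)^2
      = ∑ i1, g1 β s (ph x y) i1 w * x i1 k ^ 2 - M ^ 2 := by
    have : ∀ i1, g1 β s (ph x y) i1 w * (x i1 k - M)^2 = g1 β s (ph x y) i1 w * x i1 k ^ 2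
      - 2 * M * (g1 β s (ph x y) i1 w * x i1 k) + M^2 * g1 β s (ph x y) i1 w := fun _ => by ring
    simp only [this, Finset.sum_add_distrib, Finset.sum_sub_distrib, ← Finset.mul_sum, g1_sum hl]
    rw [← hM]; ring
  rw [e2, ec, Hc, dc]
  simp only [ph, ← Finset.sum_mul, g2_sum hl, one_mul]
  simp only [← Finset.sum_mul] at e0 e1
  rw [e0, e1]; ring

lemma ec_h_nonneg (hl : 1 ≤ l) (k : Fin n) (w : AA m n → ℝ) :
    0 ≤ ec β s (ph x y) (Sum.inr (Sum.inr k)) w := by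
  rw [ec_h hl]
  exact mul_nonneg (sq_nonneg _) (Finset.sum_nonneg fun i _ =>
    mul_nonneg (g1_pos hl _ _).le (sq_nonneg _))

lemma ec_h_pos (hs : s ≠ 0) (hβ : 0 < β) (hl : 1 ≤ l) (k : Fin n) {i j : Fin l}
    (hne : x i k ≠ x j k) (w : AA m n → ℝ) :
    0 < ec β s (ph x y) (Sum.inr (Sum.inr k)) w := by
  rw [ec_h hl]
  refine mul_pos (by positivity) ?_
  set M := ∑ j, g1 β s (ph x y) j w * x j k with hM
  have : ∃ i0, x i0 k ≠ M := by
    by_contra h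
    push Not at h
    exact hne ((h i).trans (h j).symm)
  obtain ⟨i0, h0⟩ := this
  refine Finset.sum_pos' (fun i _ => mul_nonneg (g1_pos hl _ _).le (sq_nonneg _))
    ⟨i0, Finset.mem_univ _, mul_pos (g1_pos hl _ _) ?_⟩
  have h1 : x i0 k - M ≠ 0 := sub_ne_zero.2 h0
  positivity

lemma dh_nonneg (hs : s ≠ 0) (hβ : 0 < β) (hxu : ∀ i, nrm2 (x i) = 1) (hl : 1 ≤ l)
    (hθ : θ ∈ SS (AA m n) r) {k : ℕ} (hk : k ≤ r) : 0 ≤ dh β s x y r θ k := by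
  have h := XK_h (β := β) (s := s) (y := y) hxu hl hθ hk
  have h2 : 0 ≤ ∑ i : Fin n, XK (Lc β s (ph x y)) (dc β s (ph x y)) (ec β s (ph x y)) r θ k
      (Sum.inr (Sum.inr i)) :=
    Finset.sum_nonneg fun i _ => XK_nonneg (HL_c hl) hθ _ (ec_h_nonneg hl i) k
  rw [h] at h2
  exact nonneg_of_mul_nonneg_right h2 (by positivity)

lemma Rx_ne (hxu : ∀ i, nrm2 (x i) = 1) (hl : 1 ≤ l) (hθ : θ ∈ SS (AA m n) r) {k : ℕ}
    (h : Rx β s x y r θ k ≠ 1) : ∃ (a : Fin n) (i j : Fin l), x i a ≠ x j a := by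
  by_contra hc
  push Not at hc
  apply h
  rw [← EBk_one (β := β) (s := s) (φ := ph x y) hl hθ k, Rx]
  congr 1
  funext i1 i2 p1 p2
  rw [← sumsq (hxu i1), dotv]
  exact Finset.sum_congr rfl fun a _ => by rw [hc a p1 i1, pow_two]

lemma psi_deriv (hxu : ∀ i, nrm2 (x i) = 1) (hs : s ≠ 0) (hβ : 0 < β) (hl : 1 ≤ l)
    {T : ℝ → ℝ} {a b mv : ℝ → ℕ → ℝ} {S : Set ℝ} {t0 : ℝ} (ht0 : t0 ∈ S)
    (hadm : ∀ t ∈ S, Adm r (T t) (a t) (b t) (mv t)) (h0 : ∀ t, mv t 0 = 1)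
    {T' : ℝ} {a' b' mv' : ℕ → ℝ}
    (hT : HasDerivWithinAt T T' S t0)
    (ha : ∀ k, k ≤ r → HasDerivWithinAt (fun t => a t k) (a' k) S t0)
    (hb : ∀ k, k ≤ r → HasDerivWithinAt (fun t => b t k) (b' k) S t0)
    (hm : ∀ k, 1 ≤ k → k ≤ r → HasDerivWithinAt (fun t => mv t k) (mv' k) S t0)
    {θ : Ix (AA m n) → ℝ} (hθe : θ = TH m n r (T t0) (a t0) (b t0) (mv t0)) :
    HasDerivWithinAt (fun t => fK (Lc β s (ph x y)) (TH m n r (T t) (a t) (b t) (mv t)) (r+1) 0)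
      ((s*β)^2/2 * (dG β s x y r θ r * T'
        + ∑ k ∈ Finset.range (r+1), (du β s x y r θ k * a' k + dh β s x y r θ k * b' k))
        + ∑ k ∈ Finset.range r, GK (Lc β s (ph x y)) r θ k * mv' (k+1)) S t0 := by
  have H := HL_c (β := β) (s := s) (φ := ph x y) hl
  have hθ : θ ∈ SS (AA m n) r := hθe ▸ TH_mem (hadm t0 ht0)
  let θ' : Ix (AA m n) → ℝ := TH m n r T' a' b' mv'
  have key := box_deriv (J := JJ (AA m n) r) (JJ_conn r) (f := fun θ => fK (Lc β s (ph x y)) θ (r+1) 0)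
    (D := DP (Lc β s (ph x y)) (dc β s (ph x y)) (ec β s (ph x y)) r) (sIx (AA m n) r)
    (fK_cont H.lg) (fun i hi => DP_cont H i hi) (fun i hi θ hθ z hz => DP_deriv H i hi hθ hz)
    ht0 (θ := fun t => TH m n r (T t) (a t) (b t) (mv t)) (θ' := θ')
    (fun t ht => TH_mem (hadm t ht)) ?_ ?_
  · refine key.congr_deriv ?_
    rw [← hθe]
    unfold sIx
    rw [Finset.sum_disjSum, Finset.sum_map, Finset.sum_product]
    congr 1
    · have e : ∀ k ∈ Finset.range (r+1), ∑ a : AA m n, DP (Lc β s (ph x y)) (dc β s (ph x y))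
          (ec β s (ph x y)) r (Sum.inl (k, a)) θ * θ' (Sum.inl (k, a))
          = (s*β)^2/2 * (dG β s x y r θ k * (if k = r then T' else 0)
            + (du β s x y r θ k * a' k + dh β s x y r θ k * b' k)) := by
        intro k hk
        have hk' : k ≤ r := by simpa [Nat.lt_succ_iff] using hk
        rw [Fintype.sum_sum_type, Fintype.sum_sum_type]
        simp only [DP, θ', TH, if_pos hk', ← Finset.sum_mul, ← Finset.mul_sum]
        rw [XK_u hs hβ hl hθ hk', XK_G hxu hs hβ hl hθ hk', XK_h hxu hl hθ hk']
        ring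
      rw [Finset.sum_congr rfl e, ← Finset.mul_sum, Finset.sum_add_distrib]
      congr 2
      rw [Finset.sum_eq_single r]
      · simp
      · intro b _ hb; simp [hb]
      · simp
    · refine Finset.sum_congr rfl fun k hk => ?_
      have hk' : k + 1 ≤ r := Finset.mem_range.1 hk
      simp [DP, θ', TH, hk']
  · intro i hi t
    rcases i with ⟨k, g | j | j⟩ | k
    · rw [mem_sIx_inl] at hi; simp only [TH]; rw [if_neg (by omega), if_neg (by omega)]
    · rw [mem_sIx_inl] at hi; simp only [TH]; rw [if_neg (by omega), if_neg (by omega)]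
    · rw [mem_sIx_inl] at hi; simp only [TH]; rw [if_neg (by omega), if_neg (by omega)]
    · rw [mem_sIx_inr] at hi; simp only [TH]
      rcases Nat.eq_zero_or_pos k with rfl | hk
      · simp [h0]
      · rw [if_neg (by omega), if_neg (by omega)]
  · intro i hi
    rcases i with ⟨k, g | j | j⟩ | k
    · simp only [TH, θ']
      split_ifs
      · exact hT
      · exact hasDerivWithinAt_const _ _ _
    · rw [mem_sIx_inl] at hi; simp only [TH, θ', if_pos (Nat.lt_succ_iff.1 hi)]
      exact ha k (by omega)
    · rw [mem_sIx_inl] at hi; simp only [TH, θ', if_pos (Nat.lt_succ_iff.1 hi)]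
      exact hb k (by omega)
    · rw [mem_sIx_inr] at hi; simp only [TH, θ', if_pos hi.2]
      exact hm k hi.1 hi.2

lemma psi_cont (hl : 1 ≤ l)
    {T : ℝ → ℝ} {a b mv : ℝ → ℕ → ℝ} {S : Set ℝ}
    (hadm : ∀ t ∈ S, Adm r (T t) (a t) (b t) (mv t))
    (hT : ContinuousOn T S)
    (ha : ∀ k, k ≤ r → ContinuousOn (fun t => a t k) S)
    (hb : ∀ k, k ≤ r → ContinuousOn (fun t => b t k) S)
    (hm : ∀ k, k ≤ r → ContinuousOn (fun t => mv t k) S) :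
    ContinuousOn (fun t => fK (Lc β s (ph x y)) (TH m n r (T t) (a t) (b t) (mv t)) (r+1) 0) S := by
  refine (fK_cont (Lc_LG1 (β := β) (s := s) (φ := ph x y) hl)).comp
    (f := fun t => TH m n r (T t) (a t) (b t) (mv t)) ?_ (fun t ht => TH_mem (hadm t ht))
  refine continuousOn_pi.2 fun i => ?_
  rcases i with ⟨k, g | j | j⟩ | k
  · simp only [TH]; split_ifs; exacts [hT, continuousOn_const]
  · simp only [TH]; split_ifs with hk; exacts [ha k hk, continuousOn_const]
  · simp only [TH]; split_ifs with hk; exacts [hb k hk, continuousOn_const]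
  · simp only [TH]; split_ifs with hk; exacts [hm k hk, continuousOn_const]

end blocks

section meas

/-- noise vector -/
def vec (G : Fin m → Fin n → ℝ) (v : (Fin m → ℝ) × (Fin n → ℝ)) : AA m n → ℝ
  | Sum.inl jk => G jk.1 jk.2
  | Sum.inr (Sum.inl j) => v.1 j
  | Sum.inr (Sum.inr j) => v.2 j

lemma mp_curry : MeasurePreserving (fun (G : Fin m → Fin n → ℝ) (jk : Fin m × Fin n) => G jk.1 jk.2)
    (gMat m n) (gA (Fin m × Fin n)) := by
  have hmeas : Measurable (fun (G : Fin m → Fin n → ℝ) (jk : Fin m × Fin n) => G jk.1 jk.2) := by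
    fun_prop
  refine ⟨hmeas, ?_⟩
  unfold gA
  symm
  refine Measure.pi_eq fun s hs => ?_
  rw [Measure.map_apply hmeas (MeasurableSet.univ_pi hs)]
  have : (fun (G : Fin m → Fin n → ℝ) (jk : Fin m × Fin n) => G jk.1 jk.2) ⁻¹' Set.univ.pi s
      = Set.univ.pi fun j => Set.univ.pi fun k => s (j, k) := by
    ext G
    simp only [Set.mem_preimage, Set.mem_pi, Set.mem_univ, true_imp_iff, Prod.forall]
  rw [this, gMat, Measure.pi_pi, Fintype.prod_prod_type]
  refine Finset.prod_congr rfl fun j _ => ?_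
  rw [gVec, Measure.pi_pi]

lemma mp_vec : MeasurePreserving
    (fun z : (Fin m → Fin n → ℝ) × ((Fin m → ℝ) × (Fin n → ℝ)) => vec z.1 z.2)
    ((gMat m n).prod ((gVec m).prod (gVec n))) (gA (AA m n)) := by
  have h1 := measurePreserving_sumPiEquivProdPi_symm (ι := Fin m) (ι' := Fin n) (X := fun _ => ℝ)
    (fun _ => stdG)
  have h2 := measurePreserving_sumPiEquivProdPi_symm (ι := Fin m × Fin n) (ι' := Fin m ⊕ Fin n)
    (X := fun _ => ℝ) (fun _ => stdG)
  have h3 := h2.comp (MeasurePreserving.prod (mp_curry (m := m) (n := n)) h1)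
  convert h3 using 1
  · funext z a
    rcases a with a | a | a <;> rfl
  · rfl
  · rfl

lemma vec_cont : Continuous
    (fun z : (Fin m → Fin n → ℝ) × ((Fin m → ℝ) × (Fin n → ℝ)) => vec z.1 z.2) := by
  refine continuous_pi fun a => ?_
  rcases a with a | a | a <;> simp only [vec] <;> fun_prop

/-- low level expectation -/
lemma low_int {F : (AA m n → ℝ) → ℝ} (hF : Continuous F)
    (h0 : ∀ G v, F (vec G v) = F (vec 0 v)) :
    ∫ v, F (vec 0 v) ∂((gVec m).prod (gVec n)) = ∫ g, F g ∂(gA (AA m n)) := by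
  rw [← mp_vec.map_eq, integral_map mp_vec.measurable.aemeasurable hF.aestronglyMeasurable]
  have : ∀ z : (Fin m → Fin n → ℝ) × ((Fin m → ℝ) × (Fin n → ℝ)), F (vec z.1 z.2)
    = (fun v => F (vec 0 v)) z.2 := fun z => h0 _ _
  have e := integral_fun_snd (μ := gMat m n) (ν := (gVec m).prod (gVec n)) (fun v => F (vec 0 v))
  simp only [this]
  rw [e]
  simp

lemma muU_int (a : ℝ → ℝ) (b : (Fin m → ℝ) × (Fin n → ℝ) → ℝ) :
    ∫ u, a u.1 * b u.2 ∂muU m n = (∫ z, a z ∂stdG) * ∫ v, b v ∂((gVec m).prod (gVec n)) := by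
  unfold muU
  exact integral_prod_mul a b

lemma mp_top (r : ℕ) : MeasurePreserving
    (fun ω : (Fin m → Fin n → ℝ) × (Fin (r+1) → Us m n) => vec ω.1 (ω.2 (Fin.last r)).2)
    (muAll r m n) (gA (AA m n)) := by
  have h1 : MeasurePreserving (fun U : Fin (r+1) → Us m n => (U (Fin.last r)).2)
      (Measure.pi fun _ : Fin (r+1) => muU m n) ((gVec m).prod (gVec n)) :=
    (measurePreserving_snd (μ := stdG) (ν := (gVec m).prod (gVec n))).comp
      (measurePreserving_eval (fun _ : Fin (r+1) => muU m n) (Fin.last r))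
  exact mp_vec.comp ((MeasurePreserving.id (gMat m n)).prod h1)

lemma mp_top4 (r : ℕ) : MeasurePreserving
    (fun ω : (Fin m → Fin n → ℝ) × (Fin (r+1) → Us m n) => (ω.2 (Fin.last r)).1)
    (muAll r m n) stdG := by
  have h1 : MeasurePreserving (fun U : Fin (r+1) → Us m n => (U (Fin.last r)).1)
      (Measure.pi fun _ : Fin (r+1) => muU m n) stdG :=
    (measurePreserving_fst (μ := stdG) (ν := (gVec m).prod (gVec n))).comp
      (measurePreserving_eval (fun _ : Fin (r+1) => muU m n) (Fin.last r))
  exact h1.comp measurePreserving_snd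

lemma stdG_id : Integrable (fun z : ℝ => z) stdG ∧ ∫ z, z ∂stdG = 0 := by
  constructor
  · unfold stdG
    exact (ProbabilityTheory.memLp_id_gaussianReal 1).integrable (by norm_num)
  · unfold stdG
    simp

lemma mgf_two (c : ℝ) : ∫ z, Real.exp (c * z) ∂stdG = Real.exp (c ^ 2 / 2) := by
  have h := mgf_one c
  simp only [Real.exp_sub, integral_div] at h
  rwa [div_eq_one_iff_eq (Real.exp_pos _).ne'] at h

end meas

section bridge

/-- variances -/
def al (t : ℝ) (p : ℕ → ℝ) (k : ℕ) : ℝ := (1 - t) * max 0 (p k - p (k+1))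
/-- parameters -/
def thp (m n r : ℕ) (t : ℝ) (mv p q : ℕ → ℝ) : Ix (AA m n) → ℝ :=
  TH m n r t (al t p) (al t q) mv
/-- u4 coefficients -/
def ta (ε t : ℝ) (p q : ℕ → ℝ) (k : ℕ) : ℝ := ε * (√t * √(p k * q k - p (k+1) * q (k+1)))
/-- base noise -/
def Wb (t : ℝ) (G : Fin m → Fin n → ℝ) : AA m n → ℝ
  | Sum.inl jk => √t * G jk.1 jk.2
  | Sum.inr _ => 0
/-- accumulated noise -/
def Wn (r : ℕ) (θ : Ix (AA m n) → ℝ) (t : ℝ) (k : ℕ) (G : Fin m → Fin n → ℝ)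
    (U : Fin (r+1) → Us m n) : AA m n → ℝ :=
  fun a => Wb t G a + ∑ j : Fin (r+1), if k ≤ (j : ℕ) then sg θ j a * vec 0 (U j).2 a else 0
/-- accumulated scalar noise -/
def S4 (r : ℕ) (τ : ℕ → ℝ) (k : ℕ) (U : Fin (r+1) → Us m n) : ℝ :=
  ∑ j : Fin (r+1), if k ≤ (j : ℕ) then τ j * (U j).1 else 0
/-- accumulated constant -/
def cst (β s : ℝ) (mv τ : ℕ → ℝ) (k : ℕ) : ℝ :=
  ∑ j ∈ Finset.range k, mv (j+1) * (s * β * τ j) ^ 2 / 2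

variable {r : ℕ} {ε β s t : ℝ} {mv p q : ℕ → ℝ} {x : Fin l → Fin n → ℝ} {y : Fin l → Fin m → ℝ}

lemma sqrt_al (ht : t ≤ 1) (p : ℕ → ℝ) (k : ℕ) : √(al t p k) = √(1 - t) * √(p k - p (k+1)) := by
  unfold al
  rw [Real.sqrt_mul (by linarith)]
  congr 1
  rcases le_total 0 (p k - p (k+1)) with h | h
  · rw [max_eq_right h]
  · rw [max_eq_left h, Real.sqrt_zero, Real.sqrt_eq_zero_of_nonpos h]

lemma sg_u (ht : t ≤ 1) {k : ℕ} (hk : k ≤ r) (j : Fin m) :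
    sg (thp m n r t mv p q) k (Sum.inr (Sum.inl j)) = √(1 - t) * √(p k - p (k+1)) := by
  simp only [sg, thp, TH, if_pos hk, sqrt_al ht]
lemma sg_h (ht : t ≤ 1) {k : ℕ} (hk : k ≤ r) (j : Fin n) :
    sg (thp m n r t mv p q) k (Sum.inr (Sum.inr j)) = √(1 - t) * √(q k - q (k+1)) := by
  simp only [sg, thp, TH, if_pos hk, sqrt_al ht]
lemma sg_G (k : ℕ) (j : Fin m × Fin n) :
    sg (thp m n r t mv p q) k (Sum.inl j) = if k = r then √t else 0 := by
  simp only [sg, thp, TH]; split_ifs <;> simp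

lemma upd_sum (F : Fin (r+1) → Us m n → ℝ) {k : ℕ} (h : k < r + 1) (U : Fin (r+1) → Us m n)
    (u : Us m n) :
    (∑ j : Fin (r+1), if k ≤ (j : ℕ) then F j (Function.update U ⟨k, h⟩ u j) else 0)
      = (∑ j : Fin (r+1), if k + 1 ≤ (j : ℕ) then F j (U j) else 0) + F ⟨k, h⟩ u := by
  have e : F ⟨k, h⟩ u = ∑ j : Fin (r+1), if j = ⟨k, h⟩ then F ⟨k, h⟩ u else 0 := by simp
  rw [e, ← Finset.sum_add_distrib]
  refine Finset.sum_congr rfl fun j _ => ?_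
  by_cases hj : j = ⟨k, h⟩
  · subst hj; simp
  · have hj' : (j : ℕ) ≠ k := fun hh => hj (Fin.ext hh)
    rw [Function.update_of_ne hj, if_neg hj, add_zero]
    by_cases hk : k ≤ (j : ℕ)
    · rw [if_pos hk, if_pos (by omega)]
    · rw [if_neg hk, if_neg (by omega)]

lemma Wn_upd (θ : Ix (AA m n) → ℝ) {k : ℕ} (h : k < r + 1) (G : Fin m → Fin n → ℝ)
    (U : Fin (r+1) → Us m n) (u : Us m n) :
    Wn r θ t k G (Function.update U ⟨k, h⟩ u) = sh (Wn r θ t (k+1) G U) (sg θ k) (vec 0 u.2) := by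
  funext a
  simp only [Wn, sh]
  rw [upd_sum (fun j u => sg θ j a * vec 0 u.2 a) h U u, add_assoc]

lemma S4_upd (τ : ℕ → ℝ) {k : ℕ} (h : k < r + 1) (U : Fin (r+1) → Us m n) (u : Us m n) :
    S4 r τ k (Function.update U ⟨k, h⟩ u) = S4 r τ (k+1) U + τ k * u.1 := by
  simp only [S4]
  rw [upd_sum (fun j u => τ j * u.1) h U u]

lemma last_sum (F : Fin (r+1) → ℝ) :
    (∑ j : Fin (r+1), if r ≤ (j : ℕ) then F j else 0) = F (Fin.last r) := by
  rw [Finset.sum_eq_single (Fin.last r)]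
  · simp
  · intro j _ hj
    rw [if_neg]
    intro h
    exact hj (Fin.ext (by have := j.2; simp; omega))
  · simp

lemma Wn_last (G : Fin m → Fin n → ℝ) (U : Fin (r+1) → Us m n) :
    Wn r (thp m n r t mv p q) t r G U
      = sh 0 (sg (thp m n r t mv p q) r) (vec G (U (Fin.last r)).2) := by
  funext a
  simp only [Wn, sh]
  rw [last_sum (fun j => sg (thp m n r t mv p q) j a * vec 0 (U j).2 a)]
  rcases a with a | a | a
  · simp [Wb, vec, sg_G]
  · simp [Wb, vec]
  · simp [Wb, vec]

lemma D0R_eq (hxu : ∀ i, nrm2 (x i) = 1) (hyu : ∀ i, nrm2 (y i) = 1) (ht : t ≤ 1)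
    (G : Fin m → Fin n → ℝ) (U : Fin (r+1) → Us m n) (i1 i2 : Fin l) :
    D0R r ε β s t mv p q x y G U i1 i2
      = lin (ph x y i1 i2) (Wn r (thp m n r t mv p q) t 0 G U) + S4 r (ta ε t p q) 0 U := by
  unfold D0R lin
  rw [Fintype.sum_sum_type, Fintype.sum_sum_type, Fintype.sum_prod_type]
  simp only [hxu, hyu, mul_one, ph, Wn, Wb, vec, zero_add, Nat.zero_le, if_true, Pi.zero_apply,
    mul_zero, Finset.sum_const_zero, add_zero]
  have e1 : ∀ j : Fin m, ∑ k : Fin (r+1), sg (thp m n r t mv p q) k (Sum.inr (Sum.inl j)) * (U k).2.1 j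
      = √(1-t) * ∑ k : Fin (r+1), √(p k - p (k+1)) * (U k).2.1 j := by
    intro j
    rw [Finset.mul_sum]
    refine Finset.sum_congr rfl fun k _ => ?_
    rw [sg_u ht (by have := k.2; omega)]; ring
  have e2 : ∀ j : Fin n, ∑ k : Fin (r+1), sg (thp m n r t mv p q) k (Sum.inr (Sum.inr j)) * (U k).2.2 j
      = √(1-t) * ∑ k : Fin (r+1), √(q k - q (k+1)) * (U k).2.2 j := by
    intro j
    rw [Finset.mul_sum]
    refine Finset.sum_congr rfl fun k _ => ?_
    rw [sg_h ht (by have := k.2; omega)]; ring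
  simp only [e1, e2]
  have e3 : √t * ∑ j, ∑ k, y i2 j * (G j k * x i1 k)
      = ∑ j, ∑ k, y i2 j * x i1 k * (√t * G j k) := by
    simp only [Finset.mul_sum]
    refine Finset.sum_congr rfl fun j _ => Finset.sum_congr rfl fun k _ => by ring
  have e4 : √(1-t) * ∑ j, y i2 j * ∑ k : Fin (r+1), √(p k - p (k+1)) * (U k).2.1 j
      = ∑ j, y i2 j * (√(1-t) * ∑ k : Fin (r+1), √(p k - p (k+1)) * (U k).2.1 j) := by
    rw [Finset.mul_sum]
    refine Finset.sum_congr rfl fun j _ => by ring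
  have e5 : √(1-t) * ∑ j, (∑ k : Fin (r+1), √(q k - q (k+1)) * (U k).2.2 j) * x i1 j
      = ∑ j, x i1 j * (√(1-t) * ∑ k : Fin (r+1), √(q k - q (k+1)) * (U k).2.2 j) := by
    rw [Finset.mul_sum]
    refine Finset.sum_congr rfl fun j _ => by ring
  have e6 : ε * (√t * ∑ k : Fin (r+1), √(p k * q k - p (k+1) * q (k+1)) * (U k).1)
      = S4 r (ta ε t p q) 0 U := by
    unfold S4 ta
    simp only [Nat.zero_le, if_true, Finset.mul_sum]
    refine Finset.sum_congr rfl fun j _ => by ring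
  rw [e3, e4, e5, e6]
  ring

lemma AR_eq (hxu : ∀ i, nrm2 (x i) = 1) (hyu : ∀ i, nrm2 (y i) = 1) (ht : t ≤ 1)
    (G : Fin m → Fin n → ℝ) (U : Fin (r+1) → Us m n) (i1 i2 : Fin l) :
    AR r ε β s t mv p q x y G U i1 i2
      = Real.exp (β * S4 r (ta ε t p q) 0 U)
        * Ac β (ph x y) i1 i2 (Wn r (thp m n r t mv p q) t 0 G U) := by
  unfold AR Ac
  rw [D0R_eq hxu hyu ht, ← Real.exp_add]
  congr 1; ring

lemma CR_eq (hxu : ∀ i, nrm2 (x i) = 1) (hyu : ∀ i, nrm2 (y i) = 1) (ht : t ≤ 1)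
    (G : Fin m → Fin n → ℝ) (U : Fin (r+1) → Us m n) (i1 : Fin l) :
    CR r ε β s t mv p q x y G U i1
      = Real.exp (β * S4 r (ta ε t p q) 0 U)
        * Cc β (ph x y) i1 (Wn r (thp m n r t mv p q) t 0 G U) := by
  unfold CR Cc
  rw [Finset.mul_sum]
  exact Finset.sum_congr rfl fun i _ => AR_eq hxu hyu ht G U i1 i

lemma CRs_eq (hl : 1 ≤ l) (hxu : ∀ i, nrm2 (x i) = 1) (hyu : ∀ i, nrm2 (y i) = 1) (ht : t ≤ 1)
    (G : Fin m → Fin n → ℝ) (U : Fin (r+1) → Us m n) (i1 : Fin l) :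
    CR r ε β s t mv p q x y G U i1 ^ s
      = Real.exp (s * β * S4 r (ta ε t p q) 0 U)
        * Cc β (ph x y) i1 (Wn r (thp m n r t mv p q) t 0 G U) ^ s := by
  rw [CR_eq hxu hyu ht, Real.mul_rpow (Real.exp_pos _).le (Cc_pos hl _ _).le, ← Real.exp_mul]
  congr 2; ring

lemma ZR_eq (hl : 1 ≤ l) (hxu : ∀ i, nrm2 (x i) = 1) (hyu : ∀ i, nrm2 (y i) = 1) (ht : t ≤ 1)
    (G : Fin m → Fin n → ℝ) (U : Fin (r+1) → Us m n) :
    ZR r ε β s t mv p q x y G U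
      = Real.exp (s * β * S4 r (ta ε t p q) 0 U)
        * Zc β s (ph x y) (Wn r (thp m n r t mv p q) t 0 G U) := by
  unfold ZR Zc
  rw [Finset.mul_sum]
  exact Finset.sum_congr rfl fun i _ => CRs_eq hl hxu hyu ht G U i

lemma gam0R_eq (hl : 1 ≤ l) (hxu : ∀ i, nrm2 (x i) = 1) (hyu : ∀ i, nrm2 (y i) = 1) (ht : t ≤ 1)
    (G : Fin m → Fin n → ℝ) (U : Fin (r+1) → Us m n) (i1 i2 : Fin l) :
    gam0R r ε β s t mv p q x y i1 i2 G U
      = g0 β s (ph x y) i1 i2 (Wn r (thp m n r t mv p q) t 0 G U) := by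
  unfold gam0R g0 g1 g2
  rw [CRs_eq hl hxu hyu ht, ZR_eq hl hxu hyu ht, CR_eq hxu hyu ht, AR_eq hxu hyu ht,
    mul_div_mul_left _ _ (Real.exp_pos _).ne', mul_div_mul_left _ _ (Real.exp_pos _).ne']

/-- the level integral -/
lemma lev_int {f h : (AA m n → ℝ) → ℝ} (hf : LG1 f) (hh : EG1 h) {k : ℕ} (hk : k < r)
    (μ c τ : ℝ) (w : AA m n → ℝ) :
    ∫ u : Us m n, Real.exp (μ * (f (sh w (sg (thp m n r t mv p q) k) (vec 0 u.2))
        + (c + τ * u.1))) * h (sh w (sg (thp m n r t mv p q) k) (vec 0 u.2)) ∂muU m n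
      = Real.exp (μ * (c + μ * τ ^ 2 / 2)) * EE μ (sg (thp m n r t mv p q) k) f h w := by
  set σ := sg (thp m n r t mv p q) k with hσ
  have hσ0 : ∀ a, σ (Sum.inl a) = 0 := fun a => by rw [hσ, sg_G, if_neg (by omega)]
  have e : ∀ u : Us m n, Real.exp (μ * (f (sh w σ (vec 0 u.2))
        + (c + τ * u.1))) * h (sh w σ (vec 0 u.2))
      = (fun z : ℝ => Real.exp (μ * c) * Real.exp ((μ * τ) * z)) u.1
        * (fun v => Real.exp (μ * f (sh w σ (vec 0 v))) * h (sh w σ (vec 0 v))) u.2 := by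
    intro u
    simp only
    rw [← mul_assoc, ← Real.exp_add, ← Real.exp_add]
    congr 2; ring
  rw [integral_congr_ae (Filter.Eventually.of_forall e),
    muU_int (fun z : ℝ => Real.exp (μ * c) * Real.exp ((μ * τ) * z))
      (fun v => Real.exp (μ * f (sh w σ (vec 0 v))) * h (sh w σ (vec 0 v))), integral_const_mul, mgf_two, ← Real.exp_add]
  have hsh : ∀ G v, sh w σ (vec G v) = sh w σ (vec 0 v) := by
    intro G v; funext a
    rcases a with a | a | a <;> simp [sh, vec, hσ0]
  rw [low_int (F := fun g => Real.exp (μ * f (sh w σ g)) * h (sh w σ g))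
    (((hf.exp μ).mul hh).comp_sh σ w).cont (fun G v => by simp only [hsh G v])]
  unfold EE
  congr 2; ring

end bridge

section bridge2

/-- standing hypotheses -/
structure BH (r : ℕ) (t : ℝ) (mv : ℕ → ℝ) (x : Fin l → Fin n → ℝ) (y : Fin l → Fin m → ℝ) :
    Prop where
  hl : 1 ≤ l
  hxu : ∀ i, nrm2 (x i) = 1
  hyu : ∀ i, nrm2 (y i) = 1
  ht0 : 0 ≤ t
  ht1 : t ≤ 1
  h0 : mv 0 = 1
  hm : ∀ k, 1 ≤ k → k ≤ r → 0 < mv k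

variable {r : ℕ} {ε β s t : ℝ} {mv p q : ℕ → ℝ} {x : Fin l → Fin n → ℝ} {y : Fin l → Fin m → ℝ}

lemma al_nonneg (ht : t ≤ 1) (p : ℕ → ℝ) (k : ℕ) : 0 ≤ al t p k :=
  mul_nonneg (by linarith) (le_max_left _ _)

lemma BH.adm (B : BH r t mv x y) (p q : ℕ → ℝ) : Adm r t (al t p) (al t q) mv :=
  ⟨B.ht0, fun k _ => al_nonneg B.ht1 p k, fun k _ => al_nonneg B.ht1 q k, B.h0, B.hm⟩

lemma BH.mem (B : BH r t mv x y) (p q : ℕ → ℝ) : thp m n r t mv p q ∈ SS (AA m n) r :=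
  TH_mem (B.adm p q)

lemma BH.mpos (B : BH r t mv x y) {k : ℕ} (hk : k ≤ r) : 0 < mv k := by
  rcases Nat.eq_zero_or_pos k with rfl | h
  · rw [B.h0]; exact one_pos
  · exact B.hm k h hk

lemma mu_thp {k : ℕ} (hk : k ≤ r) : mu (thp m n r t mv p q) k = mv k := by
  simp only [mu, thp, TH, if_pos hk]

lemma cst_succ (mv τ : ℕ → ℝ) (k : ℕ) :
    cst β s mv τ (k+1) = cst β s mv τ k + mv (k+1) * (s * β * τ k) ^ 2 / 2 := by
  unfold cst; rw [Finset.sum_range_succ]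

/-- the common integrand -/
lemma zeta_step (B : BH r t mv x y) {k : ℕ} (hk : k < r) (hk1 : k < r + 1)
    (G : Fin m → Fin n → ℝ)
    (ih : ∀ U, zetaR r ε β s t mv p q x y G k U
      = Real.exp (mv k * (fK (Lc β s (ph x y)) (thp m n r t mv p q) k
          (Wn r (thp m n r t mv p q) t k G U) + s * β * S4 r (ta ε t p q) k U
          + cst β s mv (ta ε t p q) k)))
    {h : (AA m n → ℝ) → ℝ} (hh : EG1 h) (U : Fin (r+1) → Us m n) :
    ∫ u, zetaR r ε β s t mv p q x y G k (Function.update U ⟨k, hk1⟩ u) ^ (mv (k+1) / mv k)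
        * h (Wn r (thp m n r t mv p q) t k G (Function.update U ⟨k, hk1⟩ u)) ∂muU m n
      = Real.exp (mv (k+1) * (s * β * S4 r (ta ε t p q) (k+1) U + cst β s mv (ta ε t p q) (k+1)))
        * EE (mv (k+1)) (sg (thp m n r t mv p q) k) (fK (Lc β s (ph x y)) (thp m n r t mv p q) k) h
          (Wn r (thp m n r t mv p q) t (k+1) G U) := by
  have hmk := B.mpos hk.le
  have H := fK_LG1 (Lc_LG1 (β := β) (s := s) (φ := ph x y) B.hl) (B.mem p q) k
  have key := lev_int (t := t) (mv := mv) (p := p) (q := q) H hh hk (mv (k+1))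
    (s * β * S4 r (ta ε t p q) (k+1) U + cst β s mv (ta ε t p q) k)
    (s * β * ta ε t p q k) (Wn r (thp m n r t mv p q) t (k+1) G U)
  rw [cst_succ]
  rw [show mv (k+1) * (s * β * S4 r (ta ε t p q) (k+1) U + (cst β s mv (ta ε t p q) k
      + mv (k+1) * (s * β * ta ε t p q k) ^ 2 / 2)) = mv (k+1) * (s * β * S4 r (ta ε t p q) (k+1) U
      + cst β s mv (ta ε t p q) k + mv (k+1) * (s * β * ta ε t p q k) ^ 2 / 2) by ring, ← key]
  refine integral_congr_ae (Filter.Eventually.of_forall fun u => ?_)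
  simp only
  rw [ih, ← Real.exp_mul, Wn_upd, S4_upd]
  congr 2
  field_simp
  ring

lemma zeta_eq (B : BH r t mv x y) (G : Fin m → Fin n → ℝ) {k : ℕ} (hk : k ≤ r) :
    ∀ U, zetaR r ε β s t mv p q x y G k U
      = Real.exp (mv k * (fK (Lc β s (ph x y)) (thp m n r t mv p q) k
          (Wn r (thp m n r t mv p q) t k G U) + s * β * S4 r (ta ε t p q) k U
          + cst β s mv (ta ε t p q) k)) := by
  induction k with
  | zero =>
    intro U
    simp only [zetaR, fK, B.h0, one_mul, cst, Finset.range_zero, Finset.sum_empty, add_zero]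
    rw [ZR_eq B.hl B.hxu B.hyu B.ht1, Real.exp_add, Lc, Real.exp_log (Zc_pos B.hl _), mul_comm]
  | succ k ih =>
    intro U
    have hk' : k < r := hk
    have hm1 := B.mpos hk
    have st := zeta_step B hk' (by omega) G (ih (by omega)) (EG1.const 1) U
    simp only [mul_one] at st
    rw [zetaR, dif_pos (by omega), st, add_assoc, mul_add (mv (k+1)) (fK _ _ _ _), Real.exp_add,
      mul_comm]
    congr 1
    rw [fK, TT, mu_thp hk, if_neg hm1.ne', mul_div_cancel₀ _ hm1.ne',
      Real.exp_log (LG1.EEpos (fK_LG1 (Lc_LG1 B.hl) (B.mem p q) k) _ _ _)]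

lemma Phi_eq (B : BH r t mv x y) {k : ℕ} (hk : k < r) {h : (AA m n → ℝ) → ℝ} (hh : EG1 h)
    {f : (Fin m → Fin n → ℝ) → (Fin (r+1) → Us m n) → ℝ}
    (hf : ∀ G U, f G U = h (Wn r (thp m n r t mv p q) t k G U)) (G : Fin m → Fin n → ℝ)
    (U : Fin (r+1) → Us m n) :
    PhiR r ε β s t mv p q x y (k+1) f G U
      = PK (Lc β s (ph x y)) (thp m n r t mv p q) k h (Wn r (thp m n r t mv p q) t (k+1) G U) := by
  unfold PhiR
  simp only [Nat.add_sub_cancel]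
  rw [dif_pos (by omega)]
  simp only [hf]
  rw [zeta_step B hk (by omega) G (zeta_eq B G hk.le) hh U]
  have st := zeta_step (ε := ε) (β := β) (s := s) (p := p) (q := q) B hk (by omega) G
    (zeta_eq B G hk.le) (EG1.const 1) U
  simp only [mul_one] at st
  rw [zetaR, dif_pos (by omega), st, mul_div_mul_left _ _ (Real.exp_pos _).ne', PK, Phi,
    mu_thp (show k+1 ≤ r from hk)]

lemma PhiUp_low (lo : ℕ) (f : (Fin m → Fin n → ℝ) → (Fin (r+1) → Us m n) → ℝ) {hi : ℕ}
    (h : hi < lo) : PhiUpToR r ε β s t mv p q x y lo hi f = f := by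
  cases hi with
  | zero => rfl
  | succ hi => rw [PhiUpToR, if_pos h]

lemma PhiUp_eq (B : BH r t mv x y) {k : ℕ} {h : (AA m n → ℝ) → ℝ} (hh : EG1 h)
    {f : (Fin m → Fin n → ℝ) → (Fin (r+1) → Us m n) → ℝ}
    (hf : ∀ G U, f G U = h (Wn r (thp m n r t mv p q) t k G U)) {hi : ℕ} (hk : k ≤ hi)
    (hr : hi ≤ r) : ∀ G U,
    PhiUpToR r ε β s t mv p q x y (k+1) hi f G U
      = PU (Lc β s (ph x y)) (thp m n r t mv p q) k hi h
          (Wn r (thp m n r t mv p q) t hi G U) := by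
  induction hi, hk using Nat.le_induction with
  | base =>
    intro G U
    rw [PhiUp_low _ _ (Nat.lt_succ_self k), PU_low _ _ le_rfl, hf]
  | succ j hj ih =>
    intro G U
    rw [PhiUpToR, if_neg (by omega), PU_succ _ _ hj]
    exact Phi_eq B hr (PU_EG1 (Lc_LG1 B.hl) (B.mem p q) k j hh) (ih (by omega)) G U

lemma gamR_eq (B : BH r t mv x y) {k : ℕ} (hk : k ≤ r) (i1 i2 p1 p2 : Fin l)
    (G : Fin m → Fin n → ℝ) (U : Fin (r+1) → Us m n) :
    gamR r ε β s t mv p q x y k i1 i2 p1 p2 G U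
      = PU (Lc β s (ph x y)) (thp m n r t mv p q) k r
          (fun w => gk β s (ph x y) (thp m n r t mv p q) k i1 i2 w
            * gk β s (ph x y) (thp m n r t mv p q) k p1 p2 w)
          (Wn r (thp m n r t mv p q) t r G U) := by
  unfold gamR
  have hg := fun i1 i2 => gk_EG1 (β := β) (s := s) (φ := ph x y) B.hl (B.mem p q) k i1 i2
  refine PhiUp_eq B ((hg i1 i2).mul (hg p1 p2)) (fun G U => ?_) hk le_rfl G U
  have e := fun i1 i2 => PhiUp_eq (ε := ε) (β := β) (s := s) B
    (g0_EG1 (β := β) (s := s) (φ := ph x y) B.hl i1 i2)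
    (f := gam0R r ε β s t mv p q x y i1 i2)
    (fun G U => gam0R_eq B.hl B.hxu B.hyu B.ht1 G U i1 i2) (Nat.zero_le k) hk G U
  rw [zero_add] at e
  rw [e, e, gk, gk]

lemma top_int (B : BH r t mv x y) {h : (AA m n → ℝ) → ℝ} (hh : EG1 h) :
    Integrable (fun ω => h (Wn r (thp m n r t mv p q) t r ω.1 ω.2)) (muAll r m n) ∧
    ∫ ω, h (Wn r (thp m n r t mv p q) t r ω.1 ω.2) ∂muAll r m n
      = PK (Lc β s (ph x y)) (thp m n r t mv p q) r h 0 := by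
  have h1 := hh.comp_sh (sg (thp m n r t mv p q) r) 0
  simp only [Wn_last]
  constructor
  · exact (mp_top (m := m) (n := n) r).integrable_comp_of_integrable h1.int
  · have e := integral_map (μ := muAll r m n) (mp_top (m := m) (n := n) r).measurable.aemeasurable
      (f := fun g => h (sh 0 (sg (thp m n r t mv p q) r) g)) h1.cont.aestronglyMeasurable
    rw [← e, (mp_top (m := m) (n := n) r).map_eq, PK, Phi, mu_zero (B.mem p q) (Nat.lt_succ_self r),
      EE_zero_one, div_one, EE]
    simp

lemma EBrR_eq (B : BH r t mv x y) {k : ℕ} (hk : k ≤ r) (f : Fin l → Fin l → Fin l → Fin l → ℝ) :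
    EBrR r ε β s t mv p q x y k f = EBk β s (ph x y) r (thp m n r t mv p q) k f := by
  have hg := fun i1 i2 => gk_EG1 (β := β) (s := s) (φ := ph x y) B.hl (B.mem p q) k i1 i2
  have hgg := fun i1 i2 p1 p2 => (hg i1 i2).mul (hg p1 p2)
  have hP := fun i1 i2 p1 p2 => PU_EG1 (Lc_LG1 (β := β) (s := s) (φ := ph x y) B.hl) (B.mem p q)
    k r (hgg i1 i2 p1 p2)
  have hT := fun i1 i2 p1 p2 => top_int (β := β) (s := s) (p := p) (q := q) B (hP i1 i2 p1 p2)
  unfold EBrR EBk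
  simp only [gamR_eq B hk]
  rw [integral_finsetSum _ fun i1 _ => integrable_finsetSum _ fun i2 _ => integrable_finsetSum _
    fun p1 _ => integrable_finsetSum _ fun p2 _ => ((hT i1 i2 p1 p2).1.const_mul _)]
  refine Finset.sum_congr rfl fun i1 _ => ?_
  rw [integral_finsetSum _ fun i2 _ => integrable_finsetSum _
    fun p1 _ => integrable_finsetSum _ fun p2 _ => ((hT i1 i2 p1 p2).1.const_mul _)]
  refine Finset.sum_congr rfl fun i2 _ => ?_
  rw [integral_finsetSum _
    fun p1 _ => integrable_finsetSum _ fun p2 _ => ((hT i1 i2 p1 p2).1.const_mul _)]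
  refine Finset.sum_congr rfl fun p1 _ => ?_
  rw [integral_finsetSum _ fun p2 _ => ((hT i1 i2 p1 p2).1.const_mul _)]
  refine Finset.sum_congr rfl fun p2 _ => ?_
  rw [integral_const_mul, (hT i1 i2 p1 p2).2, PU_succ _ _ hk]

lemma psiR_eq (B : BH r t mv x y) :
    psiR r ε β s t mv p q x y = (β * |s| * √(n : ℝ))⁻¹ *
      (fK (Lc β s (ph x y)) (thp m n r t mv p q) (r+1) 0 + cst β s mv (ta ε t p q) r) := by
  have hmr := B.mpos (le_refl r)
  unfold psiR
  have hf := (fK_LG1 (Lc_LG1 (β := β) (s := s) (φ := ph x y) B.hl) (B.mem p q) r).eg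
  have hT := top_int (β := β) (s := s) (p := p) (q := q) B hf
  have h4 := (mp_top4 (m := m) (n := n) r)
  have i4 : Integrable (fun ω : (Fin m → Fin n → ℝ) × (Fin (r+1) → Us m n) =>
      (ω.2 (Fin.last r)).1) (muAll r m n) := h4.integrable_comp_of_integrable stdG_id.1
  have e4 : ∫ ω : (Fin m → Fin n → ℝ) × (Fin (r+1) → Us m n),
      (ω.2 (Fin.last r)).1 ∂(muAll r m n) = 0 := by
    have e := integral_map (μ := muAll r m n) h4.measurable.aemeasurable (f := fun z : ℝ => z)
      continuous_id.aestronglyMeasurable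
    rw [← e, h4.map_eq, stdG_id.2]
  have e : ∀ ω : (Fin m → Fin n → ℝ) × (Fin (r+1) → Us m n),
      (β * |s| * √(n : ℝ) * mv r)⁻¹ * Real.log (zetaR r ε β s t mv p q x y ω.1 r ω.2)
      = (β * |s| * √(n : ℝ))⁻¹ * (fK (Lc β s (ph x y)) (thp m n r t mv p q) r
          (Wn r (thp m n r t mv p q) t r ω.1 ω.2) + s * β * ta ε t p q r * (ω.2 (Fin.last r)).1
          + cst β s mv (ta ε t p q) r) := by
    intro ω
    rw [zeta_eq B _ le_rfl, Real.log_exp, mul_inv, S4, last_sum (fun j => ta ε t p q j * (ω.2 j).1)]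
    simp only [Fin.val_last]
    field_simp
  have hA : Integrable (fun ω : (Fin m → Fin n → ℝ) × (Fin (r+1) → Us m n) =>
      fK (Lc β s (ph x y)) (thp m n r t mv p q) r
          (Wn r (thp m n r t mv p q) t r ω.1 ω.2) + s * β * ta ε t p q r * (ω.2 (Fin.last r)).1)
      (muAll r m n) := hT.1.add (i4.const_mul _)
  rw [integral_congr_ae (Filter.Eventually.of_forall e), integral_const_mul,
    integral_add hA (integrable_const _), integral_add hT.1 (i4.const_mul _), integral_const_mul, e4, hT.2]
  simp only [mul_zero, add_zero, integral_const, probReal_univ, one_smul]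
  rw [fK, TT, mu_zero (B.mem p q) (Nat.lt_succ_self r), if_pos rfl, PK, Phi,
    mu_zero (B.mem p q) (Nat.lt_succ_self r), EE_zero_one, div_one]

lemma EXR_eq (B : BH r t mv x y) {k : ℕ} (hk : k ≤ r) :
    EXR r ε β s t mv p q x y k = 1 := by
  rw [EXR, EBrR_eq B hk]
  simp only [B.hxu, B.hyu, mul_one]
  exact EBk_one B.hl (B.mem p q) k

/-- normalisation -/
def Kn (n : ℕ) (β s : ℝ) : ℝ := (β * |s| * √(n : ℝ))⁻¹
/-- `p_{k-1} q_{k-1} - p_k q_k` -/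
def V4 (p q : ℕ → ℝ) (k : ℕ) : ℝ := p k * q k - p (k+1) * q (k+1)
/-- `ψ` without the scalar part -/
def Psi (r : ℕ) (β s : ℝ) (t : ℝ) (mv p q : ℕ → ℝ) (x : Fin l → Fin n → ℝ) (y : Fin l → Fin m → ℝ) :
    ℝ := fK (Lc β s (ph x y)) (thp m n r t mv p q) (r+1) 0

lemma cst_eq (ht : 0 ≤ t) (r : ℕ) : cst β s mv (ta ε t p q) r
    = (s*β)^2/2 * (ε^2 * t * ∑ k ∈ Finset.range r, mv (k+1) * max 0 (V4 p q k)) := by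
  unfold cst
  simp only [Finset.mul_sum]
  refine Finset.sum_congr rfl fun k _ => ?_
  have h : √(p k * q k - p (k+1) * q (k+1)) ^ 2 = max 0 (V4 p q k) := by
    unfold V4
    rcases le_total 0 (p k * q k - p (k+1) * q (k+1)) with h | h
    · rw [max_eq_right h, Real.sq_sqrt h]
    · rw [max_eq_left h, Real.sqrt_eq_zero_of_nonpos h]; norm_num
  unfold ta
  rw [← h]
  have ht2 : √t ^ 2 = t := Real.sq_sqrt ht
  calc _ = mv (k+1) * (s*β)^2/2 * ε^2 * √t^2 * √(p k * q k - p (k+1) * q (k+1)) ^ 2 := by ring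
    _ = _ := by rw [ht2]; ring

lemma Kn_c (hn : 1 ≤ n) (hβ : 0 < β) (hs : s ≠ 0) :
    Real.sign s * s * β / (2 * √(n : ℝ)) = Kn n β s * ((s*β)^2/2) := by
  have hn' : (0:ℝ) < √(n:ℝ) := Real.sqrt_pos.2 (by exact_mod_cast hn)
  have h1 : Real.sign s * s = |s| := by
    rcases lt_or_gt_of_ne hs with h | h
    · rw [Real.sign_of_neg h, abs_of_neg h]; ring
    · rw [Real.sign_of_pos h, abs_of_pos h]; ring
  have h2 : 0 < |s| := abs_pos.2 hs
  rw [h1, Kn, mul_pow, ← sq_abs s]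
  field_simp

lemma psiR0_eq (B : BH r t mv x y) :
    psiR r 0 β s t mv p q x y = Kn n β s * Psi r β s t mv p q x y := by
  rw [psiR_eq B, cst_eq B.ht0, Kn, Psi]; ring

lemma psi1R_eq (hn : 1 ≤ n) (hβ : 0 < β) (hs : s ≠ 0) (B : BH r t mv x y) (hme : mv (r+1) = 0) :
    psi1R r 1 β s t mv p q x y = Kn n β s * (Psi r β s t mv p q x y
      + (s*β)^2/2 * ∑ k ∈ Finset.range r, mv (k+1) * (t * max 0 (V4 p q k) - V4 p q k)) := by
  rw [psi1R, Kn_c hn hβ hs, psiR_eq B, cst_eq B.ht0, Finset.sum_range_succ, hme, zero_mul, add_zero]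
  have e : ∑ k ∈ Finset.range r, mv (k+1) * (p k * q k * EXR r 1 β s t mv p q x y k
      - p (k+1) * q (k+1) * EXR r 1 β s t mv p q x y (k+1))
      = ∑ k ∈ Finset.range r, mv (k+1) * V4 p q k := by
    refine Finset.sum_congr rfl fun k hk => ?_
    have := Finset.mem_range.1 hk
    rw [EXR_eq B (by omega), EXR_eq B (by omega), V4, mul_one, mul_one]
  rw [e]
  have e2 : ∑ k ∈ Finset.range r, mv (k+1) * (t * max 0 (V4 p q k) - V4 p q k)
      = t * (∑ k ∈ Finset.range r, mv (k+1) * max 0 (V4 p q k))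
        - ∑ k ∈ Finset.range r, mv (k+1) * V4 p q k := by
    rw [Finset.mul_sum, ← Finset.sum_sub_distrib]
    exact Finset.sum_congr rfl fun k _ => by ring
  rw [e2, Kn, Psi]; ring

end bridge2

section master

/-- one-sided derivative of the positive part of an affine function -/
def md (σ α κ : ℝ) : ℝ := if 0 < α then κ else σ * max 0 (σ * κ)

/-- half line -/
def Hs (σ ρ0 : ℝ) : Set ℝ := {ρ | 0 ≤ σ * (ρ - ρ0)}

lemma Hs_mem (σ ρ0 : ℝ) : ρ0 ∈ Hs σ ρ0 := by simp [Hs]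

lemma Hs_uniq {σ : ℝ} (hσ : σ = 1 ∨ σ = -1) (ρ0 : ℝ) : UniqueDiffWithinAt ℝ (Hs σ ρ0) ρ0 := by
  rcases hσ with rfl | rfl
  · have : Hs 1 ρ0 = Set.Ici ρ0 := by ext; simp [Hs]
    rw [this]; exact uniqueDiffOn_Ici _ _ (Set.mem_Ici.2 le_rfl)
  · have : Hs (-1) ρ0 = Set.Iic ρ0 := by ext; simp [Hs]
    rw [this]; exact uniqueDiffOn_Iic _ _ (Set.mem_Iic.2 le_rfl)

lemma md_deriv {σ : ℝ} (hσ : σ = 1 ∨ σ = -1) {α κ ρ0 : ℝ} (hα : 0 ≤ α) {f : ℝ → ℝ}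
    (hf : ∀ ρ, f ρ = α + κ * (ρ - ρ0)) :
    HasDerivWithinAt (fun ρ => max 0 (f ρ)) (md σ α κ) (Hs σ ρ0) ρ0 := by
  have hd : HasDerivAt f κ ρ0 := by
    have h1 : HasDerivAt (fun ρ : ℝ => α + κ * (ρ - ρ0)) (κ * 1) ρ0 :=
      (((hasDerivAt_id ρ0).sub_const ρ0).const_mul κ).const_add α
    rw [mul_one] at h1
    rwa [show f = fun ρ => α + κ * (ρ - ρ0) from funext hf]
  unfold md
  split_ifs with h
  · have hc : ∀ᶠ ρ in nhds ρ0, 0 < f ρ := by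
      refine hd.continuousAt.eventually (Ioi_mem_nhds ?_)
      rw [hf]; simpa using h
    refine (hd.congr_of_eventuallyEq ?_).hasDerivWithinAt
    filter_upwards [hc] with ρ hρ
    exact max_eq_right hρ.le
  · have h0 : α = 0 := le_antisymm (not_lt.1 h) hα
    have h1 : HasDerivAt (fun ρ : ℝ => (σ * max 0 (σ * κ)) * (ρ - ρ0)) (σ * max 0 (σ * κ) * 1) ρ0 :=
      ((hasDerivAt_id ρ0).sub_const ρ0).const_mul _
    rw [mul_one] at h1
    have key : ∀ ρ ∈ Hs σ ρ0, max 0 (f ρ) = (σ * max 0 (σ * κ)) * (ρ - ρ0) := by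
      intro ρ hρ
      have hρ' : 0 ≤ σ * (ρ - ρ0) := hρ
      have e : f ρ = (σ * κ) * (σ * (ρ - ρ0)) := by
        rw [hf, h0]; rcases hσ with rfl | rfl <;> ring
      rw [e, mul_comm (σ * κ), ← mul_zero (σ * (ρ - ρ0)), ← mul_max_of_nonneg _ _ hρ', mul_zero]
      ring
    exact h1.hasDerivWithinAt.congr key (key ρ0 (Hs_mem _ _))

/-- normalised corrected interpolating function -/
def FF (r : ℕ) (β s : ℝ) (t : ℝ) (mv p q : ℕ → ℝ) (x : Fin l → Fin n → ℝ) (y : Fin l → Fin m → ℝ) :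
    ℝ := Psi r β s t mv p q x y
      + (s*β)^2/2 * ∑ k ∈ Finset.range r, mv (k+1) * (t * max 0 (V4 p q k) - V4 p q k)

variable {r : ℕ} {β s : ℝ} {x : Fin l → Fin n → ℝ} {y : Fin l → Fin m → ℝ}

lemma master (hs : s ≠ 0) (hβ : 0 < β)
    {T : ℝ → ℝ} {p q mv : ℝ → ℕ → ℝ} {S : Set ℝ} {t0 : ℝ} (ht0 : t0 ∈ S)
    (hB : ∀ t ∈ S, BH r (T t) (mv t) x y) (h0 : ∀ t, mv t 0 = 1)
    {T' : ℝ} {a' b' mv' M' V' : ℕ → ℝ}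
    (hT : HasDerivWithinAt T T' S t0)
    (ha : ∀ k, k ≤ r → HasDerivWithinAt (fun t => al (T t) (p t) k) (a' k) S t0)
    (hb : ∀ k, k ≤ r → HasDerivWithinAt (fun t => al (T t) (q t) k) (b' k) S t0)
    (hm : ∀ k, 1 ≤ k → k ≤ r → HasDerivWithinAt (fun t => mv t k) (mv' k) S t0)
    (hM : ∀ k, k < r → HasDerivWithinAt (fun t => max 0 (V4 (p t) (q t) k)) (M' k) S t0)
    (hV : ∀ k, k < r → HasDerivWithinAt (fun t => V4 (p t) (q t) k) (V' k) S t0)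
    {θ : Ix (AA m n) → ℝ} (hθe : θ = thp m n r (T t0) (mv t0) (p t0) (q t0)) :
    HasDerivWithinAt (fun t => FF r β s (T t) (mv t) (p t) (q t) x y)
      ((s*β)^2/2 * (dG β s x y r θ r * T'
        + ∑ k ∈ Finset.range (r+1), (du β s x y r θ k * a' k + dh β s x y r θ k * b' k))
        + ∑ k ∈ Finset.range r, GK (Lc β s (ph x y)) r θ k * mv' (k+1)
        + (s*β)^2/2 * ∑ k ∈ Finset.range r,
          (mv' (k+1) * (T t0 * max 0 (V4 (p t0) (q t0) k) - V4 (p t0) (q t0) k)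
            + mv t0 (k+1) * ((T' * max 0 (V4 (p t0) (q t0) k) + T t0 * M' k) - V' k))) S t0 := by
  have B0 := hB t0 ht0
  refine HasDerivWithinAt.add ?_ ?_
  · exact psi_deriv (mv := mv) B0.hxu hs hβ B0.hl ht0 (fun t ht => (hB t ht).adm (p t) (q t)) h0
      hT ha hb hm hθe
  · refine HasDerivWithinAt.const_mul _ (HasDerivWithinAt.fun_sum fun k hk => ?_)
    have hk' := Finset.mem_range.1 hk
    exact (hm (k+1) (by omega) (by omega)).mul ((hT.mul (hM k hk')).sub (hV k hk'))

lemma psi1_FF (hn : 1 ≤ n) (hβ : 0 < β) (hs : s ≠ 0) {t : ℝ} {mv : ℕ → ℝ} (B : BH r t mv x y)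
    (hme : mv (r+1) = 0) (p q : ℕ → ℝ) :
    psi1R r 1 β s t mv p q x y = Kn n β s * FF r β s t mv p q x y := psi1R_eq hn hβ hs B hme

lemma Kn_pos (hn : 1 ≤ n) (hβ : 0 < β) (hs : s ≠ 0) : 0 < Kn n β s := by
  have hn' : (0:ℝ) < √(n:ℝ) := Real.sqrt_pos.2 (by exact_mod_cast hn)
  have h2 : 0 < |s| := abs_pos.2 hs
  unfold Kn; positivity

/-- two-term sums -/
lemma two_sum {N j : ℕ} (hj : j < N) {f : ℕ → ℝ} (h : ∀ k, k ≠ j → k ≠ j+1 → f k = 0)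
    (hN : j + 1 = N → f (j+1) = 0) : ∑ k ∈ Finset.range N, f k = f j + f (j+1) := by
  have hz : ∀ M, N ≤ M → ∑ k ∈ Finset.range M, f k = ∑ k ∈ Finset.range N, f k := by
    intro M hM
    refine (Finset.sum_subset (Finset.range_mono hM) fun k _ hk => ?_).symm
    rw [Finset.mem_range, not_lt] at hk
    by_cases h1 : k = j + 1
    · subst h1; exact hN (by omega)
    · exact h k (by omega) h1
  rw [← hz (N+1) (by omega)]
  rw [← Finset.sum_subset (s₁ := {j, j+1})]
  · rw [Finset.sum_pair (by omega)]
  · intro k hk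
    simp only [Finset.mem_insert, Finset.mem_singleton] at hk
    rw [Finset.mem_range]; omega
  · intro k _ hk
    simp only [Finset.mem_insert, Finset.mem_singleton, not_or] at hk
    exact h k hk.1 hk.2

/-- coefficient of the variation -/
def kap (j k : ℕ) : ℝ := if k = j then -1 else if k = j + 1 then 1 else 0

lemma upd_diff (p : ℕ → ℝ) (j k : ℕ) (ρ : ℝ) :
    Function.update p (j+1) ρ k - Function.update p (j+1) ρ (k+1)
      = (p k - p (k+1)) + kap j k * (ρ - p (j+1)) := by
  unfold kap
  by_cases h1 : k = j
  · subst h1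
    simp
  · by_cases h2 : k = j + 1
    · subst h2; simp
    · rw [if_neg h1, if_neg h2, Function.update_of_ne h2, Function.update_of_ne (by omega)]; ring

lemma upd_V4 (p q : ℕ → ℝ) (j k : ℕ) (ρ : ℝ) :
    V4 (Function.update p (j+1) ρ) q k
      = V4 p q k + (kap j k * q (j+1)) * (ρ - p (j+1)) := by
  unfold kap V4
  by_cases h1 : k = j
  · subst h1
    simp; ring
  · by_cases h2 : k = j + 1
    · subst h2; simp; ring
    · rw [if_neg h1, if_neg h2, Function.update_of_ne h2, Function.update_of_ne (by omega)]; ring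

lemma V4_comm (p q : ℕ → ℝ) : V4 p q = V4 q p := by funext k; unfold V4; ring

/-- monotone parameters -/
structure Mon (r : ℕ) (p : ℕ → ℝ) : Prop where
  p0 : p 0 = 1
  pe : p (r+1) = 0
  mon : ∀ k ≤ r, p (k+1) ≤ p k

lemma Mon.nonneg {p : ℕ → ℝ} (h : Mon r p) {k : ℕ} (hk : k ≤ r + 1) : 0 ≤ p k := by
  have key : ∀ d k, k + d = r + 1 → 0 ≤ p k := by
    intro d
    induction d with
    | zero => intro k e; rw [show k = r + 1 by omega, h.pe]
    | succ d ih => intro k e; exact (ih (k+1) (by omega)).trans (h.mon k (by omega))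
  exact key (r + 1 - k) k (by omega)

lemma Mon.le_one {p : ℕ → ℝ} (h : Mon r p) {k : ℕ} (hk : k ≤ r + 1) : p k ≤ 1 := by
  induction k with
  | zero => exact h.p0.le
  | succ k ih => exact (h.mon k (by omega)).trans (ih (by omega))

lemma V4_nonneg {p q : ℕ → ℝ} (hp : Mon r p) (hq : Mon r q) {k : ℕ} (hk : k ≤ r) :
    0 ≤ V4 p q k := by
  unfold V4
  have := mul_le_mul (hp.mon k hk) (hq.mon k hk) (hq.nonneg (k := k+1) (by omega))
    (hp.nonneg (k := k) (by omega))
  linarith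

lemma mul_max_al {t : ℝ} {p : ℕ → ℝ} {f : ℝ → ℕ → ℝ} {k : ℕ} {S : Set ℝ} {ρ0 d : ℝ}
    (h : HasDerivWithinAt (fun ρ => max 0 (f ρ k - f ρ (k+1))) d S ρ0) :
    HasDerivWithinAt (fun ρ => al t (f ρ) k) ((1 - t) * d) S ρ0 := h.const_mul _

lemma md_zero {σ α : ℝ} : md σ α 0 = 0 := by unfold md; split_ifs <;> simp

lemma affine_deriv {f : ℝ → ℝ} {α κ ρ0 : ℝ} {S : Set ℝ} (hf : ∀ ρ, f ρ = α + κ * (ρ - ρ0)) :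
    HasDerivWithinAt f κ S ρ0 := by
  have h1 : HasDerivAt (fun ρ : ℝ => α + κ * (ρ - ρ0)) (κ * 1) ρ0 :=
    (((hasDerivAt_id ρ0).sub_const ρ0).const_mul κ).const_add α
  rw [mul_one] at h1
  rw [show f = fun ρ => α + κ * (ρ - ρ0) from funext hf]
  exact h1.hasDerivWithinAt

variable {t : ℝ} {mv p q : ℕ → ℝ}

/-- one-sided stationarity equation -/
def steq (σ t : ℝ) (d mv p q : ℕ → ℝ) (j : ℕ) : Prop :=
  (1 - t) * (d j * md σ (p j - p (j+1)) (-1) + d (j+1) * md σ (p (j+1) - p (j+2)) 1)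
    + (mv (j+1) * (t * md σ (V4 p q j) (-q (j+1)) + q (j+1))
      + mv (j+2) * (t * md σ (V4 p q (j+1)) (q (j+1)) - q (j+1))) = 0

lemma kap_self (j : ℕ) : kap j j = -1 := by simp [kap]
lemma kap_succ (j : ℕ) : kap j (j+1) = 1 := by simp [kap]
lemma kap_ne {j k : ℕ} (h1 : k ≠ j) (h2 : k ≠ j+1) : kap j k = 0 := by simp [kap, h1, h2]

lemma stat_p (hn : 1 ≤ n) (hs : s ≠ 0) (hβ : 0 < β) (B : BH r t mv x y) (hme : mv (r+1) = 0)
    (hp : Mon r p) (hq : Mon r q) {j : ℕ} (hj : j < r)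
    (hst : HasDerivAt (fun ρ => psi1R r 1 β s t mv (Function.update p (j+1) ρ) q x y) 0 (p (j+1)))
    {σ : ℝ} (hσ : σ = 1 ∨ σ = -1) :
    steq σ t (du β s x y r (thp m n r t mv p q)) mv p q j := by
  have hc : 0 < (s*β)^2/2 := by positivity
  have hK := Kn_pos hn hβ hs
  have hM := master (r := r) (β := β) (s := s) (x := x) (y := y) hs hβ (T := fun _ => t)
    (p := fun ρ => Function.update p (j+1) ρ) (q := fun _ => q) (mv := fun _ => mv)
    (S := Hs σ (p (j+1))) (t0 := p (j+1)) (Hs_mem _ _) (fun _ _ => B) (fun _ => B.h0)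
    (T' := 0) (a' := fun k => (1 - t) * md σ (p k - p (k+1)) (kap j k)) (b' := fun _ => 0)
    (mv' := fun _ => 0) (M' := fun k => md σ (V4 p q k) (kap j k * q (j+1)))
    (V' := fun k => kap j k * q (j+1))
    (hasDerivWithinAt_const _ _ _)
    (fun k hk => mul_max_al (p := p) (md_deriv hσ (sub_nonneg.2 (hp.mon k hk))
      (fun ρ => upd_diff p j k ρ)))
    (fun k hk => hasDerivWithinAt_const _ _ _) (fun k _ _ => hasDerivWithinAt_const _ _ _)
    (fun k hk => md_deriv hσ (V4_nonneg hp hq hk.le) (fun ρ => upd_V4 p q j k ρ))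
    (fun k hk => affine_deriv (fun ρ => upd_V4 p q j k ρ))
    (θ := thp m n r t mv p q) (by rw [Function.update_eq_self])
  have h1 := hM.const_mul (Kn n β s)
  have h2 : HasDerivWithinAt (fun ρ => Kn n β s * FF r β s t mv (Function.update p (j+1) ρ) q x y)
      0 (Hs σ (p (j+1))) (p (j+1)) := by
    refine hst.hasDerivWithinAt.congr (fun ρ _ => ?_) ?_ <;>
    exact (psi1_FF hn hβ hs B hme _ _).symm
  have h3 := (Hs_uniq hσ (p (j+1))).eq_deriv _ h2 h1
  rw [eq_comm, mul_eq_zero, or_iff_right hK.ne'] at h3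
  simp only [mul_zero, add_zero, zero_mul, zero_add, Finset.sum_const_zero] at h3
  rw [← mul_add, mul_eq_zero, or_iff_right hc.ne'] at h3
  rw [two_sum (j := j) (by omega), two_sum (j := j) hj] at h3
  · simp only [kap_self, kap_succ, one_mul, neg_mul, sub_neg_eq_add] at h3
    unfold steq
    linear_combination h3
  · intro k k1 k2; simp [kap_ne k1 k2, md_zero]
  · intro h; subst h; simp [hme]
  · intro k k1 k2; simp [kap_ne k1 k2, md_zero]
  · intro h; omega

lemma stat_q (hn : 1 ≤ n) (hs : s ≠ 0) (hβ : 0 < β) (B : BH r t mv x y) (hme : mv (r+1) = 0)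
    (hp : Mon r p) (hq : Mon r q) {j : ℕ} (hj : j < r)
    (hst : HasDerivAt (fun ρ => psi1R r 1 β s t mv p (Function.update q (j+1) ρ) x y) 0 (q (j+1)))
    {σ : ℝ} (hσ : σ = 1 ∨ σ = -1) :
    steq σ t (dh β s x y r (thp m n r t mv p q)) mv q p j := by
  have hc : 0 < (s*β)^2/2 := by positivity
  have hK := Kn_pos hn hβ hs
  have hM := master (r := r) (β := β) (s := s) (x := x) (y := y) hs hβ (T := fun _ => t)
    (q := fun ρ => Function.update q (j+1) ρ) (p := fun _ => p) (mv := fun _ => mv)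
    (S := Hs σ (q (j+1))) (t0 := q (j+1)) (Hs_mem _ _) (fun _ _ => B) (fun _ => B.h0)
    (T' := 0) (b' := fun k => (1 - t) * md σ (q k - q (k+1)) (kap j k)) (a' := fun _ => 0)
    (mv' := fun _ => 0) (M' := fun k => md σ (V4 q p k) (kap j k * p (j+1)))
    (V' := fun k => kap j k * p (j+1))
    (hasDerivWithinAt_const _ _ _)
    (fun k hk => hasDerivWithinAt_const _ _ _)
    (fun k hk => mul_max_al (p := p) (md_deriv hσ (sub_nonneg.2 (hq.mon k hk))
      (fun ρ => upd_diff q j k ρ)))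
    (fun k _ _ => hasDerivWithinAt_const _ _ _)
    (fun k hk => md_deriv hσ (V4_nonneg hq hp hk.le)
      (fun ρ => by rw [V4_comm]; exact upd_V4 q p j k ρ))
    (fun k hk => affine_deriv (fun ρ => by rw [V4_comm]; exact upd_V4 q p j k ρ))
    (θ := thp m n r t mv p q) (by rw [Function.update_eq_self])
  have h1 := hM.const_mul (Kn n β s)
  have h2 : HasDerivWithinAt (fun ρ => Kn n β s * FF r β s t mv p (Function.update q (j+1) ρ) x y)
      0 (Hs σ (q (j+1))) (q (j+1)) := by
    refine hst.hasDerivWithinAt.congr (fun ρ _ => ?_) ?_ <;>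
    exact (psi1_FF hn hβ hs B hme _ _).symm
  have h3 := (Hs_uniq hσ (q (j+1))).eq_deriv _ h2 h1
  rw [eq_comm, mul_eq_zero, or_iff_right hK.ne'] at h3
  simp only [mul_zero, add_zero, zero_mul, zero_add, Finset.sum_const_zero] at h3
  rw [← mul_add, mul_eq_zero, or_iff_right hc.ne'] at h3
  rw [two_sum (j := j) (by omega), two_sum (j := j) hj] at h3
  · simp only [kap_self, kap_succ, one_mul, neg_mul, sub_neg_eq_add] at h3
    unfold steq
    linear_combination h3
  · intro k k1 k2; simp [kap_ne k1 k2, md_zero]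
  · intro h; subst h; simp [hme]
  · intro k k1 k2; simp [kap_ne k1 k2, md_zero]
  · intro h; omega

lemma stat_m (hn : 1 ≤ n) (hs : s ≠ 0) (hβ : 0 < β) (B : BH r t mv x y) (hme : mv (r+1) = 0)
    (hp : Mon r p) (hq : Mon r q) {j : ℕ} (hj : j < r)
    (hst : HasDerivAt (fun ρ => psi1R r 1 β s t (Function.update mv (j+1) ρ) p q x y) 0 (mv (j+1))) :
    GK (Lc β s (ph x y)) r (thp m n r t mv p q) j = (s*β)^2/2 * ((1 - t) * V4 p q j) := by
  have hK := Kn_pos hn hβ hs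
  have hpos := B.hm (j+1) (by omega) (by omega)
  have hB : ∀ ρ ∈ Set.Ioi (0:ℝ), BH r t (Function.update mv (j+1) ρ) x y := by
    intro ρ hρ
    refine ⟨B.hl, B.hxu, B.hyu, B.ht0, B.ht1, ?_, fun k hk1 hk2 => ?_⟩
    · rw [Function.update_of_ne (by omega)]; exact B.h0
    · by_cases h : k = j + 1
      · subst h; rw [Function.update_self]; exact hρ
      · rw [Function.update_of_ne h]; exact B.hm k hk1 hk2
  have hM := master (r := r) (β := β) (s := s) (x := x) (y := y) hs hβ (T := fun _ => t)
    (q := fun ρ => q) (p := fun _ => p) (mv := fun ρ => Function.update mv (j+1) ρ)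
    (S := Set.Ioi 0) (t0 := mv (j+1)) hpos hB
    (fun ρ => by rw [Function.update_of_ne (by omega)]; exact B.h0)
    (T' := 0) (b' := fun k => 0) (a' := fun _ => 0)
    (mv' := fun k => if k = j+1 then 1 else 0) (M' := fun k => 0)
    (V' := fun k => 0)
    (hasDerivWithinAt_const _ _ _)
    (fun k hk => hasDerivWithinAt_const _ _ _)
    (fun k hk => hasDerivWithinAt_const _ _ _)
    (fun k _ _ => by
      by_cases h : k = j + 1
      · subst h; simp only [Function.update_self, if_true]; exact hasDerivWithinAt_id _ _
      · simp only [Function.update_of_ne h, if_neg h]; exact hasDerivWithinAt_const _ _ _)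
    (fun k hk => hasDerivWithinAt_const _ _ _)
    (fun k hk => hasDerivWithinAt_const _ _ _)
    (θ := thp m n r t mv p q) (by rw [Function.update_eq_self])
  have h1 := hM.const_mul (Kn n β s)
  have h2 : HasDerivWithinAt (fun ρ => Kn n β s * FF r β s t (Function.update mv (j+1) ρ) p q x y)
      0 (Set.Ioi 0) (mv (j+1)) := by
    have hme' : ∀ ρ, Function.update mv (j+1) ρ (r+1) = 0 := fun ρ => by
      rw [Function.update_of_ne (by omega)]; exact hme
    refine hst.hasDerivWithinAt.congr (fun ρ hρ => ?_) ?_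
    · exact (psi1_FF hn hβ hs (hB ρ hρ) (hme' ρ) _ _).symm
    · exact (psi1_FF hn hβ hs (hB _ hpos) (hme' _) _ _).symm
  have h3 := (isOpen_Ioi.uniqueDiffWithinAt (𝕜 := ℝ) (Set.mem_Ioi.2 hpos)).eq_deriv _ h2 h1
  rw [eq_comm, mul_eq_zero, or_iff_right hK.ne'] at h3
  simp only [mul_zero, add_zero, zero_mul, zero_add, Finset.sum_const_zero, sub_zero,
    Nat.add_right_cancel_iff, mul_ite, ite_mul, mul_one, one_mul] at h3
  rw [Finset.sum_ite_eq' , Finset.sum_ite_eq', if_pos (Finset.mem_range.2 hj),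
    if_pos (Finset.mem_range.2 hj), max_eq_right (V4_nonneg hp hq hj.le)] at h3
  linear_combination h3

end master

section degenerate

lemma md_pos {σ α κ : ℝ} (h : 0 < α) : md σ α κ = κ := if_pos h
lemma md_one_up {α κ : ℝ} (h : 0 ≤ κ) : md 1 α κ = κ := by
  unfold md; split_ifs <;> simp [h]
lemma md_one_dn {α κ : ℝ} (hα : ¬ 0 < α) (h : 0 ≤ κ) : md 1 α (-κ) = 0 := by
  unfold md; rw [if_neg hα]; simp [h]
lemma md_neg_dn {α κ : ℝ} (h : 0 ≤ κ) : md (-1) α (-κ) = -κ := by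
  unfold md; split_ifs <;> simp [h]
lemma md_neg_up {α κ : ℝ} (hα : ¬ 0 < α) (h : 0 ≤ κ) : md (-1) α κ = 0 := by
  unfold md; rw [if_neg hα]; simp [h]

/-- consequences of the one-sided stationarity equations, nondegenerate case -/
lemma steq_nd {t : ℝ} {d mv p q : ℕ → ℝ} {j : ℕ} (ht1 : t < 1)
    (hq2 : q (j+2) ≤ q (j+1)) (hq1 : q (j+1) ≤ q j) (hQ : 0 ≤ q (j+1))
    (hp2 : p (j+2) ≤ p (j+1)) (hp1 : p (j+1) ≤ p j) (hP : 0 ≤ p (j+2))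
    (hup : steq 1 t d mv p q j) (hdn : steq (-1) t d mv p q j)
    (h : p (j+1) < p j ∨ p (j+2) < p (j+1)) :
    d (j+1) - d j = (mv (j+2) - mv (j+1)) * q (j+1) := by
  have ht : (1 - t) ≠ 0 := by linarith
  apply mul_left_cancel₀ ht
  rcases h with h | h
  · unfold steq at hup
    rw [md_pos (sub_pos.2 h), md_one_up zero_le_one, md_one_up hQ] at hup
    by_cases hV : 0 < V4 p q j
    · rw [md_pos hV] at hup; linear_combination hup
    · have h1 : V4 p q j ≤ 0 := not_lt.1 hV
      unfold V4 at h1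
      have h2 : p j * q (j+1) ≤ p j * q j := mul_le_mul_of_nonneg_left hq1 (by linarith)
      have h3 : (p j - p (j+1)) * q (j+1) ≤ 0 := by linarith
      have h4 : q (j+1) = 0 := by
        by_contra h5
        have := mul_pos (sub_pos.2 h) (lt_of_le_of_ne hQ (Ne.symm h5))
        linarith
      rw [md_one_dn hV hQ] at hup
      rw [h4] at hup ⊢
      linear_combination hup
  · unfold steq at hdn
    rw [md_neg_dn zero_le_one, md_pos (sub_pos.2 h), md_neg_dn hQ] at hdn
    by_cases hV : 0 < V4 p q (j+1)
    · rw [md_pos hV] at hdn; linear_combination hdn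
    · have h1 : V4 p q (j+1) ≤ 0 := not_lt.1 hV
      unfold V4 at h1
      have h2 : p (j+2) * q (j+2) ≤ p (j+2) * q (j+1) := mul_le_mul_of_nonneg_left hq2 hP
      have h3 : (p (j+1) - p (j+2)) * q (j+1) ≤ 0 := by
        have : p (j+1+1) * q (j+1+1) = p (j+2) * q (j+2) := rfl
        linarith
      have h4 : q (j+1) = 0 := by
        by_contra h5
        have := mul_pos (sub_pos.2 h) (lt_of_le_of_ne hQ (Ne.symm h5))
        linarith
      rw [md_neg_up hV hQ] at hdn
      rw [h4] at hdn ⊢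
      linear_combination hdn

/-- consequences of the one-sided stationarity equations, nonnegative derivative -/
lemma steq_nn {t : ℝ} {d mv p q : ℕ → ℝ} {j : ℕ} (ht0 : 0 < t) (ht1 : t < 1)
    (hm1 : 0 < mv (j+1)) (hm2 : 0 ≤ mv (j+2)) (hd0 : 0 ≤ d j) (hd1 : 0 ≤ d (j+1))
    (hq2 : q (j+2) ≤ q (j+1)) (hq1 : q (j+1) ≤ q j) (hQ : 0 ≤ q (j+1))
    (hp2 : p (j+2) ≤ p (j+1)) (hp1 : p (j+1) ≤ p j) (hP : 0 ≤ p (j+2))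
    (hup : steq 1 t d mv p q j) (hdn : steq (-1) t d mv p q j) :
    d (j+1) - d j = (mv (j+2) - mv (j+1)) * q (j+1) := by
  by_cases h : p (j+1) < p j ∨ p (j+2) < p (j+1)
  · exact steq_nd ht1 hq2 hq1 hQ hp2 hp1 hP hup hdn h
  push Not at h
  unfold steq at hup hdn
  rw [md_one_dn (by linarith) zero_le_one, md_one_up zero_le_one, md_one_up hQ] at hup
  rw [md_neg_dn zero_le_one, md_neg_up (by linarith) zero_le_one, md_neg_dn hQ] at hdn
  have hB0 : 0 ≤ md 1 (V4 p q j) (-q (j+1)) + q (j+1) := by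
    by_cases hV : 0 < V4 p q j
    · rw [md_pos hV]; simp
    · rw [md_one_dn hV hQ]; simpa using hQ
  have hB1 : 0 ≤ q (j+1) - md (-1) (V4 p q (j+1)) (q (j+1)) := by
    by_cases hV : 0 < V4 p q (j+1)
    · rw [md_pos hV]; simp
    · rw [md_neg_up hV hQ]; simpa using hQ
  generalize md 1 (V4 p q j) (-q (j+1)) = B0 at *
  generalize md (-1) (V4 p q (j+1)) (q (j+1)) = B1 at *
  have e : (1 - t) * (d j + d (j+1)) + t * (mv (j+1) * (B0 + q (j+1)))
      + t * (mv (j+2) * (q (j+1) - B1)) = 0 := by linear_combination hup - hdn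
  have n1 : 0 ≤ (1 - t) * (d j + d (j+1)) := mul_nonneg (by linarith) (by linarith)
  have n2 : 0 ≤ t * (mv (j+1) * (B0 + q (j+1))) := by positivity
  have n3 : 0 ≤ t * (mv (j+2) * (q (j+1) - B1)) := by positivity
  have z1 : (1 - t) * (d j + d (j+1)) = 0 := by linarith
  have z2 : t * (mv (j+1) * (B0 + q (j+1))) = 0 := by linarith
  rw [mul_eq_zero, or_iff_right (by linarith)] at z1
  have d0 : d j = 0 := by linarith
  have d1 : d (j+1) = 0 := by linarith
  have ht : (1 - t) ≠ 0 := by linarith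
  apply mul_left_cancel₀ ht
  rw [d0, d1]
  rw [d1] at hup
  linear_combination hup - z2

variable {r : ℕ} {β s : ℝ} {x : Fin l → Fin n → ℝ} {y : Fin l → Fin m → ℝ}
  {t : ℝ} {mv p q : ℕ → ℝ}

lemma mu_thp' (B : BH r t mv x y) (hme : mv (r+1) = 0) {k : ℕ} (hk : k ≤ r + 1) :
    mu (thp m n r t mv p q) k = mv k := by
  rcases Nat.lt_or_ge r k with h | h
  · rw [mu_zero (B.mem p q) h, show k = r + 1 by omega, hme]
  · exact mu_thp h

/-- all stationarity equations at one index -/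
structure Stat (r : ℕ) (β s t : ℝ) (mv p q : ℕ → ℝ) (x : Fin l → Fin n → ℝ)
    (y : Fin l → Fin m → ℝ) (j : ℕ) : Prop where
  pu : steq 1 t (du β s x y r (thp m n r t mv p q)) mv p q j
  pd : steq (-1) t (du β s x y r (thp m n r t mv p q)) mv p q j
  qu : steq 1 t (dh β s x y r (thp m n r t mv p q)) mv q p j
  qd : steq (-1) t (dh β s x y r (thp m n r t mv p q)) mv q p j
  sm : GK (Lc β s (ph x y)) r (thp m n r t mv p q) j = (s*β)^2/2 * ((1 - t) * V4 p q j)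

lemma du_succ (θ : Ix (AA m n) → ℝ) (j : ℕ) : du β s x y r θ (j+1) - du β s x y r θ j
    = (mu θ (j+2) - mu θ (j+1)) * Ry β s x y r θ (j+1) := by
  unfold du; rw [Finset.sum_range_succ _ (j+1)]; ring
lemma dh_succ (θ : Ix (AA m n) → ℝ) (j : ℕ) : dh β s x y r θ (j+1) - dh β s x y r θ j
    = (mu θ (j+2) - mu θ (j+1)) * Rx β s x y r θ (j+1) := by
  unfold dh; rw [Finset.sum_range_succ _ (j+1)]; ring

lemma stat_x (hs : s ≠ 0) (hβ : 0 < β) (B : BH r t mv x y) (hme : mv (r+1) = 0)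
    (ht0 : 0 < t) (ht1 : t < 1) (hp : Mon r p) (hq : Mon r q) {j : ℕ} (hj : j < r)
    (h : Stat r β s t mv p q x y j) :
    (mv (j+2) - mv (j+1)) * (Rx β s x y r (thp m n r t mv p q) (j+1) - p (j+1)) = 0 := by
  have hm2 : 0 ≤ mv (j+2) := by
    rcases Nat.lt_or_ge r (j+2) with h | h
    · rw [show j + 2 = r + 1 by omega, hme]
    · exact (B.mpos h).le
  have e := steq_nn ht0 ht1 (B.mpos (k := j+1) (by omega)) hm2
    (dh_nonneg hs hβ B.hxu B.hl (B.mem p q) (k := j) (by omega))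
    (dh_nonneg hs hβ B.hxu B.hl (B.mem p q) (k := j+1) (by omega))
    (hp.mon (j+1) (by omega)) (hp.mon j (by omega)) (hp.nonneg (by omega))
    (hq.mon (j+1) (by omega)) (hq.mon j (by omega)) (hq.nonneg (by omega)) h.qu h.qd
  rw [dh_succ, mu_thp' B hme (by omega), mu_thp' B hme (by omega)] at e
  linear_combination e

lemma stat_y (hs : s ≠ 0) (hβ : 0 < β) (B : BH r t mv x y) (hme : mv (r+1) = 0)
    (ht0 : 0 < t) (ht1 : t < 1) (hp : Mon r p) (hq : Mon r q) {j : ℕ} (hj : j < r)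
    (h : Stat r β s t mv p q x y j) :
    (mv (j+2) - mv (j+1)) * (Ry β s x y r (thp m n r t mv p q) (j+1) - q (j+1)) = 0
      ∨ p (j+1) = 0 ∨ p (j+1) = 1 := by
  have hx := stat_x hs hβ B hme ht0 ht1 hp hq hj h
  have hdh0 := dh_nonneg (y := y) hs hβ B.hxu B.hl (B.mem p q) (k := j) (by omega)
  have hm1 := B.mpos (k := j+1) (by omega)
  by_cases hc : p (j+1) < p j ∨ p (j+2) < p (j+1)
  · left
    have e := steq_nd ht1
      (hq.mon (j+1) (by omega)) (hq.mon j (by omega)) (hq.nonneg (by omega))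
      (hp.mon (j+1) (by omega)) (hp.mon j (by omega)) (hp.nonneg (by omega)) h.pu h.pd hc
    rw [du_succ, mu_thp' B hme (by omega), mu_thp' B hme (by omega)] at e
    linear_combination e
  push Not at hc
  by_cases hP0 : p (j+1) = 0
  · exact Or.inr (Or.inl hP0)
  by_cases hP1 : p (j+1) = 1
  · exact Or.inr (Or.inr hP1)
  left
  have hPn : 0 < p (j+1) := lt_of_le_of_ne (hp.nonneg (by omega)) (Ne.symm hP0)
  have e1 : p j = p (j+1) := le_antisymm hc.1 (hp.mon j (by omega))
  have e2 : p (j+2) = p (j+1) := le_antisymm (hp.mon (j+1) (by omega)) hc.2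
  rcases (hq.mon j (by omega)).eq_or_lt with hqe | hql
  · exfalso
    have hV : V4 q p j = 0 := by unfold V4; rw [e1, hqe]; ring
    have hqu := h.qu
    unfold steq at hqu
    rw [hV, md_one_dn (by linarith) zero_le_one, md_one_up zero_le_one, md_one_up hPn.le,
      md_one_dn (by linarith) hPn.le] at hqu
    have e := dh_succ (β := β) (s := s) (x := x) (y := y) (r := r) (thp m n r t mv p q) j
    rw [mu_thp' B hme (by omega), mu_thp' B hme (by omega)] at e
    have e3 : (1 - t) * dh β s x y r (thp m n r t mv p q) j = - (t * (mv (j+1) * p (j+1))) := by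
      linear_combination hqu - (1 - t) * e - (1 - t) * hx
    have n1 : 0 ≤ (1 - t) * dh β s x y r (thp m n r t mv p q) j := mul_nonneg (by linarith) hdh0
    have n2 : 0 < t * (mv (j+1) * p (j+1)) := by positivity
    linarith
  · rcases mul_eq_zero.1 hx with h0 | h0
    · rw [h0, zero_mul]
    · exfalso
      have hR : Rx β s x y r (thp m n r t mv p q) (j+1) = p (j+1) := by linarith
      obtain ⟨a, i, i', hne⟩ := Rx_ne (β := β) (s := s) (y := y) B.hxu B.hl (B.mem p q)
        (k := j+1) (by rw [hR]; exact hP1)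
      have hg := GK_gt (HL_c (β := β) (s := s) (φ := ph x y) B.hl) (B.mem p q) (k := j) (by omega)
        (Sum.inr (Sum.inr a)) (by
          rw [sg_h B.ht1 (by omega)]
          exact mul_ne_zero (Real.sqrt_pos.2 (by linarith)).ne' (Real.sqrt_pos.2 (by linarith)).ne')
        (fun w => ec_h_pos hs hβ B.hl a hne w)
      rw [h.sm, Fintype.sum_sum_type, Fintype.sum_sum_type] at hg
      simp only [sg_h B.ht1 (show j ≤ r by omega), sg_u B.ht1 (show j ≤ r by omega), sg_G,
        if_neg (show j ≠ r by omega), e1, sub_self, Real.sqrt_zero, mul_zero] at hg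
      simp only [mul_pow, Real.sq_sqrt (show 0 ≤ 1 - t by linarith),
        Real.sq_sqrt (show 0 ≤ q j - q (j+1) by linarith), ← Finset.mul_sum,
        SK_h B.hl (B.mem p q), hR] at hg
      unfold V4 at hg
      rw [e1] at hg
      apply lt_irrefl _ (lt_of_lt_of_eq hg _)
      norm_num
      ring

lemma phi_eq (hs : s ≠ 0) (B : BH r t mv x y) {k : ℕ} (hk : k ≤ r)
    (h : -(s * (mv k - mv (k+1))) * EBrR r 1 β s t mv p q x y k (fun i1 i2 pp1 pp2 =>
      (p k * (nrm2 (x i1) * nrm2 (x pp1)) - dotv (x pp1) (x i1))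
        * (q k * (nrm2 (y i2) * nrm2 (y pp2)) - dotv (y pp2) (y i2))) = 0) :
    (mv (k+1) - mv k) * (RG β s x y r (thp m n r t mv p q) k
      - p k * Ry β s x y r (thp m n r t mv p q) k - q k * Rx β s x y r (thp m n r t mv p q) k
      + p k * q k) = 0 := by
  have e : ∀ i1 i2 pp1 pp2 : Fin l, (p k * (nrm2 (x i1) * nrm2 (x pp1)) - dotv (x pp1) (x i1))
        * (q k * (nrm2 (y i2) * nrm2 (y pp2)) - dotv (y pp2) (y i2))
      = (dotv (x pp1) (x i1) * dotv (y pp2) (y i2) + (-p k) * dotv (y pp2) (y i2))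
        + ((-q k) * dotv (x pp1) (x i1) + (p k * q k) * 1) := by
    intro i1 i2 pp1 pp2
    rw [B.hxu, B.hxu, B.hyu, B.hyu]; ring
  simp only [e] at h
  rw [EBrR_eq B hk, EBk_add, EBk_add, EBk_add, EBk_smul, EBk_smul, EBk_smul,
    EBk_one B.hl (B.mem p q)] at h
  have h2 : s * ((mv (k+1) - mv k) * (RG β s x y r (thp m n r t mv p q) k
      - p k * Ry β s x y r (thp m n r t mv p q) k - q k * Rx β s x y r (thp m n r t mv p q) k
      + p k * q k)) = 0 := by
    unfold RG Ry Rx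
    linear_combination h
  exact (mul_eq_zero.1 h2).resolve_left hs

/-- Abel summation -/
lemma abel {d e a : ℕ → ℝ} {H : ℝ} (hd : ∀ k, d k = H + ∑ j ∈ Finset.range (k+1), e j) (N : ℕ) :
    ∑ k ∈ Finset.range N, d k * (a k - a (k+1))
      = H * a 0 + ∑ j ∈ Finset.range N, e j * a j - (H + ∑ j ∈ Finset.range N, e j) * a N := by
  induction N with
  | zero => simp
  | succ N ih =>
    rw [Finset.sum_range_succ, ih, hd, Finset.sum_range_succ, Finset.sum_range_succ]
    ring

lemma abel_m {mv : ℕ → ℝ} (h0 : mv 0 = 1) (k : ℕ) :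
    mv (k+1) = 1 + ∑ j ∈ Finset.range (k+1), (mv (j+1) - mv j) := by
  rw [Finset.sum_range_sub, h0]; ring

end degenerate

section final

variable {r : ℕ} {β s : ℝ} {x : Fin l → Fin n → ℝ} {y : Fin l → Fin m → ℝ}

lemma path_alg {t : ℝ} {mv p q p' q' mv' : ℕ → ℝ} (B : BH r t mv x y) (hme : mv (r+1) = 0)
    (hp : Mon r p) (hq : Mon r q) (hp0 : p' 0 = 0) (hq0 : q' 0 = 0) (hpe : p' (r+1) = 0)
    (hqe : q' (r+1) = 0) {θ : Ix (AA m n) → ℝ} (hθ : θ = thp m n r t mv p q)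
    (hsm : ∀ j < r, GK (Lc β s (ph x y)) r θ j = (s*β)^2/2 * ((1 - t) * V4 p q j))
    (hphi : ∀ k ≤ r, (mv (k+1) - mv k) * (RG β s x y r θ k
      - p k * Ry β s x y r θ k - q k * Rx β s x y r θ k + p k * q k) = 0)
    (hx : ∀ j < r, (mv (j+2) - mv (j+1)) * (Rx β s x y r θ (j+1) - p (j+1)) = 0)
    (hy : ∀ j < r, (mv (j+2) - mv (j+1)) * (Ry β s x y r θ (j+1) - q (j+1)) * p' (j+1) = 0) :
    (s*β)^2/2 * (dG β s x y r θ r * 1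
        + ∑ k ∈ Finset.range (r+1), (du β s x y r θ k
            * (-(p k - p (k+1)) + (1 - t) * (p' k - p' (k+1)))
          + dh β s x y r θ k * (-(q k - q (k+1)) + (1 - t) * (q' k - q' (k+1)))))
        + ∑ k ∈ Finset.range r, GK (Lc β s (ph x y)) r θ k * mv' (k+1)
        + (s*β)^2/2 * ∑ k ∈ Finset.range r,
          (mv' (k+1) * (t * V4 p q k - V4 p q k)
            + mv (k+1) * ((1 * V4 p q k + t * ((p' k * q k + p k * q' k)
                - (p' (k+1) * q (k+1) + p (k+1) * q' (k+1))))
              - ((p' k * q k + p k * q' k) - (p' (k+1) * q (k+1) + p (k+1) * q' (k+1))))) = 0 := by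
  have hmu : ∀ k ≤ r + 1, mu θ k = mv k := fun k hk => by rw [hθ]; exact mu_thp' B hme hk
  have A1 := abel (a := p) (H := Hu β s x y r θ)
    (e := fun j => (mu θ (j+1) - mu θ j) * Ry β s x y r θ j) (d := du β s x y r θ) (fun k => rfl) (r+1)
  have A2 := abel (a := q) (H := 1)
    (e := fun j => (mu θ (j+1) - mu θ j) * Rx β s x y r θ j) (d := dh β s x y r θ) (fun k => rfl) (r+1)
  have A3 := abel (a := p') (H := Hu β s x y r θ)
    (e := fun j => (mu θ (j+1) - mu θ j) * Ry β s x y r θ j) (d := du β s x y r θ) (fun k => rfl) (r+1)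
  have A4 := abel (a := q') (H := 1)
    (e := fun j => (mu θ (j+1) - mu θ j) * Rx β s x y r θ j) (d := dh β s x y r θ) (fun k => rfl) (r+1)
  have A5 := abel (a := fun k => p k * q k) (H := 1) (e := fun j => mv (j+1) - mv j)
    (d := fun k => mv (k+1)) (fun k => abel_m B.h0 k) (r+1)
  have A6 := abel (a := fun k => p' k * q k + p k * q' k) (H := 1) (e := fun j => mv (j+1) - mv j)
    (d := fun k => mv (k+1)) (fun k => abel_m B.h0 k) (r+1)
  simp only [hp.p0, hp.pe, hq.p0, hq.pe, hp0, hq0, hpe, hqe, mul_zero, add_zero, sub_zero,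
    mul_one, zero_add] at A1 A2 A3 A4 A5 A6
  rw [Finset.sum_range_succ, hme, zero_mul, add_zero] at A5 A6
  have cg : ∀ f : ℕ → ℝ, ∑ j ∈ Finset.range (r+1), (mu θ (j+1) - mu θ j) * f j
      = ∑ j ∈ Finset.range (r+1), (mv (j+1) - mv j) * f j := fun f =>
    Finset.sum_congr rfl fun j hj => by
      have := Finset.mem_range.1 hj
      rw [hmu _ (by omega), hmu _ (by omega)]
  have I : ∑ j ∈ Finset.range (r+1), (mv (j+1) - mv j) * RG β s x y r θ j
      - ∑ j ∈ Finset.range (r+1), (mv (j+1) - mv j) * (Ry β s x y r θ j * p j)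
      - ∑ j ∈ Finset.range (r+1), (mv (j+1) - mv j) * (Rx β s x y r θ j * q j)
      + ∑ j ∈ Finset.range (r+1), (mv (j+1) - mv j) * (p j * q j) = 0 := by
    rw [← Finset.sum_sub_distrib, ← Finset.sum_sub_distrib, ← Finset.sum_add_distrib]
    refine Finset.sum_eq_zero fun j hj => ?_
    have := Finset.mem_range.1 hj
    linear_combination hphi j (by omega)
  have II : ∑ j ∈ Finset.range (r+1), (mv (j+1) - mv j) * (Ry β s x y r θ j * p' j)
      + ∑ j ∈ Finset.range (r+1), (mv (j+1) - mv j) * (Rx β s x y r θ j * q' j)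
      - ∑ j ∈ Finset.range (r+1), (mv (j+1) - mv j) * (p' j * q j + p j * q' j) = 0 := by
    rw [← Finset.sum_add_distrib, ← Finset.sum_sub_distrib]
    refine Finset.sum_eq_zero fun j hj => ?_
    have := Finset.mem_range.1 hj
    cases j with
    | zero => rw [hp0, hq0]; ring
    | succ j => linear_combination hy j (by omega) + q' (j+1) * hx j (by omega)
  simp only [mul_assoc, cg] at A1 A2 A3 A4
  have G : dG β s x y r θ r = Hu β s x y r θ
      + ∑ j ∈ Finset.range (r+1), (mv (j+1) - mv j) * RG β s x y r θ j := by
    rw [dG, cg]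
  have E1 : ∑ k ∈ Finset.range (r+1), (du β s x y r θ k
            * (-(p k - p (k+1)) + (1 - t) * (p' k - p' (k+1)))
          + dh β s x y r θ k * (-(q k - q (k+1)) + (1 - t) * (q' k - q' (k+1))))
      = -(∑ k ∈ Finset.range (r+1), du β s x y r θ k * (p k - p (k+1)))
        + (1 - t) * (∑ k ∈ Finset.range (r+1), du β s x y r θ k * (p' k - p' (k+1)))
        - (∑ k ∈ Finset.range (r+1), dh β s x y r θ k * (q k - q (k+1)))
        + (1 - t) * (∑ k ∈ Finset.range (r+1), dh β s x y r θ k * (q' k - q' (k+1))) := by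
    rw [Finset.mul_sum, Finset.mul_sum, ← Finset.sum_neg_distrib, ← Finset.sum_add_distrib,
      ← Finset.sum_sub_distrib, ← Finset.sum_add_distrib]
    exact Finset.sum_congr rfl fun k _ => by ring
  have E2 : ∑ k ∈ Finset.range r, GK (Lc β s (ph x y)) r θ k * mv' (k+1)
      = (s*β)^2/2 * ∑ k ∈ Finset.range r, (1 - t) * V4 p q k * mv' (k+1) := by
    rw [Finset.mul_sum]
    refine Finset.sum_congr rfl fun k hk => ?_
    rw [hsm k (Finset.mem_range.1 hk)]; ring
  have E3 : ∑ k ∈ Finset.range r,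
          (mv' (k+1) * (t * V4 p q k - V4 p q k)
            + mv (k+1) * ((1 * V4 p q k + t * ((p' k * q k + p k * q' k)
                - (p' (k+1) * q (k+1) + p (k+1) * q' (k+1))))
              - ((p' k * q k + p k * q' k) - (p' (k+1) * q (k+1) + p (k+1) * q' (k+1)))))
      = -(∑ k ∈ Finset.range r, (1 - t) * V4 p q k * mv' (k+1))
        + (∑ k ∈ Finset.range r, mv (k+1) * (p k * q k - p (k+1) * q (k+1)))
        - (1 - t) * (∑ k ∈ Finset.range r, mv (k+1) * (p' k * q k + p k * q' k
            - (p' (k+1) * q (k+1) + p (k+1) * q' (k+1)))) := by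
    rw [Finset.mul_sum, ← Finset.sum_neg_distrib, ← Finset.sum_add_distrib,
      ← Finset.sum_sub_distrib]
    exact Finset.sum_congr rfl fun k _ => by unfold V4; ring
  rw [E1, E2, E3, G, A1, A2, A3, A4, A5, A6]
  linear_combination (s*β)^2/2 * I + (s*β)^2/2 * (1 - t) * II

/-- the parameter path -/
structure Path (r : ℕ) (pb qb mb : ℝ → ℕ → ℝ) (x : Fin l → Fin n → ℝ) (y : Fin l → Fin m → ℝ) :
    Prop where
  hdp : ∀ k, Differentiable ℝ (fun τ => pb τ k)
  hdq : ∀ k, Differentiable ℝ (fun τ => qb τ k)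
  hdm : ∀ k, Differentiable ℝ (fun τ => mb τ k)
  hp : ∀ τ, Mon r (pb τ)
  hq : ∀ τ, Mon r (qb τ)
  h0 : ∀ τ, mb τ 0 = 1
  hme : ∀ τ, mb τ (r+1) = 0
  hB : ∀ τ ∈ Set.Icc (0:ℝ) 1, BH r τ (mb τ) x y

variable {pb qb mb : ℝ → ℕ → ℝ}

lemma al_mon {p : ℕ → ℝ} (hp : Mon r p) {t : ℝ} {k : ℕ} (hk : k ≤ r) :
    al t p k = (1 - t) * (p k - p (k+1)) := by
  rw [al, max_eq_right (sub_nonneg.2 (hp.mon k hk))]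

lemma al_deriv {f : ℝ → ℕ → ℝ} (hd : ∀ k, Differentiable ℝ (fun τ => f τ k)) (hf : ∀ τ, Mon r (f τ))
    {k : ℕ} (hk : k ≤ r) (τ : ℝ) : HasDerivAt (fun t => al t (f t) k)
      (-(f τ k - f τ (k+1)) + (1 - τ) * (deriv (fun t => f t k) τ - deriv (fun t => f t (k+1)) τ)) τ := by
  have h1 : HasDerivAt (fun t : ℝ => 1 - t) (-1) τ := by
    simpa using (hasDerivAt_id τ).const_sub 1
  have h2 := h1.mul ((hd k τ).hasDerivAt.sub (hd (k+1) τ).hasDerivAt)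
  have e : (fun t => al t (f t) k)
      = (fun t : ℝ => 1 - t) * ((fun t => f t k) - fun t => f t (k+1)) := by
    funext t; rw [al_mon (hf t) hk]; rfl
  rw [e]
  refine h2.congr_deriv ?_
  simp only [Pi.sub_apply]
  ring

lemma deriv_bdry {f : ℝ → ℕ → ℝ} (hf : ∀ τ, Mon r (f τ)) {k : ℕ} (hk : k ≤ r + 1) {τ : ℝ}
    (h : f τ k = 0 ∨ f τ k = 1) : deriv (fun t => f t k) τ = 0 := by
  rcases h with h | h
  · exact IsLocalMin.deriv_eq_zero (Filter.Eventually.of_forall fun t => by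
      simp only [h]; exact (hf t).nonneg hk)
  · exact IsLocalMax.deriv_eq_zero (Filter.Eventually.of_forall fun t => by
      simp only [h]; exact (hf t).le_one hk)

lemma path_deriv (hs : s ≠ 0) (hβ : 0 < β) (P : Path r pb qb mb x y) {τ : ℝ}
    (hτ : τ ∈ Set.Ioo (0:ℝ) 1)
    (hst : ∀ j < r, Stat r β s τ (mb τ) (pb τ) (qb τ) x y j)
    (hphi : ∀ k ≤ r, (mb τ (k+1) - mb τ k) * (RG β s x y r (thp m n r τ (mb τ) (pb τ) (qb τ)) k
      - pb τ k * Ry β s x y r (thp m n r τ (mb τ) (pb τ) (qb τ)) k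
      - qb τ k * Rx β s x y r (thp m n r τ (mb τ) (pb τ) (qb τ)) k + pb τ k * qb τ k) = 0) :
    HasDerivAt (fun t => FF r β s t (mb t) (pb t) (qb t) x y) 0 τ := by
  have hBτ := P.hB τ (Set.Ioo_subset_Icc_self hτ)
  have hV : ∀ k, HasDerivAt (fun t => V4 (pb t) (qb t) k)
      ((deriv (fun t => pb t k) τ * qb τ k + pb τ k * deriv (fun t => qb t k) τ)
        - (deriv (fun t => pb t (k+1)) τ * qb τ (k+1) + pb τ (k+1) * deriv (fun t => qb t (k+1)) τ)) τ :=
    fun k => ((P.hdp k τ).hasDerivAt.mul (P.hdq k τ).hasDerivAt).sub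
      ((P.hdp (k+1) τ).hasDerivAt.mul (P.hdq (k+1) τ).hasDerivAt)
  have hM := master (r := r) (β := β) (s := s) (x := x) (y := y) hs hβ (T := fun t => t)
    (q := qb) (p := pb) (mv := mb) (S := Set.Ioo 0 1) (t0 := τ) hτ
    (fun t ht => P.hB t (Set.Ioo_subset_Icc_self ht)) P.h0
    (T' := 1) (mv' := fun k => deriv (fun t => mb t k) τ)
    (hasDerivWithinAt_id _ _)
    (fun k hk => (al_deriv P.hdp P.hp hk τ).hasDerivWithinAt)
    (fun k hk => (al_deriv P.hdq P.hq hk τ).hasDerivWithinAt)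
    (fun k _ _ => (P.hdm k τ).hasDerivAt.hasDerivWithinAt)
    (fun k hk => by
      have e : (fun t => max 0 (V4 (pb t) (qb t) k)) = fun t => V4 (pb t) (qb t) k :=
        funext fun t => max_eq_right (V4_nonneg (P.hp t) (P.hq t) hk.le)
      rw [e]; exact (hV k).hasDerivWithinAt)
    (fun k hk => (hV k).hasDerivWithinAt) rfl
  refine (hM.hasDerivAt (isOpen_Ioo.mem_nhds hτ)).congr_deriv ?_
  have hmx : ∀ k ∈ Finset.range r, max 0 (V4 (pb τ) (qb τ) k) = V4 (pb τ) (qb τ) k := fun k hk =>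
    max_eq_right (V4_nonneg (P.hp τ) (P.hq τ) (Finset.mem_range.1 hk).le)
  have key := path_alg (β := β) (s := s) (p' := fun k => deriv (fun t => pb t k) τ)
    (q' := fun k => deriv (fun t => qb t k) τ) (mv' := fun k => deriv (fun t => mb t k) τ)
    hBτ (P.hme τ) (P.hp τ) (P.hq τ)
    (deriv_bdry P.hp (by omega) (Or.inr (P.hp τ).p0)) (deriv_bdry P.hq (by omega) (Or.inr (P.hq τ).p0))
    (deriv_bdry P.hp (by omega) (Or.inl (P.hp τ).pe)) (deriv_bdry P.hq (by omega) (Or.inl (P.hq τ).pe))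
    rfl (fun j hj => (hst j hj).sm) hphi
    (fun j hj => stat_x hs hβ hBτ (P.hme τ) hτ.1 hτ.2 (P.hp τ) (P.hq τ) hj (hst j hj))
    (fun j hj => by
      rcases stat_y hs hβ hBτ (P.hme τ) hτ.1 hτ.2 (P.hp τ) (P.hq τ) hj (hst j hj) with h | h
      · rw [h, zero_mul]
      · simp only [deriv_bdry P.hp (k := j+1) (by omega) h, mul_zero])
  refine Eq.trans ?_ key
  congr 2
  refine Finset.sum_congr rfl fun k hk => ?_
  rw [hmx k hk]

lemma path_cont (P : Path r pb qb mb x y) :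
    ContinuousOn (fun t => FF r β s t (mb t) (pb t) (qb t) x y) (Set.Icc 0 1) := by
  have hl := (P.hB 0 (by simp)).hl
  have cV : ∀ k, Continuous (fun t => V4 (pb t) (qb t) k) := fun k =>
    ((P.hdp k).continuous.mul (P.hdq k).continuous).sub
      ((P.hdp (k+1)).continuous.mul (P.hdq (k+1)).continuous)
  refine ContinuousOn.add ?_ (Continuous.continuousOn ?_)
  · refine psi_cont (T := fun t => t) (a := fun t => al t (pb t)) (b := fun t => al t (qb t)) (mv := mb)
      hl (fun t ht => (P.hB t ht).adm (pb t) (qb t)) continuousOn_id ?_ ?_ ?_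
    · exact fun k hk t _ => (al_deriv P.hdp P.hp hk t).continuousAt.continuousWithinAt
    · exact fun k hk t _ => (al_deriv P.hdq P.hq hk t).continuousAt.continuousWithinAt
    · exact fun k hk => (P.hdm k).continuous.continuousOn
  · refine continuous_const.mul (continuous_finsetSum _ fun k _ => ?_)
    exact (P.hdm (k+1)).continuous.mul ((continuous_id.mul (continuous_const.max (cV k))).sub (cV k))

lemma path_final (hn : 1 ≤ n) (hs : s ≠ 0) (hβ : 0 < β) (P : Path r pb qb mb x y)
    (hd : ∀ τ ∈ Set.Ioo (0:ℝ) 1, HasDerivAt (fun t => FF r β s t (mb t) (pb t) (qb t) x y) 0 τ) :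
    psiR r 0 β s 1 (mb 1) (pb 1) (qb 1) x y = -(Real.sign s * s * β / (2 * √(n : ℝ)))
      * (∑ k ∈ Finset.range (r+1), (pb 0 k * qb 0 k - pb 0 (k+1) * qb 0 (k+1)) * mb 0 (k+1))
      + psiR r 0 β s 0 (mb 0) (pb 0) (qb 0) x y := by
  obtain ⟨c, hc, hs'⟩ := exists_hasDerivAt_eq_slope (fun t => FF r β s t (mb t) (pb t) (qb t) x y)
    (fun _ => 0) zero_lt_one (path_cont P) hd
  have hF : FF r β s 1 (mb 1) (pb 1) (qb 1) x y = FF r β s 0 (mb 0) (pb 0) (qb 0) x y := by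
    simp only [sub_zero, div_one] at hs'
    linarith
  rw [psiR0_eq (P.hB 1 (by simp)), psiR0_eq (P.hB 0 (by simp)), Kn_c hn hβ hs,
    Finset.sum_range_succ, P.hme, mul_zero, add_zero]
  unfold FF at hF
  have e1 : ∑ k ∈ Finset.range r, mb 1 (k+1) * (1 * max 0 (V4 (pb 1) (qb 1) k) - V4 (pb 1) (qb 1) k)
      = 0 := Finset.sum_eq_zero fun k hk => by
    rw [max_eq_right (V4_nonneg (P.hp 1) (P.hq 1) (Finset.mem_range.1 hk).le)]; ring
  have e0 : ∑ k ∈ Finset.range r, mb 0 (k+1) * (0 * max 0 (V4 (pb 0) (qb 0) k) - V4 (pb 0) (qb 0) k)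
      = -∑ k ∈ Finset.range r, (pb 0 k * qb 0 k - pb 0 (k+1) * qb 0 (k+1)) * mb 0 (k+1) := by
    rw [← Finset.sum_neg_distrib]
    exact Finset.sum_congr rfl fun k _ => by unfold V4; ring
  rw [e1, e0] at hF
  linear_combination Kn n β s * hF

end final

/-- Complete sfl RDT frame (unit norms): along a stationary admissible path, the value of
`ψ_S` at `t = 1` is determined by its value at `t = 0` plus an explicit correction. -/
theorem complete_sfl_rdt_frame
    (r m n l : ℕ) (hr : 1 ≤ r) (hm : 1 ≤ m) (hn : 1 ≤ n) (hl : 1 ≤ l)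
    (β s : ℝ) (hβ : 0 < β) (hs : s ≠ 0)
    (x : Fin l → Fin n → ℝ) (y : Fin l → Fin m → ℝ)
    (hx : ∀ i, x i ≠ 0) (hy : ∀ i, y i ≠ 0)
    (pb qb mb : ℝ → ℕ → ℝ)
    (hdp : ∀ k, Differentiable ℝ (fun τ => pb τ k))
    (hdq : ∀ k, Differentiable ℝ (fun τ => qb τ k))
    (hdm : ∀ k, Differentiable ℝ (fun τ => mb τ k))
    (hpb0 : ∀ τ, pb τ 0 = 1) (hqb0 : ∀ τ, qb τ 0 = 1) (hmb0 : ∀ τ, mb τ 0 = 1)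
    (hpbe : ∀ τ, pb τ (r+1) = 0) (hqbe : ∀ τ, qb τ (r+1) = 0) (hmbe : ∀ τ, mb τ (r+1) = 0)
    (hpbm : ∀ τ, ∀ k ≤ r, pb τ (k+1) ≤ pb τ k) (hqbm : ∀ τ, ∀ k ≤ r, qb τ (k+1) ≤ qb τ k)
    (hmbpos : ∀ τ, ∀ k, 1 ≤ k → k ≤ r → 0 < mb τ k)
    (hstatp : ∀ τ ∈ Set.Ioo (0:ℝ) 1, ∀ k1, 1 ≤ k1 → k1 ≤ r →
      HasDerivAt
        (fun ρ => psi1R r 1 β s τ (mb τ) (Function.update (pb τ) k1 ρ) (qb τ) x y)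
        0 (pb τ k1))
    (hstatq : ∀ τ ∈ Set.Ioo (0:ℝ) 1, ∀ k1, 1 ≤ k1 → k1 ≤ r →
      HasDerivAt
        (fun ρ => psi1R r 1 β s τ (mb τ) (pb τ) (Function.update (qb τ) k1 ρ) x y)
        0 (qb τ k1))
    (hstatm : ∀ τ ∈ Set.Ioo (0:ℝ) 1, ∀ k1, 1 ≤ k1 → k1 ≤ r →
      HasDerivAt
        (fun ρ => psi1R r 1 β s τ (Function.update (mb τ) k1 ρ) (pb τ) (qb τ) x y)
        0 (mb τ k1))
    (hphi : ∀ τ ∈ Set.Ioo (0:ℝ) 1, ∀ k1, 1 ≤ k1 → k1 ≤ r + 1 →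
      -(s * (mb τ (k1-1) - mb τ k1)) *
          EBrR r 1 β s τ (mb τ) (pb τ) (qb τ) x y (k1-1)
            (fun i1 i2 pp1 pp2 =>
              (pb τ (k1-1) * (nrm2 (x i1) * nrm2 (x pp1)) - dotv (x pp1) (x i1)) *
                (qb τ (k1-1) * (nrm2 (y i2) * nrm2 (y pp2)) - dotv (y pp2) (y i2))) = 0)
    (hxu : ∀ i, nrm2 (x i) = 1) (hyu : ∀ i, nrm2 (y i) = 1) :
    psiR r 0 β s 1 (mb 1) (pb 1) (qb 1) x y
      = -(Real.sign s * s * β / (2 * Real.sqrt (n : ℝ))) *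
          (∑ k ∈ Finset.range (r+1),
            (pb 0 k * qb 0 k - pb 0 (k+1) * qb 0 (k+1)) * mb 0 (k+1))
        + psiR r 0 β s 0 (mb 0) (pb 0) (qb 0) x y := by
  have P : Path r pb qb mb x y :=
    ⟨hdp, hdq, hdm, fun τ => ⟨hpb0 τ, hpbe τ, hpbm τ⟩, fun τ => ⟨hqb0 τ, hqbe τ, hqbm τ⟩, hmb0, hmbe,
      fun τ hτ => ⟨hl, hxu, hyu, hτ.1, hτ.2, hmb0 τ, hmbpos τ⟩⟩
  refine path_final hn hs hβ P fun τ hτ => path_deriv hs hβ P hτ (fun j hj => ?_) (fun k hk => ?_)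
  · have B := P.hB τ (Set.Ioo_subset_Icc_self hτ)
    have h1 : 1 ≤ j + 1 := by omega
    have h2 : j + 1 ≤ r := hj
    exact ⟨stat_p hn hs hβ B (hmbe τ) (P.hp τ) (P.hq τ) hj (hstatp τ hτ _ h1 h2) (Or.inl rfl),
      stat_p hn hs hβ B (hmbe τ) (P.hp τ) (P.hq τ) hj (hstatp τ hτ _ h1 h2) (Or.inr rfl),
      stat_q hn hs hβ B (hmbe τ) (P.hp τ) (P.hq τ) hj (hstatq τ hτ _ h1 h2) (Or.inl rfl),
      stat_q hn hs hβ B (hmbe τ) (P.hp τ) (P.hq τ) hj (hstatq τ hτ _ h1 h2) (Or.inr rfl),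
      stat_m hn hs hβ B (hmbe τ) (P.hp τ) (P.hq τ) hj (hstatm τ hτ _ h1 h2)⟩
  · exact phi_eq hs (P.hB τ (Set.Ioo_subset_Icc_self hτ)) hk
      (hphi τ hτ (k+1) (by omega) (by omega))

end

end SFLR
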